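/- arXiv:2202.03336 — 3 statements merged into one kernel-verified Lean document; each statement's English description precedes it below -/
import Mathlib

section
/- (Lemma 3, case h = ∞, H ∈ ℝ.) Assume ∫₀¹ q(x)dx = 0. The nodal points xₙʲ of the eigenfunction φ(·,λₙ) of the problem with conditions y(0) = 0 and y'(1) + H·y(1) − γ₁·y(ξ₁) = 0 satisfy, as n → ∞, xₙʲ = j/(n + 1/2) − [(H − (−1)ⁿγ₁·sin((n + 1/2)πξ₁))/((n + 1/2)²π²)]·(j/(n + 1/2)) + Q(xₙʲ)/((n + 1/2)²π²) + o(1/n²), uniformly in j. -/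
open Set Filter Asymptotics

/-- `y`, with derivative `y'`, solves `-y'' + q y = lam y` on `[0,1]`. -/
def IsSLSolution (q : ℝ → ℝ) (lam : ℂ) (y y' : ℝ → ℂ) : Prop :=
  (∀ x ∈ Set.Icc (0:ℝ) 1, HasDerivWithinAt y (y' x) (Set.Icc 0 1) x) ∧
  (∀ x ∈ Set.Icc (0:ℝ) 1, HasDerivWithinAt y' (((q x : ℂ) - lam) * y x) (Set.Icc 0 1) x)

/-- The boundary form `V(y) = y'(1) + H y(1) - γ₁ y(ξ₁)`. -/
def Vform (H γ1 ξ1 : ℝ) (y y' : ℝ → ℂ) : ℂ := y' 1 + (H:ℂ) * y 1 - (γ1:ℂ) * y ξ1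

/-- `lam` enumerates the zeros of `Δ` (the eigenvalues), ordered by modulus. -/
def EnumeratesZeros (Δ : ℂ → ℂ) (lam : ℕ → ℂ) : Prop :=
  Function.Injective lam ∧ (∀ n, Δ (lam n) = 0) ∧ (∀ μ : ℂ, Δ μ = 0 → ∃ n, lam n = μ) ∧
    Monotone fun n => ‖lam n‖

/-- For every `n ≥ N0`, the numbers `X n j`, `jlo n ≤ j ≤ jhi n`, are exactly the zeros
(nodal points) of the `n`-th eigenfunction `φ(·, lam n)` in `(0,1)`, increasingly ordered. -/
def HasNodalPoints (φ : ℂ → ℝ → ℂ) (lam : ℕ → ℂ) (X : ℕ → ℕ → ℝ)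
    (jlo jhi : ℕ → ℕ) (N0 : ℕ) : Prop :=
  ∀ n ≥ N0,
    (∀ j, jlo n ≤ j → j ≤ jhi n → X n j ∈ Set.Ioo (0:ℝ) 1 ∧ φ (lam n) (X n j) = 0) ∧
    StrictMonoOn (X n) (Set.Icc (jlo n) (jhi n)) ∧
    (∀ t ∈ Set.Ioo (0:ℝ) 1, φ (lam n) t = 0 → ∃ j, jlo n ≤ j ∧ j ≤ jhi n ∧ t = X n j)

namespace SLNodal

/-- Fundamental theorem of calculus on `[0,1]` for functions continuous on `[0,1]`. -/
lemma hasDeriv_integral {E : Type*} [NormedAddCommGroup E] [NormedSpace ℝ E] [CompleteSpace E]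
    {f : ℝ → E} (hf : ContinuousOn f (Icc 0 1)) {x : ℝ} (hx : x ∈ Icc (0:ℝ) 1) :
    HasDerivWithinAt (fun u => ∫ t in (0:ℝ)..u, f t) (f x) (Icc 0 1) x := by
  have h01 : (0:ℝ) ≤ 1 := zero_le_one
  set g : ℝ → E := IccExtend h01 ((Icc (0:ℝ) 1).domRestrict f) with hg
  have hgc : Continuous g := (continuousOn_iff_continuous_domRestrict.1 hf).Icc_extend'
  have hgf : ∀ t ∈ Icc (0:ℝ) 1, g t = f t := by
    intro t ht
    rw [hg, IccExtend_of_mem h01 _ ht]; rfl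
  have h1 := (hgc.integral_hasStrictDerivAt 0 x).hasDerivAt.hasDerivWithinAt (s := Icc (0:ℝ) 1)
  rw [hgf x hx] at h1
  have key : ∀ u ∈ Icc (0:ℝ) 1, (∫ t in (0:ℝ)..u, f t) = ∫ t in (0:ℝ)..u, g t := by
    intro u hu
    apply intervalIntegral.integral_congr
    intro t ht
    rw [uIcc_of_le hu.1] at ht
    exact (hgf t ⟨ht.1, ht.2.trans hu.2⟩).symm
  exact h1.congr key (key x hx)

lemma eqOn_of_deriv_zero {E : Type*} [NormedAddCommGroup E] [NormedSpace ℝ E]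
    {f f' : ℝ → E} (C : ℝ) (hf : ∀ x ∈ Icc (0:ℝ) 1, HasDerivWithinAt f (f' x) (Icc 0 1) x)
    (hb : ∀ x ∈ Icc (0:ℝ) 1, ‖f' x‖ ≤ C) (hC : 0 ≤ C) {x : ℝ} (hx : x ∈ Icc (0:ℝ) 1) :
    ‖f x - f 0‖ ≤ C := by
  have h := (convex_Icc (0:ℝ) 1).norm_image_sub_le_of_norm_hasDerivWithin_le hf hb
    (left_mem_Icc.2 zero_le_one) hx
  refine h.trans ?_
  rw [sub_zero, Real.norm_of_nonneg hx.1]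
  nlinarith [hx.2]

/-- Energy estimates for `y'' = p y`. -/
lemma energy (p y z : ℝ → ℝ) (r C : ℝ) (hr : 0 < r)
    (hy : ∀ x ∈ Icc (0:ℝ) 1, HasDerivWithinAt y (z x) (Icc 0 1) x)
    (hz : ∀ x ∈ Icc (0:ℝ) 1, HasDerivWithinAt z (p x * y x) (Icc 0 1) x)
    (hp : ∀ x ∈ Icc (0:ℝ) 1, |p x + r ^ 2| ≤ C) {x : ℝ} (hx : x ∈ Icc (0:ℝ) 1) :
    (y 0 = 0 → z 0 = 0 → y x = 0 ∧ z x = 0) ∧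
    (z 0 = 1 → 0 < z x ^ 2 + r ^ 2 * y x ^ 2) := by
  set F : ℝ → ℝ := fun x => z x ^ 2 + r ^ 2 * y x ^ 2 with hF
  have hF0 : ∀ x, 0 ≤ F x := fun x => by simp only [hF]; positivity
  set F' : ℝ → ℝ := fun x => 2 * (p x + r ^ 2) * (y x * z x) with hF'
  have hFd : ∀ x ∈ Icc (0:ℝ) 1, HasDerivWithinAt F (F' x) (Icc 0 1) x := by
    intro x hx
    have := ((hz x hx).pow 2).add (((hy x hx).pow 2).const_mul (r ^ 2))
    refine this.congr_deriv ?_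
    simp only [hF']; push_cast; ring
  have hbd : ∀ x ∈ Icc (0:ℝ) 1, |F' x| ≤ C / r * F x := by
    intro x hx
    have h1 : 2 * r * |y x * z x| ≤ F x := by
      simp only [hF]
      rw [abs_mul]
      nlinarith [sq_nonneg (|z x| - r * |y x|), sq_abs (z x), sq_abs (y x)]
    have h2 : |F' x| = |p x + r ^ 2| * (2 * r * |y x * z x|) / r := by
      simp only [hF']; rw [abs_mul, abs_mul]; simp; field_simp
    rw [h2, div_mul_eq_mul_div]
    gcongr
    · exact (abs_nonneg _).trans (hp x hx)
    · exact hp x hx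
  set c := C / r with hc
  have hE : ∀ (s : ℝ), ∀ x ∈ Icc (0:ℝ) 1, HasDerivWithinAt (fun x => F x * Real.exp (s * x))
      ((F' x + s * F x) * Real.exp (s * x)) (Icc 0 1) x := by
    intro s x hx
    have h1 : HasDerivWithinAt (fun x : ℝ => Real.exp (s * x)) (Real.exp (s * x) * (s * 1)) (Icc 0 1) x :=
      ((hasDerivAt_id x).const_mul s).exp.hasDerivWithinAt
    refine ((hFd x hx).mul h1).congr_deriv ?_
    ring
  have hmono : MonotoneOn (fun x => F x * Real.exp (c * x)) (Icc 0 1) := by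
    apply monotoneOn_of_hasDerivWithinAt_nonneg (convex_Icc 0 1)
      (fun x hx => (hE c x hx).continuousWithinAt)
      (fun x hx => (hE c x (interior_subset hx)).mono interior_subset)
    intro x hx
    have := abs_le.1 (hbd x (interior_subset hx))
    have := Real.exp_pos (c * x)
    apply mul_nonneg _ this.le
    linarith
  have hanti : AntitoneOn (fun x => F x * Real.exp ((-c) * x)) (Icc 0 1) := by
    apply antitoneOn_of_hasDerivWithinAt_nonpos (convex_Icc 0 1)
      (fun x hx => (hE (-c) x hx).continuousWithinAt)
      (fun x hx => (hE (-c) x (interior_subset hx)).mono interior_subset)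
    intro x hx
    have := abs_le.1 (hbd x (interior_subset hx))
    have := Real.exp_pos ((-c) * x)
    apply mul_nonpos_of_nonpos_of_nonneg _ this.le
    linarith
  have h0 : (0:ℝ) ∈ Icc (0:ℝ) 1 := left_mem_Icc.2 zero_le_one
  constructor
  · intro hy0 hz0
    have h := hanti h0 hx hx.1
    have hF00 : F 0 = 0 := by simp [hF, hy0, hz0]
    simp only [hF00, zero_mul] at h
    have h3 : F x ≤ 0 := by
      by_contra hcon
      push Not at hcon
      have := mul_pos hcon (Real.exp_pos ((-c) * x))
      linarith
    have h4 : F x = 0 := le_antisymm h3 (hF0 x)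
    simp only [hF] at h4
    have hz2 : z x ^ 2 = 0 := by nlinarith [sq_nonneg (z x), mul_nonneg (sq_nonneg r) (sq_nonneg (y x))]
    have hy2 : r ^ 2 * y x ^ 2 = 0 := by linarith
    refine ⟨?_, by simpa using hz2⟩
    have : y x ^ 2 = 0 := by
      rcases mul_eq_zero.1 hy2 with h | h
      · exact absurd h (by positivity)
      · exact h
    simpa using this
  · intro hz0
    have h := hmono h0 hx hx.1
    have hF00 : 0 < F 0 := by simp only [hF, hz0]; positivity
    simp only [mul_zero, Real.exp_zero, mul_one] at h
    by_contra hcon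
    push Not at hcon
    have : F x * Real.exp (c * x) ≤ 0 := mul_nonpos_of_nonpos_of_nonneg hcon (Real.exp_pos _).le
    linarith

/-- The Prüfer transformation. -/
lemma prufer (q y z : ℝ → ℝ) (r M : ℝ) (hr : 0 < r) (hqc : ContinuousOn q (Icc 0 1))
    (hM : ∀ x ∈ Icc (0:ℝ) 1, |q x| ≤ M)
    (hy : ∀ x ∈ Icc (0:ℝ) 1, HasDerivWithinAt y (z x) (Icc 0 1) x)
    (hz : ∀ x ∈ Icc (0:ℝ) 1, HasDerivWithinAt z ((q x - r ^ 2) * y x) (Icc 0 1) x)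
    (hy0 : y 0 = 0) (hz0 : z 0 = 1) :
    ∃ u θ : ℝ → ℝ, u 0 = 0 ∧ θ 0 = 0 ∧
      (∀ x ∈ Icc (0:ℝ) 1, z x = Real.exp (u x) * Real.cos (θ x)) ∧
      (∀ x ∈ Icc (0:ℝ) 1, r * y x = Real.exp (u x) * Real.sin (θ x)) ∧
      (∀ x ∈ Icc (0:ℝ) 1, HasDerivWithinAt u
        (q x * (Real.sin (θ x) * Real.cos (θ x)) / r) (Icc 0 1) x) ∧
      (∀ x ∈ Icc (0:ℝ) 1, HasDerivWithinAt θ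
        (r - q x * Real.sin (θ x) ^ 2 / r) (Icc 0 1) x) := by
  set Z : ℝ → ℂ := fun x => (z x : ℂ) + Complex.I * (r * y x : ℝ) with hZ
  have hZne : ∀ x ∈ Icc (0:ℝ) 1, Z x ≠ 0 := by
    intro x hx h
    have hpos := (energy (fun x => q x - r ^ 2) y z r M hr hy hz
      (by intro x hx; simpa using hM x hx) hx).2 hz0
    have h1 := congrArg Complex.re h
    have h2 := congrArg Complex.im h
    simp [hZ] at h1 h2
    rcases h2 with h2 | h2
    · exact hr.ne' h2
    · rw [h1, h2] at hpos; simp at hpos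
  have hZd : ∀ x ∈ Icc (0:ℝ) 1, HasDerivWithinAt Z
      (Complex.I * r * Z x + (q x * y x : ℝ)) (Icc 0 1) x := by
    intro x hx
    refine ((hz x hx).ofReal_comp.add
      ((((hy x hx).const_mul r).ofReal_comp).const_mul Complex.I)).congr_deriv ?_
    simp only [hZ]
    push_cast
    linear_combination (-(r:ℂ)^2 * y x) * Complex.I_sq
  set g : ℝ → ℂ := fun x => Complex.I * r + (q x * y x : ℝ) / Z x with hg
  have hZc : ContinuousOn Z (Icc 0 1) := fun x hx => (hZd x hx).continuousWithinAt
  have hyc : ContinuousOn y (Icc 0 1) := fun x hx => (hy x hx).continuousWithinAt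
  have hgc : ContinuousOn g (Icc 0 1) := by
    apply continuousOn_const.add
    apply ContinuousOn.div _ hZc hZne
    exact Complex.continuous_ofReal.comp_continuousOn (hqc.mul hyc)
  set w : ℝ → ℂ := fun x => ∫ t in (0:ℝ)..x, g t with hw
  have hwd : ∀ x ∈ Icc (0:ℝ) 1, HasDerivWithinAt w (g x) (Icc 0 1) x :=
    fun x hx => hasDeriv_integral hgc hx
  have hw0 : w 0 = 0 := by simp [hw]
  have hZw : ∀ x ∈ Icc (0:ℝ) 1, Z x = Complex.exp (w x) := by
    intro x hx
    have hd : ∀ x ∈ Icc (0:ℝ) 1, HasDerivWithinAt (fun x => Z x * Complex.exp (- w x)) 0 (Icc 0 1) x := by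
      intro x hx
      refine ((hZd x hx).mul ((hwd x hx).neg.cexp)).congr_deriv ?_
      have hne := hZne x hx
      simp only [hg]
      field_simp
      ring
    have h := eqOn_of_deriv_zero 0 hd (by simp) le_rfl hx
    have h2 : Z x * Complex.exp (- w x) = Z 0 * Complex.exp (- w 0) := by
      have := norm_le_zero_iff.1 h
      exact sub_eq_zero.1 this
    have hZ0 : Z 0 = 1 := by simp [hZ, hy0, hz0]
    rw [hw0, hZ0, Complex.exp_neg] at h2
    have := Complex.exp_ne_zero (w x)
    field_simp at h2
    simpa using h2
  have hre : ∀ x ∈ Icc (0:ℝ) 1, z x = Real.exp (w x).re * Real.cos (w x).im := by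
    intro x hx
    have := congrArg Complex.re (hZw x hx)
    rw [Complex.exp_re] at this
    simpa [hZ] using this
  have him : ∀ x ∈ Icc (0:ℝ) 1, r * y x = Real.exp (w x).re * Real.sin (w x).im := by
    intro x hx
    have := congrArg Complex.im (hZw x hx)
    rw [Complex.exp_im] at this
    simpa [hZ] using this
  have hgv : ∀ x ∈ Icc (0:ℝ) 1, g x = 
      ((q x * (Real.sin (w x).im * Real.cos (w x).im) / r : ℝ) : ℂ) +
      ((r - q x * Real.sin (w x).im ^ 2 / r : ℝ) : ℂ) * Complex.I := by
    intro x hx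
    have hne := hZne x hx
    have hrne : (r:ℂ) ≠ 0 := by exact_mod_cast hr.ne'
    have e1 : Z x = (Real.exp (w x).re : ℂ) * ((Real.cos (w x).im : ℂ) + Complex.I * Real.sin (w x).im) := by
      simp only [hZ]; rw [hre x hx, him x hx]; push_cast; ring
    have e2 : (y x : ℂ) = (Real.exp (w x).re : ℂ) * Real.sin (w x).im / r := by
      have : y x = Real.exp (w x).re * Real.sin (w x).im / r := by
        rw [← him x hx]; field_simp
      rw [this]; push_cast; ring
    have e3 : (Real.sin (w x).im : ℂ)^2 + (Real.cos (w x).im : ℂ)^2 = 1 := by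
      exact_mod_cast Real.sin_sq_add_cos_sq _
    have hexp : (Real.exp (w x).re : ℂ) ≠ 0 := by exact_mod_cast (Real.exp_pos _).ne'
    simp only [hg]
    suffices h : ((q x * y x : ℝ) : ℂ) = Z x * (
      ((q x * (Real.sin (w x).im * Real.cos (w x).im) / r : ℝ) : ℂ) -
      ((q x * Real.sin (w x).im ^ 2 / r : ℝ) : ℂ) * Complex.I) by
      rw [h, mul_div_cancel_left₀ _ hne]; push_cast; ring
    push_cast only [Complex.ofReal_mul, Complex.ofReal_div, Complex.ofReal_pow]
    rw [e1, e2]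
    generalize (Real.exp (w x).re : ℂ) = e at *
    generalize (Real.sin (w x).im : ℂ) = s at *
    generalize (Real.cos (w x).im : ℂ) = c at *
    field_simp
    linear_combination (-(q x : ℂ) * s) * e3 + (q x : ℂ) * s ^ 3 * Complex.I_sq
  refine ⟨fun x => (w x).re, fun x => (w x).im, by simp [hw0], by simp [hw0], hre, him, ?_, ?_⟩
  · intro x hx
    have h := Complex.reCLM.hasFDerivAt.comp_hasDerivWithinAt x (hwd x hx)
    refine h.congr_deriv ?_
    rw [hgv x hx]; simp [-Complex.ofReal_mul, -Complex.ofReal_div, -Complex.ofReal_sub]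
  · intro x hx
    have h := Complex.imCLM.hasFDerivAt.comp_hasDerivWithinAt x (hwd x hx)
    refine h.congr_deriv ?_
    rw [hgv x hx]; simp [-Complex.ofReal_mul, -Complex.ofReal_div, -Complex.ofReal_sub]

/-- Asymptotics of the Prüfer angle. -/
lemma theta_bound (q q' θ : ℝ → ℝ) (r M : ℝ) (hr : 1 ≤ r) 
    (hq : ∀ x ∈ Icc (0:ℝ) 1, HasDerivWithinAt q (q' x) (Icc 0 1) x)
    (hM : ∀ x ∈ Icc (0:ℝ) 1, |q x| ≤ M) (hM' : ∀ x ∈ Icc (0:ℝ) 1, |q' x| ≤ M)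
    (hθ0 : θ 0 = 0)
    (hθ : ∀ x ∈ Icc (0:ℝ) 1, HasDerivWithinAt θ
        (r - q x * Real.sin (θ x) ^ 2 / r) (Icc 0 1) x) {x : ℝ} (hx : x ∈ Icc (0:ℝ) 1) :
    |θ x - r * x + ((1/2) * ∫ t in (0:ℝ)..x, q t) / r| ≤ (M ^ 2 + M) / r ^ 2 := by
  have hr0 : 0 < r := by linarith
  have hM0 : 0 ≤ M := (abs_nonneg _).trans (hM 0 (left_mem_Icc.2 zero_le_one))
  have hqc : ContinuousOn q (Icc 0 1) := fun x hx => (hq x hx).continuousWithinAt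
  set G : ℝ → ℝ := fun x => θ x - r * x + ((1/2) * ∫ t in (0:ℝ)..x, q t) / r
    - q x * Real.sin (2 * θ x) / (4 * r ^ 2) with hG
  have hGd : ∀ x ∈ Icc (0:ℝ) 1, HasDerivWithinAt G
      (q x ^ 2 * Real.cos (2 * θ x) * Real.sin (θ x) ^ 2 / (2 * r ^ 3)
        - q' x * Real.sin (2 * θ x) / (4 * r ^ 2)) (Icc 0 1) x := by
    intro x hx
    have h1 := (hθ x hx).sub ((hasDerivWithinAt_id x (Icc (0:ℝ) 1)).const_mul r)
    have h2 := ((hasDeriv_integral hqc hx).const_mul (1/2)).div_const r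
    have h3 := ((hq x hx).mul (((hθ x hx).const_mul 2).sin)).div_const (4 * r ^ 2)
    refine ((h1.add h2).sub h3).congr_deriv ?_
    have : Real.cos (2 * θ x) = 1 - 2 * Real.sin (θ x) ^ 2 := by
      rw [Real.cos_two_mul, Real.cos_sq']; ring
    rw [this]
    field_simp
    ring
  have hb := eqOn_of_deriv_zero ((M ^ 2 / 2 + M / 4) / r ^ 2) hGd (by
    intro x hx
    have s1 := Real.abs_sin_le_one (2 * θ x)
    have s2 := Real.abs_cos_le_one (2 * θ x)
    have s3 : Real.sin (θ x) ^ 2 ≤ 1 := Real.sin_sq_le_one _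
    have s4 : q x ^ 2 ≤ M ^ 2 := by
      have := hM x hx
      rw [← sq_abs]; gcongr
    rw [Real.norm_eq_abs]
    refine (abs_sub _ _).trans ?_
    have t1 : |q x ^ 2 * Real.cos (2 * θ x) * Real.sin (θ x) ^ 2 / (2 * r ^ 3)| ≤ (M ^ 2 / 2) / r ^ 2 := by
      rw [abs_div, abs_mul, abs_mul, abs_of_nonneg (sq_nonneg (q x)),
        abs_of_nonneg (sq_nonneg (Real.sin (θ x))), abs_of_pos (by positivity : 0 < 2 * r ^ 3)]
      have : M ^ 2 / 2 / r ^ 2 = M ^ 2 * 1 * 1 / (2 * r ^ 2) := by field_simp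
      rw [this]
      have hr3 : r ^ 2 ≤ r ^ 3 := pow_le_pow_right₀ hr (by norm_num)
      gcongr
    have t2 : |q' x * Real.sin (2 * θ x) / (4 * r ^ 2)| ≤ (M / 4) / r ^ 2 := by
      rw [abs_div, abs_mul, abs_of_pos (by positivity : 0 < 4 * r ^ 2)]
      have : M / 4 / r ^ 2 = M * 1 / (4 * r ^ 2) := by field_simp
      rw [this]
      have := hM' x hx
      gcongr
    rw [add_div]
    exact add_le_add t1 t2) (by positivity) hx
  have hG0 : G 0 = 0 := by simp [hG, hθ0]
  rw [hG0, sub_zero, Real.norm_eq_abs] at hb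
  have t3 : |q x * Real.sin (2 * θ x) / (4 * r ^ 2)| ≤ (M / 4) / r ^ 2 := by
      rw [abs_div, abs_mul, abs_of_pos (by positivity : 0 < 4 * r ^ 2)]
      have : M / 4 / r ^ 2 = M * 1 / (4 * r ^ 2) := by field_simp
      rw [this]
      have := hM x hx
      have s1 := Real.abs_sin_le_one (2 * θ x)
      gcongr
  have e : θ x - r * x + ((1/2) * ∫ t in (0:ℝ)..x, q t) / r = 
     G x + q x * Real.sin (2 * θ x) / (4 * r ^ 2) := by simp only [hG]; ring
  rw [e]
  refine (abs_add_le _ _).trans ((add_le_add hb t3).trans ?_)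
  rw [← add_div]
  apply div_le_div_of_nonneg_right _ (by positivity)
  nlinarith [sq_nonneg M]

lemma u_bound (q u θ : ℝ → ℝ) (r M : ℝ) (hr : 0 < r) 
    (hM : ∀ x ∈ Icc (0:ℝ) 1, |q x| ≤ M)
    (hu0 : u 0 = 0)
    (hu : ∀ x ∈ Icc (0:ℝ) 1, HasDerivWithinAt u
        (q x * (Real.sin (θ x) * Real.cos (θ x)) / r) (Icc 0 1) x)
    {x : ℝ} (hx : x ∈ Icc (0:ℝ) 1) : |u x| ≤ M / r := by
  have hM0 : 0 ≤ M := (abs_nonneg _).trans (hM 0 (left_mem_Icc.2 zero_le_one))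
  have := eqOn_of_deriv_zero (M / r) hu (by
    intro x hx
    have s1 := Real.abs_sin_le_one (θ x)
    have s2 := Real.abs_cos_le_one (θ x)
    have s3 := hM x hx
    rw [Real.norm_eq_abs, abs_div, abs_mul, abs_mul, abs_of_pos hr]
    have : M / r = M * (1 * 1) / r := by ring
    rw [this]; gcongr) (by positivity) hx
  simpa [hu0] using this

/-- Counting: the Prüfer angle at the `j`-th nodal point is `j π`. -/
lemma counting (θ : ℝ → ℝ) (hmono : StrictMonoOn θ (Icc 0 1)) (hc : ContinuousOn θ (Icc 0 1))
    (hθ0 : θ 0 = 0) (X : ℕ → ℝ) (n : ℕ)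
    (hX : ∀ j, 1 ≤ j → j ≤ n → X j ∈ Ioo (0:ℝ) 1 ∧ Real.sin (θ (X j)) = 0)
    (hXm : StrictMonoOn X (Icc 1 n))
    (hall : ∀ t ∈ Ioo (0:ℝ) 1, Real.sin (θ t) = 0 → ∃ j, 1 ≤ j ∧ j ≤ n ∧ t = X j) :
    (∀ j, 1 ≤ j → j ≤ n → θ (X j) = j * Real.pi) ∧ n * Real.pi ≤ θ 1 ∧
      θ 1 ≤ (n + 1) * Real.pi := by
  have h0 : (0:ℝ) ∈ Icc (0:ℝ) 1 := left_mem_Icc.2 zero_le_one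
  have h1 : (1:ℝ) ∈ Icc (0:ℝ) 1 := right_mem_Icc.2 zero_le_one
  have hpi := Real.pi_pos
  have hsurj : ∀ k : ℕ, 1 ≤ k → k * Real.pi < θ 1 → ∃ i, 1 ≤ i ∧ i ≤ n ∧ θ (X i) = k * Real.pi := by
    intro k hk hk1
    have hk' : (1:ℝ) ≤ k := by exact_mod_cast hk
    have hmem : (k * Real.pi) ∈ Ioo (θ 0) (θ 1) := ⟨by rw [hθ0]; positivity, hk1⟩
    obtain ⟨t, ht, hte⟩ := intermediate_value_Ioo zero_le_one hc hmem
    obtain ⟨i, hi1, hi2, hi3⟩ := hall t ht (by rw [hte]; exact Real.sin_nat_mul_pi k)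
    exact ⟨i, hi1, hi2, by rw [← hi3, hte]⟩
  have hnat : ∀ j, 1 ≤ j → j ≤ n → ∃ k : ℕ, 1 ≤ k ∧ θ (X j) = k * Real.pi := by
    intro j hj1 hj2
    obtain ⟨hm, hs⟩ := hX j hj1 hj2
    obtain ⟨k, hk⟩ := Real.sin_eq_zero_iff.1 hs
    have hpos : 0 < θ (X j) := by
      rw [← hθ0]; exact hmono h0 (Ioo_subset_Icc_self hm) hm.1
    have hk0 : 0 < k := by
      rw [← hk] at hpos
      have := (mul_pos_iff_of_pos_right hpi).1 hpos
      exact_mod_cast this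
    refine ⟨k.toNat, by omega, ?_⟩
    rw [← hk]
    congr 1
    have : ((k.toNat : ℤ) : ℝ) = (k : ℝ) := by rw [Int.toNat_of_nonneg hk0.le]
    rw [← this, Int.cast_natCast]
  have hlt1 : ∀ j, 1 ≤ j → j ≤ n → θ (X j) < θ 1 := fun j a b =>
    hmono (Ioo_subset_Icc_self (hX j a b).1) h1 (hX j a b).1.2
  have hθX : ∀ i j, 1 ≤ i → i ≤ n → 1 ≤ j → j ≤ n → (θ (X i) < θ (X j) ↔ i < j) := by
    intro i j a b c d
    rw [hmono.lt_iff_lt (Ioo_subset_Icc_self (hX i a b).1) (Ioo_subset_Icc_self (hX j c d).1),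
      hXm.lt_iff_lt ⟨a, b⟩ ⟨c, d⟩]
  have hmain : ∀ j, 1 ≤ j → j ≤ n → θ (X j) = j * Real.pi := by
    intro j
    induction j using Nat.strong_induction_on with
    | _ j ih =>
      intro hj1 hj2
      obtain ⟨k, hk1, hk⟩ := hnat j hj1 hj2
      rcases lt_trichotomy k j with h | h | h
      · have h2 := ih k h hk1 (by omega)
        have h3 := (hθX k j hk1 (by omega) hj1 hj2).2 h
        rw [h2, hk] at h3
        exact absurd h3 (lt_irrefl _)
      · rw [hk, h]
      · have hjk : (j:ℝ) * Real.pi < θ (X j) := by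
          rw [hk]; have : (j:ℝ) < k := by exact_mod_cast h
          gcongr
        obtain ⟨i, hi1, hi2, hi⟩ := hsurj j hj1 (hjk.trans (hlt1 j hj1 hj2))
        have hij : i < j := (hθX i j hi1 hi2 hj1 hj2).1 (by rw [hi]; exact hjk)
        have := ih i hij hi1 hi2
        rw [hi] at this
        have := mul_right_cancel₀ hpi.ne' this
        have : j = i := by exact_mod_cast this
        omega
  refine ⟨hmain, ?_, ?_⟩
  · rcases Nat.eq_zero_or_pos n with h | h
    · subst h
      have := hmono h0 h1 one_pos
      rw [hθ0] at this
      simpa using this.le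
    · rw [← hmain n h le_rfl]; exact (hlt1 n h le_rfl).le
  · by_contra hcon
    push Not at hcon
    obtain ⟨i, hi1, hi2, hi⟩ := hsurj (n+1) (by omega) (by push_cast; exact hcon)
    rw [hmain i hi1 hi2] at hi
    have := mul_right_cancel₀ hpi.ne' hi
    have : i = n + 1 := by exact_mod_cast this
    omega

/-- If a real solution of `y'' = p y` with `|p| ≤ L` has two zeros at distance `d` with
`d ^ 2 * L < 1`, then `y` and `y'` vanish at the left one. -/
lemma gap (p y z : ℝ → ℝ) (L a b : ℝ) (hab : a < b) (ha : 0 ≤ a) (hb : b ≤ 1)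
    (hy : ∀ x ∈ Icc (0:ℝ) 1, HasDerivWithinAt y (z x) (Icc 0 1) x)
    (hz : ∀ x ∈ Icc (0:ℝ) 1, HasDerivWithinAt z (p x * y x) (Icc 0 1) x)
    (hp : ∀ x ∈ Icc (0:ℝ) 1, |p x| ≤ L) (hya : y a = 0) (hyb : y b = 0)
    (hL : (b - a) ^ 2 * L < 1) : y a = 0 ∧ z a = 0 := by
  refine ⟨hya, ?_⟩
  have hsub : Icc a b ⊆ Icc (0:ℝ) 1 := Icc_subset_Icc ha hb
  have hL0 : 0 ≤ L := (abs_nonneg _).trans (hp 0 (left_mem_Icc.2 zero_le_one))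
  have hy' : ∀ x ∈ Icc a b, HasDerivWithinAt y (z x) (Icc a b) x :=
    fun x hx => (hy x (hsub hx)).mono hsub
  have hz' : ∀ x ∈ Icc a b, HasDerivWithinAt z (p x * y x) (Icc a b) x :=
    fun x hx => (hz x (hsub hx)).mono hsub
  have hzc : ContinuousOn z (Icc a b) := fun x hx => (hz' x hx).continuousWithinAt
  have hyc : ContinuousOn y (Icc a b) := fun x hx => (hy' x hx).continuousWithinAt
  obtain ⟨m, hm, hmax⟩ := isCompact_Icc.exists_isMaxOn (nonempty_Icc.2 hab.le) hzc.abs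
  have hmax' : ∀ x ∈ Icc a b, |z x| ≤ |z m| := hmax
  obtain ⟨c, hc, hzc0⟩ := exists_hasDerivAt_eq_zero hab hyc (hya.trans hyb.symm)
    (fun x hx => (hy' x (Ioo_subset_Icc_self hx)).hasDerivAt (Icc_mem_nhds hx.1 hx.2))
  have hyb : ∀ x ∈ Icc a b, |y x| ≤ |z m| * (b - a) := by
    intro x hx
    have h := (convex_Icc a b).norm_image_sub_le_of_norm_hasDerivWithin_le hy' hmax'
      (left_mem_Icc.2 hab.le) hx
    rw [hya, sub_zero, Real.norm_eq_abs, Real.norm_eq_abs,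
      abs_of_nonneg (by linarith [hx.1] : 0 ≤ x - a)] at h
    refine h.trans ?_
    gcongr
    exact hx.2
  have hzb := (convex_Icc a b).norm_image_sub_le_of_norm_hasDerivWithin_le hz'
    (C := L * (|z m| * (b - a))) (by
      intro x hx
      rw [Real.norm_eq_abs, abs_mul]
      have := hyb x hx
      have := hp x (hsub hx)
      gcongr) (Ioo_subset_Icc_self hc) hm
  rw [hzc0, sub_zero, Real.norm_eq_abs, Real.norm_eq_abs] at hzb
  have hmc : |m - c| ≤ b - a := abs_le.2 ⟨by linarith [hm.1, hc.2], by linarith [hm.2, hc.1]⟩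
  have hba : 0 < b - a := by linarith
  have h3 : |z m| ≤ (b - a) ^ 2 * L * |z m| := by
    refine hzb.trans ?_
    calc L * (|z m| * (b - a)) * |m - c| ≤ L * (|z m| * (b - a)) * (b - a) := by gcongr
      _ = _ := by ring
  have h4 : |z m| ≤ 0 := by
    by_contra hcon
    push Not at hcon
    nlinarith
  exact abs_nonpos_iff.1 ((hmax' a (left_mem_Icc.2 hab.le)).trans h4)

/-- Pigeonhole: some gap among `n` points of `(0,1)` is at most `1/(n-1)`. -/
lemma small_gap (X : ℕ → ℝ) (n : ℕ) (d : ℝ) (hd : 1 ≤ d * n)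
    (hX : ∀ j, 1 ≤ j → j ≤ n + 1 → X j ∈ Ioo (0:ℝ) 1) :
    ∃ j, 1 ≤ j ∧ j ≤ n ∧ X (j+1) - X j < d := by
  by_contra hcon
  push Not at hcon
  have : ∀ k, k ≤ n → X 1 + d * k ≤ X (k + 1) := by
    intro k
    induction k with
    | zero => simp
    | succ k ih =>
      intro hk
      have := ih (by omega)
      have h2 := hcon (k+1) (by omega) hk
      push_cast
      linarith
  have h1 := this n le_rfl
  have h2 := (hX (n+1) (by omega) le_rfl).2
  have h3 := (hX 1 le_rfl (by omega)).1
  linarith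

/-- If a nontrivial solution with `y(0)=0` vanishes in `(0,1)` then the spectral parameter is real and
larger than the minimum of the potential. -/
lemma real_of_zero (q : ℝ → ℝ) (M : ℝ) (hM : ∀ x ∈ Icc (0:ℝ) 1, |q x| ≤ M)
    (l : ℂ) (y z : ℝ → ℂ) (h : IsSLSolution q l y z) (hy0 : y 0 = 0) (hz0 : z 0 = 1)
    (a : ℝ) (ha : a ∈ Ioo (0:ℝ) 1) (hya : y a = 0) : l.im = 0 ∧ - M ≤ l.re := by
  obtain ⟨hy, hz⟩ := h
  have hsub : Icc 0 a ⊆ Icc (0:ℝ) 1 := Icc_subset_Icc le_rfl ha.2.le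
  have h0a : (0:ℝ) ∈ Icc 0 a := left_mem_Icc.2 ha.1.le
  have haa : a ∈ Icc 0 a := right_mem_Icc.2 ha.1.le
  set W : ℝ → ℂ := fun x => z x * (starRingEnd ℂ) (y x) with hW
  have hWd : ∀ x ∈ Icc 0 a, HasDerivWithinAt W
      (((q x : ℂ) - l) * (Complex.normSq (y x) : ℂ) + (Complex.normSq (z x) : ℂ)) (Icc 0 a) x := by
    intro x hx
    have h1 := (hz x (hsub hx)).mono hsub
    have h2 := Complex.conjCLE.toContinuousLinearMap.hasFDerivAt.comp_hasDerivWithinAt x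
      ((hy x (hsub hx)).mono hsub)
    refine (h1.mul h2).congr_deriv ?_
    simp [Complex.normSq_eq_conj_mul_self]
    ring
  have hre : ∀ x ∈ Icc 0 a, HasDerivWithinAt (fun x => (W x).re)
      ((q x - l.re) * Complex.normSq (y x) + Complex.normSq (z x)) (Icc 0 a) x := by
    intro x hx
    refine (Complex.reCLM.hasFDerivAt.comp_hasDerivWithinAt x (hWd x hx)).congr_deriv ?_
    simp
  have him : ∀ x ∈ Icc 0 a, HasDerivWithinAt (fun x => (W x).im)
      (- l.im * Complex.normSq (y x)) (Icc 0 a) x := by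
    intro x hx
    refine (Complex.imCLM.hasFDerivAt.comp_hasDerivWithinAt x (hWd x hx)).congr_deriv ?_
    simp
  have hW0 : W 0 = 0 := by simp [hW, hy0]
  have hWa : W a = 0 := by simp [hW, hya]
  -- a monotone function with equal end values has zero derivative
  have key : ∀ f f' : ℝ → ℝ, (∀ x ∈ Icc 0 a, HasDerivWithinAt f (f' x) (Icc 0 a) x) →
      f 0 = 0 → f a = 0 → (∀ x ∈ Icc 0 a, 0 ≤ f' x) → ∀ x ∈ Icc 0 a, f' x = 0 := by
    intro f f' hf hf0 hfa hpos x hx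
    have hmono : MonotoneOn f (Icc 0 a) := monotoneOn_of_hasDerivWithinAt_nonneg (convex_Icc 0 a)
      (fun x hx => (hf x hx).continuousWithinAt)
      (fun x hx => (hf x (interior_subset hx)).mono interior_subset)
      (fun x hx => hpos x (interior_subset hx))
    have hzero : ∀ x ∈ Icc 0 a, f x = 0 := by
      intro x hx
      have h1 := hmono h0a hx hx.1
      have h2 := hmono hx haa hx.2
      linarith
    have h2 : HasDerivWithinAt f 0 (Icc 0 a) x :=
      (hasDerivWithinAt_const x (Icc 0 a) (0:ℝ)).congr hzero (hzero x hx)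
    exact (uniqueDiffOn_Icc ha.1 x hx).eq_deriv _ (hf x hx) h2
  constructor
  · by_contra hne
    have hy2 : ∀ x ∈ Icc 0 a, l.im ^ 2 * Complex.normSq (y x) = 0 := by
      refine key (fun x => - l.im * (W x).im) _ ?_ (by simp [hW0]) (by simp [hWa]) ?_
      · intro x hx
        refine ((him x hx).const_mul (- l.im)).congr_deriv ?_
        ring
      · intro x hx
        exact mul_nonneg (sq_nonneg _) (Complex.normSq_nonneg _)
    have hyz : ∀ x ∈ Icc 0 a, y x = 0 := by
      intro x hx
      have := hy2 x hx
      simpa [hne] using this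
    have h2 : HasDerivWithinAt y 0 (Icc 0 a) 0 :=
      (hasDerivWithinAt_const (0:ℝ) (Icc 0 a) (0:ℂ)).congr hyz (hyz 0 h0a)
    have := (uniqueDiffOn_Icc ha.1 0 h0a).eq_deriv _ ((hy 0 (hsub h0a)).mono hsub) h2
    rw [hz0] at this
    exact one_ne_zero this
  · by_contra hcon
    push Not at hcon
    have := key _ _ hre (by simp [hW0]) (by simp [hWa]) (by
      intro x hx
      have h1 := (abs_le.1 (hM x (hsub hx))).1
      have : 0 ≤ q x - l.re := by linarith
      exact add_nonneg (mul_nonneg this (Complex.normSq_nonneg _)) (Complex.normSq_nonneg _)) 0 h0a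
    simp [hy0, hz0] at this

/-- The eigenvalue asymptotics, extracted from the boundary condition. -/
lemma eig_asymp (H γ ξ M C0 : ℝ) (hM0 : 0 ≤ M) (hC0 : 0 ≤ C0) (hξ : ξ ∈ Icc (0:ℝ) 1) :
    ∃ R C1 C4 : ℝ, 0 ≤ C1 ∧ 0 ≤ C4 ∧ ∀ (n : ℕ) (r T t uξ u1 Qξ : ℝ), 1 ≤ r → R ≤ r →
      n * Real.pi ≤ T → T ≤ (n + 1) * Real.pi → |T - r| ≤ C0 / r ^ 2 →
      |t - r * ξ + Qξ / r| ≤ C0 / r ^ 2 → |Qξ| ≤ M → |uξ| ≤ M / r → |u1| ≤ M / r →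
      Real.exp u1 * Real.cos T + H * (Real.exp u1 * Real.sin T / r)
        - γ * (Real.exp uξ * Real.sin t / r) = 0 →
      |r - (n + 1/2) * Real.pi| ≤ C1 / r ∧
      |r - (n + 1/2) * Real.pi -
        (H - (-1) ^ n * (γ * Real.sin ((n + 1/2) * Real.pi * ξ))) / r| ≤ C4 / r ^ 2 := by
  set D := |H| + 3 * |γ| with hD
  have hD0 : 0 ≤ D := by positivity
  set C1 := C0 + 2 * D with hC1
  set C2 := C0 + M + C1 with hC2
  set C3 := 2 * |H| * D ^ 2 + |γ| * (4 * M + C2) with hC3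
  set C4 := C0 + 4 * D ^ 2 + C3 with hC4
  have hC10 : 0 ≤ C1 := by positivity
  have hC20 : 0 ≤ C2 := by positivity
  have hC30 : 0 ≤ C3 := by positivity
  refine ⟨2 * M + 2 * D + 1, C1, C4, hC10, by positivity, ?_⟩
  intro n r T t uξ u1 Qξ hr hR hT1 hT2 hTr ht hQ huξ hu1 hbc
  have hr0 : 0 < r := by linarith
  set N := ((n:ℝ) + 1/2) * Real.pi with hN
  set δ := T - N with hδ
  set s : ℝ := (-1) ^ n with hs
  have hs2 : s * s = 1 := by
    rw [hs, ← pow_add, ← two_mul, pow_mul]; norm_num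
  have hsabs : |s| = 1 := by rw [hs, abs_pow]; simp
  have hpi := Real.pi_pos
  have hinv : 1 / r ^ 2 ≤ 1 / r := by
    apply one_div_le_one_div_of_le hr0; nlinarith
  have hdiv : ∀ c : ℝ, 0 ≤ c → c / r ^ 2 ≤ c / r := by
    intro c hc
    rw [div_eq_mul_one_div, div_eq_mul_one_div c r]; gcongr
  have hTe : T = (n * Real.pi + δ) + Real.pi / 2 := by rw [hδ, hN]; ring
  have hcosT : Real.cos T = - (s * Real.sin δ) := by
    rw [hTe, Real.cos_add_pi_div_two, add_comm, Real.sin_add_nat_mul_pi]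
  have hsinT : Real.sin T = s * Real.cos δ := by
    rw [hTe, Real.sin_add_pi_div_two, add_comm, Real.cos_add_nat_mul_pi]
  set E := Real.exp (uξ - u1) with hE
  have hxu : |uξ - u1| ≤ 2 * M / r := by
    refine (abs_sub _ _).trans ?_
    have : 2 * M / r = M / r + M / r := by ring
    linarith
  have hxu1 : 2 * M / r ≤ 1 := by rw [div_le_one hr0]; linarith
  have hE1 : |E - 1| ≤ 4 * M / r := by
    refine (Real.abs_exp_sub_one_le (hxu.trans hxu1)).trans ?_
    have : 4 * M / r = 2 * (2 * M / r) := by ring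
    linarith
  have hE3 : |E| ≤ 3 := by
    have h1 : 4 * M / r = 2 * (2 * M / r) := by ring
    have := abs_le.1 hE1
    rw [abs_le]; constructor <;> linarith
  have hmain : r * Real.sin δ = H * Real.cos δ - s * (γ * (E * Real.sin t)) := by
    have he : Real.exp uξ = E * Real.exp u1 := by rw [hE, ← Real.exp_add]; ring_nf
    have hne := (Real.exp_pos u1).ne'
    rw [hcosT, hsinT, he] at hbc
    have h2 : -(s * Real.sin δ * r) + H * s * Real.cos δ - γ * E * Real.sin t = 0 := by
      apply mul_left_cancel₀ hne
      have hrr : r * (1 / r) = 1 := by field_simp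
      linear_combination r * hbc - (H * Real.exp u1 * s * Real.cos δ
        - γ * E * Real.exp u1 * Real.sin t) * hrr
    linear_combination (-s) * h2 - (r * Real.sin δ - H * Real.cos δ) * hs2
  have hsd : |Real.sin δ| ≤ D / r := by
    rw [le_div_iff₀ hr0, mul_comm]
    have : |r * Real.sin δ| ≤ D := by
      rw [hmain]
      refine (abs_sub _ _).trans ?_
      rw [abs_mul, abs_mul, abs_mul, abs_mul, hsabs, hD]
      have c1 := Real.abs_cos_le_one δ
      have c2 := Real.abs_sin_le_one t
      have a1 : |H| * |Real.cos δ| ≤ |H| * 1 := by gcongr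
      have a2 : |γ| * (|E| * |Real.sin t|) ≤ |γ| * (3 * 1) := by gcongr
      linarith
    rwa [abs_mul, abs_of_pos hr0] at this
  have hδpi : |δ| ≤ Real.pi / 2 := by
    rw [hδ, hN, abs_le]; constructor <;> linarith
  have hδ1 : |δ| ≤ 2 * D / r := by
    have h1 := Real.mul_abs_le_abs_sin hδpi
    have h2 : |δ| ≤ Real.pi / 2 * |Real.sin δ| := by
      have : |δ| = Real.pi / 2 * (2 / Real.pi * |δ|) := by field_simp
      rw [this]; gcongr
    have h3 : Real.pi / 2 ≤ 2 := by linarith [Real.pi_le_four]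
    calc |δ| ≤ Real.pi / 2 * |Real.sin δ| := h2
      _ ≤ 2 * (D / r) := by gcongr
      _ = _ := by ring
  have hrN : |r - N| ≤ C1 / r := by
    have e : r - N = -(T - r) + δ := by rw [hδ]; ring
    rw [e]
    refine (abs_add_le _ _).trans ?_
    rw [abs_neg, hC1, add_div]
    exact add_le_add (hTr.trans (hdiv _ hC0)) hδ1
  refine ⟨hrN, ?_⟩
  have ht2 : |t - N * ξ| ≤ C2 / r := by
    have e : t - N * ξ = (t - r * ξ + Qξ / r) + (-(Qξ / r)) + (r - N) * ξ := by ring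
    rw [e]
    refine (abs_add_three _ _ _).trans ?_
    rw [abs_neg, abs_div, abs_of_pos hr0, abs_mul, abs_of_nonneg hξ.1]
    have a1 := ht.trans (hdiv _ hC0)
    have a2 : |Qξ| / r ≤ M / r := by gcongr
    have a3 : |r - N| * ξ ≤ C1 / r * 1 := by
      have := hξ.1; have := hξ.2; gcongr
    rw [hC2, add_div, add_div]
    linarith
  have hsint : |Real.sin t - Real.sin (N * ξ)| ≤ C2 / r := by
    refine le_trans ?_ ht2
    have h := Real.abs_sin_sub_sin_le t (N * ξ)
    exact h
  have hδone : |δ| ≤ 1 := by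
    refine hδ1.trans ?_
    rw [div_le_one hr0]; linarith
  have hδsq : δ ^ 2 ≤ 4 * D ^ 2 / r ^ 2 := by
    rw [← sq_abs]
    calc |δ| ^ 2 ≤ (2 * D / r) ^ 2 := by gcongr
      _ = _ := by ring
  have hsb : |δ - Real.sin δ| ≤ δ ^ 2 := by
    have h := Real.sin_bound hδone
    have e : δ - Real.sin δ = -(Real.sin δ - (δ - δ ^ 3 / 6)) + δ ^ 3 / 6 := by ring
    rw [e]
    refine (abs_add_le _ _).trans ?_
    rw [abs_neg, abs_div, abs_pow, ← sq_abs δ]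
    have h0 := abs_nonneg δ
    have h3 : |δ| ^ 3 ≤ |δ| ^ 2 := pow_le_pow_of_le_one h0 hδone (by norm_num)
    have h5 : |δ| ^ 5 ≤ |δ| ^ 2 := pow_le_pow_of_le_one h0 hδone (by norm_num)
    have h6 : |(6:ℝ)| = 6 := by norm_num
    rw [h6]
    have : 0 ≤ |δ| ^ 2 := by positivity
    linarith
  have hcb : |Real.cos δ - 1| ≤ 2 * D ^ 2 / r ^ 2 := by
    have h1 := Real.one_sub_sq_div_two_le_cos (x := δ)
    have h2 := Real.cos_le_one δ
    have e : 2 * D ^ 2 / r ^ 2 = (4 * D ^ 2 / r ^ 2) / 2 := by ring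
    rw [abs_le]; constructor <;> linarith
  set B := H - s * (γ * Real.sin (N * ξ)) with hB
  have hmB : |r * Real.sin δ - B| ≤ C3 / r := by
    have e : r * Real.sin δ - B = H * (Real.cos δ - 1) +
        (-(s * (γ * ((E - 1) * Real.sin t)))) + (-(s * (γ * (Real.sin t - Real.sin (N * ξ))))) := by
      rw [hmain, hB]; ring
    rw [e]
    refine (abs_add_three _ _ _).trans ?_
    rw [abs_neg, abs_neg, abs_mul, abs_mul, abs_mul, abs_mul, abs_mul, abs_mul, hsabs]
    have c2 := Real.abs_sin_le_one t
    have a1 : |H| * |Real.cos δ - 1| ≤ |H| * (2 * D ^ 2 / r) := by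
      have := hcb.trans (hdiv _ (by positivity))
      gcongr
    have a2 : |γ| * (|E - 1| * |Real.sin t|) ≤ |γ| * (4 * M / r * 1) := by gcongr
    have a3 : |γ| * |Real.sin t - Real.sin (N * ξ)| ≤ |γ| * (C2 / r) := by gcongr
    have e : C3 / r = |H| * (2 * D ^ 2 / r) + |γ| * (4 * M / r * 1) + |γ| * (C2 / r) := by
      rw [hC3]; ring
    rw [e]; linarith
  have e : r - N - B / r = -(T - r) + (δ - Real.sin δ) + (r * Real.sin δ - B) / r := by
    rw [hδ]; field_simp; ring
  rw [e]
  refine (abs_add_three _ _ _).trans ?_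
  rw [abs_neg, abs_div, abs_of_pos hr0]
  have a1 : |r * Real.sin δ - B| / r ≤ C3 / r / r := by gcongr
  have e2 : C4 / r ^ 2 = C0 / r ^ 2 + 4 * D ^ 2 / r ^ 2 + C3 / r / r := by
    rw [hC4]; field_simp
  rw [e2]
  have := hsb.trans hδsq
  linarith

/-- The nodal asymptotics, given the eigenvalue asymptotics. -/
lemma nodal_asymp (M C0 C1 C4 D : ℝ) (hM0 : 0 ≤ M) (hC0 : 0 ≤ C0) (hC1 : 0 ≤ C1) (hC4 : 0 ≤ C4)
    (hD : 0 ≤ D) :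
    ∃ C : ℝ, 0 ≤ C ∧ ∀ (r N J X Q B : ℝ), 1 ≤ r → C1 ≤ r → 1 ≤ N → X ∈ Icc (0:ℝ) 1 →
      |Q| ≤ M → |B| ≤ D → |r - N| ≤ C1 / r → |r - N - B / r| ≤ C4 / r ^ 2 →
      |J - r * X + Q / r| ≤ C0 / r ^ 2 →
      |X - (J / N - B / N ^ 2 * (J / N) + Q / N ^ 2)| ≤ C / N ^ 3 := by
  set C5 := C0 + M + C1 with hC5
  set C6 := C0 + C4 + M * C1 + D * (2 * C5 + C1) with hC6
  refine ⟨4 * C6, by positivity, ?_⟩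
  intro r N J X Q B hr hrC hN hX hQ hB hrN hrB hJ
  have hr0 : 0 < r := by linarith
  have hN0 : 0 < N := by linarith
  have hX0 := hX.1
  have hX1 := hX.2
  have hdiv : ∀ c : ℝ, 0 ≤ c → c / r ^ 2 ≤ c / r := by
    intro c hc
    apply div_le_div_of_nonneg_left hc hr0; nlinarith
  have hN2 : N ≤ 2 * r := by
    have h1 : C1 / r ≤ 1 := by rw [div_le_one hr0]; exact hrC
    have := (abs_le.1 hrN).1
    linarith
  have hNi : 1 / N ≤ 1 := by rw [div_le_one hN0]; exact hN
  have hr2 : r ≤ 2 * N := by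
    have h1 : C1 / r ≤ 1 := by rw [div_le_one hr0]; exact hrC
    have := (abs_le.1 hrN).2
    linarith
  have hNr : 1 / N ≤ 2 / r := by rw [div_le_div_iff₀ hN0 hr0]; linarith
  have hinv : |1 / r - 1 / N| ≤ C1 / r ^ 2 := by
    have e : 1 / r - 1 / N = - ((r - N) * (1 / N) / r) := by field_simp; ring
    rw [e, abs_neg, abs_div, abs_mul, abs_of_pos hr0, abs_of_pos (by positivity : 0 < 1 / N)]
    calc |r - N| * (1 / N) / r ≤ (C1 / r) * 1 / r := by gcongr
      _ = _ := by field_simp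
  have hJN : |J - N * X| ≤ C5 / r := by
    have e : J - N * X = (J - r * X + Q / r) + (- (Q / r)) + (r - N) * X := by ring
    rw [e]
    refine (abs_add_three _ _ _).trans ?_
    rw [abs_neg, abs_div, abs_of_pos hr0, abs_mul, abs_of_nonneg hX0]
    have a1 := hJ.trans (hdiv _ hC0)
    have a2 : |Q| / r ≤ M / r := by gcongr
    have a3 : |r - N| * X ≤ C1 / r * 1 := by gcongr
    rw [hC5, add_div, add_div]
    linarith
  have hlast : |J / N ^ 2 - X / r| ≤ (2 * C5 + C1) / r ^ 2 := by
    have e : J / N ^ 2 - X / r = (J - N * X) * (1 / N) * (1 / N) + (-(X * (1 / r - 1 / N))) := by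
      field_simp; ring
    rw [e]
    refine (abs_add_le _ _).trans ?_
    rw [abs_neg, abs_mul, abs_mul, abs_mul, abs_of_nonneg hX0, abs_of_pos (by positivity : 0 < 1 / N)]
    have a1 : |J - N * X| * (1 / N) * (1 / N) ≤ C5 / r * (2 / r) * 1 := by gcongr
    have a2 : X * |1 / r - 1 / N| ≤ 1 * (C1 / r ^ 2) := by gcongr
    have e : (2 * C5 + C1) / r ^ 2 = C5 / r * (2 / r) * 1 + 1 * (C1 / r ^ 2) := by field_simp
    rw [e]; linarith
  have hfin : |N * (X - (J / N - B / N ^ 2 * (J / N) + Q / N ^ 2))| ≤ C6 / r ^ 2 := by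
    have e : N * (X - (J / N - B / N ^ 2 * (J / N) + Q / N ^ 2)) =
      -(J - r * X + Q / r) + (-((r - N - B / r) * X)) + (Q * (1 / r - 1 / N)
        + B * (J / N ^ 2 - X / r)) := by
      field_simp; ring
    rw [e]
    refine (abs_add_three _ _ _).trans ?_
    have a0 := abs_add_le (Q * (1 / r - 1 / N)) (B * (J / N ^ 2 - X / r))
    rw [abs_mul, abs_mul] at a0
    rw [abs_neg, abs_neg, abs_mul, abs_of_nonneg hX0]
    have a1 : |r - N - B / r| * X ≤ C4 / r ^ 2 * 1 := by gcongr
    have a2 : |Q| * |1 / r - 1 / N| ≤ M * (C1 / r ^ 2) := by gcongr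
    have a3 : |B| * |J / N ^ 2 - X / r| ≤ D * ((2 * C5 + C1) / r ^ 2) := by gcongr
    have e : C6 / r ^ 2 = C0 / r ^ 2 + C4 / r ^ 2 * 1 + (M * (C1 / r ^ 2) + 
      D * ((2 * C5 + C1) / r ^ 2)) := by rw [hC6]; ring
    rw [e]; linarith
  rw [abs_mul, abs_of_pos hN0] at hfin
  have h6 : 0 ≤ C6 := by positivity
  have h7 : C6 / r ^ 2 ≤ 4 * C6 / N ^ 2 := by
    rw [div_le_div_iff₀ (by positivity) (by positivity)]
    have : N ^ 2 ≤ 4 * r ^ 2 := by nlinarith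
    nlinarith
  have h8 := hfin.trans h7
  have e : 4 * C6 / N ^ 3 = (4 * C6 / N ^ 2) / N := by field_simp
  rw [e, le_div_iff₀ hN0, mul_comm]
  exact h8

lemma re_solution (q : ℝ → ℝ) (l : ℂ) (him : l.im = 0) (y z : ℝ → ℂ) (h : IsSLSolution q l y z) :
    (∀ x ∈ Icc (0:ℝ) 1, HasDerivWithinAt (fun x => (y x).re) (z x).re (Icc 0 1) x) ∧
    (∀ x ∈ Icc (0:ℝ) 1, HasDerivWithinAt (fun x => (z x).re)
      ((q x - l.re) * (y x).re) (Icc 0 1) x) ∧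
    (∀ x ∈ Icc (0:ℝ) 1, HasDerivWithinAt (fun x => (y x).im) (z x).im (Icc 0 1) x) ∧
    (∀ x ∈ Icc (0:ℝ) 1, HasDerivWithinAt (fun x => (z x).im)
      ((q x - l.re) * (y x).im) (Icc 0 1) x) := by
  obtain ⟨hy, hz⟩ := h
  refine ⟨fun x hx => ?_, fun x hx => ?_, fun x hx => ?_, fun x hx => ?_⟩
  · exact Complex.reCLM.hasFDerivAt.comp_hasDerivWithinAt x (hy x hx)
  · refine (Complex.reCLM.hasFDerivAt.comp_hasDerivWithinAt x (hz x hx)).congr_deriv ?_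
    simp [him]
  · exact Complex.imCLM.hasFDerivAt.comp_hasDerivWithinAt x (hy x hx)
  · refine (Complex.imCLM.hasFDerivAt.comp_hasDerivWithinAt x (hz x hx)).congr_deriv ?_
    simp [him]

/-- The eigenvalues are eventually real and tend to `+∞`. -/
lemma lam_large (q : ℝ → ℝ) (M : ℝ) (hM0 : 0 ≤ M) (hM : ∀ x ∈ Icc (0:ℝ) 1, |q x| ≤ M)
    (S S' : ℂ → ℝ → ℂ)
    (hsolS : ∀ lam : ℂ, IsSLSolution q lam (S lam) (S' lam))
    (hS0 : ∀ lam : ℂ, S lam 0 = 0) (hS'0 : ∀ lam : ℂ, S' lam 0 = 1)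
    (lam : ℕ → ℂ) (X : ℕ → ℕ → ℝ) (N0 : ℕ)
    (hX : HasNodalPoints (fun l => S l) lam X (fun _ => 1) (fun n => n) N0) (K : ℝ) (hK : 0 ≤ K) :
    ∃ N : ℕ, N0 ≤ N ∧ ∀ n ≥ N, (lam n).im = 0 ∧ K ≤ (lam n).re := by
  obtain ⟨m, hm⟩ := exists_nat_gt (K + 2 * M + 1)
  have hm1 : (1:ℝ) ≤ m := by linarith
  refine ⟨max N0 (m + 1), le_max_left _ _, ?_⟩
  intro n hn
  have hn0 : N0 ≤ n := (le_max_left _ _).trans hn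
  have hnm : m + 1 ≤ n := (le_max_right _ _).trans hn
  obtain ⟨h1, h2, -⟩ := hX n hn0
  have hz1 := h1 1 le_rfl (by show 1 ≤ n; omega)
  obtain ⟨him, hre⟩ := real_of_zero q M hM (lam n) _ _ (hsolS (lam n)) (hS0 _) (hS'0 _) _ hz1.1 hz1.2
  refine ⟨him, ?_⟩
  by_contra hcon
  push Not at hcon
  obtain ⟨j, hj1, hj2, hj⟩ := small_gap (X n) m (1 / m) (by field_simp; exact le_rfl)
    (fun j a b => (h1 j a (by show j ≤ n; omega)).1)
  have hja := h1 j hj1 (by show j ≤ n; omega)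
  have hjb := h1 (j+1) (by show 1 ≤ j + 1; omega) (by show j + 1 ≤ n; omega)
  have hlt : X n j < X n (j+1) := h2 ⟨hj1, by show j ≤ n; omega⟩
    ⟨by show 1 ≤ j + 1; omega, by show j + 1 ≤ n; omega⟩ (by omega)
  obtain ⟨d1, d2, -, -⟩ := re_solution q (lam n) him _ _ (hsolS (lam n))
  have hp : ∀ x ∈ Icc (0:ℝ) 1, |q x - (lam n).re| ≤ K + 2 * M := by
    intro x hx
    have := abs_le.1 (hM x hx)
    rw [abs_le]; constructor <;> linarith
  have hgap := gap (fun x => q x - (lam n).re) _ _ (K + 2 * M) (X n j) (X n (j+1)) hlt hja.1.1.le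
    hjb.1.2.le d1 d2 hp (by simpa using congrArg Complex.re hja.2)
    (by simpa using congrArg Complex.re hjb.2) (by
      have hd0 : 0 < X n (j+1) - X n j := by linarith
      have hsq : (X n (j+1) - X n j) ^ 2 ≤ (1 / m) ^ 2 := by gcongr
      have hsq2 : ((1:ℝ) / m) ^ 2 ≤ 1 / m := by
        rw [div_pow, one_pow]
        apply one_div_le_one_div_of_le (by linarith); nlinarith
      calc (X n (j+1) - X n j) ^ 2 * (K + 2 * M) ≤ 1 / m * (K + 2 * M) := by
            gcongr; exact hsq.trans hsq2
        _ < 1 := by rw [div_mul_eq_mul_div, one_mul, div_lt_one (by linarith)]; linarith)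
  have hen := (energy (fun x => q x - (lam n).re) _ _ 1 (K + 2 * M + 1) one_pos d1 d2 (by
    intro x hx
    refine (abs_add_le _ _).trans ?_
    have := hp x hx
    simp only [one_pow, abs_one]
    linarith) (Ioo_subset_Icc_self hja.1)).2 (by simp [hS'0])
  rw [hgap.1, hgap.2] at hen
  simp at hen

end SLNodal

open SLNodal in
/-- Lemma 3, case `h = ∞`, `H ∈ ℝ`: assuming `∫₀¹ q = 0`, the nodal points `xₙʲ` of the
eigenfunction `φ(·,λₙ) = S(·,λₙ)` of the problem with `y(0)=0`, `y'(1)+Hy(1)-γ₁y(ξ₁)=0`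
satisfy, uniformly in `j`,
`xₙʲ = j/(n+1/2) - [(H-(-1)ⁿγ₁ sin((n+1/2)πξ₁))/((n+1/2)²π²)]·(j/(n+1/2))
 + Q(xₙʲ)/((n+1/2)²π²) + o(1/n²)`. -/
theorem stmt_12
    (q : ℝ → ℝ) (hq : ContDiffOn ℝ 1 q (Set.Icc 0 1))
    (hint : (∫ t in (0:ℝ)..1, q t) = 0)
    (H γ1 : ℝ) (hγ1 : γ1 ≠ 0)
    (ξ1 : ℚ) (hξ1 : (ξ1:ℝ) ∈ Set.Ioo 0 1)
    (S S' : ℂ → ℝ → ℂ)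
    (hsolS : ∀ lam : ℂ, IsSLSolution q lam (S lam) (S' lam))
    (hS0 : ∀ lam : ℂ, S lam 0 = 0) (hS'0 : ∀ lam : ℂ, S' lam 0 = 1)
    (Δ : ℂ → ℂ)
    (hΔ : ∀ lam : ℂ, Δ lam = Vform H γ1 ξ1 (S lam) (S' lam))
    (lam : ℕ → ℂ) (hen : EnumeratesZeros Δ lam)
    (X : ℕ → ℕ → ℝ) (N0 : ℕ)
    (hX : HasNodalPoints (fun l => S l) lam X (fun _ => 1) (fun n => n) N0) :
    ∀ ε > (0:ℝ), ∃ N : ℕ, ∀ n ≥ N, ∀ j : ℕ, 1 ≤ j → j ≤ n →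
      |X n j - ((j:ℝ) / ((n:ℝ) + 1/2)
        - (H - (-1:ℝ)^n * (γ1 * Real.sin (((n:ℝ) + 1/2) * Real.pi * ξ1))) /
            (((n:ℝ) + 1/2)^2 * Real.pi^2) * ((j:ℝ) / ((n:ℝ) + 1/2))
        + ((1/2) * ∫ t in (0:ℝ)..(X n j), q t) / (((n:ℝ) + 1/2)^2 * Real.pi^2))| ≤
        ε / (n:ℝ)^2 := by
  have hqc : ContinuousOn q (Icc 0 1) := hq.continuousOn
  have hqd : ∀ x ∈ Icc (0:ℝ) 1, HasDerivWithinAt q (derivWithin q (Icc 0 1) x) (Icc 0 1) x :=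
    fun x hx => ((hq.differentiableOn one_ne_zero) x hx).hasDerivWithinAt
  have hqd'c : ContinuousOn (derivWithin q (Icc 0 1)) (Icc 0 1) :=
    hq.continuousOn_derivWithin (uniqueDiffOn_Icc zero_lt_one) le_rfl
  obtain ⟨M1, hM1⟩ := isCompact_Icc.exists_bound_of_continuousOn hqc
  obtain ⟨M2, hM2⟩ := isCompact_Icc.exists_bound_of_continuousOn hqd'c
  set M := max M1 M2 with hMdef
  have hM : ∀ x ∈ Icc (0:ℝ) 1, |q x| ≤ M := fun x hx => (hM1 x hx).trans (le_max_left _ _)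
  have hM' : ∀ x ∈ Icc (0:ℝ) 1, |derivWithin q (Icc 0 1) x| ≤ M :=
    fun x hx => (hM2 x hx).trans (le_max_right _ _)
  have h0mem : (0:ℝ) ∈ Icc (0:ℝ) 1 := left_mem_Icc.2 zero_le_one
  have h1mem : (1:ℝ) ∈ Icc (0:ℝ) 1 := right_mem_Icc.2 zero_le_one
  have hM0 : 0 ≤ M := (abs_nonneg _).trans (hM 0 h0mem)
  have hQM : ∀ x ∈ Icc (0:ℝ) 1, |(1/2) * ∫ t in (0:ℝ)..x, q t| ≤ M := by
    intro x hx
    have h := intervalIntegral.norm_integral_le_of_norm_le_const (a := 0) (b := x) (f := q) (C := M)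
      (by
        intro t ht
        rw [uIoc_of_le hx.1] at ht
        exact hM t ⟨ht.1.le, ht.2.trans hx.2⟩)
    rw [sub_zero, Real.norm_eq_abs, abs_of_nonneg hx.1] at h
    rw [abs_mul, abs_of_pos (by norm_num : (0:ℝ) < 1/2)]
    have : M * x ≤ M * 1 := by have := hx.2; gcongr
    linarith
  have hξ : (ξ1:ℝ) ∈ Icc (0:ℝ) 1 := Ioo_subset_Icc_self hξ1
  set C0 := M ^ 2 + M with hC0def
  have hC0 : 0 ≤ C0 := by positivity
  obtain ⟨R, C1, C4, hC1, hC4, heig⟩ := eig_asymp H γ1 ξ1 M C0 hM0 hC0 hξ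
  obtain ⟨C, hC, hnod⟩ := nodal_asymp M C0 C1 C4 (|H| + |γ1|) hM0 hC0 hC1 hC4 (by positivity)
  set K := 1 + |R| + C1 + M with hKdef
  have hK1 : 1 ≤ K := by have := abs_nonneg R; linarith
  obtain ⟨N1, hN1, hlarge⟩ := lam_large q M hM0 hM S S' hsolS hS0 hS'0 lam X N0 hX (K ^ 2)
    (by positivity)
  intro ε hε
  obtain ⟨N2, hN2'⟩ := exists_nat_gt (C / ε)
  refine ⟨max (max N1 N2) 1, ?_⟩
  intro n hn j hj1 hj2
  have hnN1 : N1 ≤ n := (le_max_left _ _).trans ((le_max_left _ _).trans hn)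
  have hnN2 : N2 ≤ n := (le_max_right _ _).trans ((le_max_left _ _).trans hn)
  have hn1 : 1 ≤ n := (le_max_right _ _).trans hn
  obtain ⟨him, hre⟩ := hlarge n hnN1
  obtain ⟨x1, x2, x3⟩ := hX n (hN1.trans hnN1)
  set r := Real.sqrt (lam n).re with hr
  have hrsq : r ^ 2 = (lam n).re := Real.sq_sqrt ((sq_nonneg K).trans hre)
  have hrK : K ≤ r := Real.le_sqrt_of_sq_le hre
  have hR : R ≤ r := by have := le_abs_self R; linarith
  have hrC1 : C1 ≤ r := by have := abs_nonneg R; linarith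
  have hr1 : 1 ≤ r := hK1.trans hrK
  have hrM : M < r := by have := abs_nonneg R; linarith
  have hr0 : 0 < r := by linarith
  obtain ⟨d1, d2, d3, d4⟩ := re_solution q (lam n) him _ _ (hsolS (lam n))
  rw [← hrsq] at d2 d4
  have himz : ∀ x ∈ Icc (0:ℝ) 1, (S (lam n) x).im = 0 := fun x hx =>
    ((energy (fun x => q x - r ^ 2) _ _ r M hr0 d3 d4
      (by intro x hx; simpa using hM x hx) hx).1 (by simp [hS0]) (by simp [hS'0])).1
  obtain ⟨u, θ, hu0, hθ0, hz, hy, hud, hθd⟩ := prufer q _ _ r M hr0 hqc hM d1 d2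
    (by simp [hS0]) (by simp [hS'0])
  have hzero : ∀ x ∈ Icc (0:ℝ) 1, S (lam n) x = 0 ↔ Real.sin (θ x) = 0 := by
    intro x hx
    have h := hy x hx
    have hexp := (Real.exp_pos (u x)).ne'
    constructor
    · intro hs
      rw [hs] at h
      simpa [hexp] using h.symm
    · intro hs
      rw [hs, mul_zero] at h
      have : (S (lam n) x).re = 0 := by simpa [hr0.ne'] using h
      exact Complex.ext this (himz x hx)
  have hθc : ContinuousOn θ (Icc 0 1) := fun x hx => (hθd x hx).continuousWithinAt
  have hθm : StrictMonoOn θ (Icc 0 1) := by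
    apply strictMonoOn_of_hasDerivWithinAt_pos (convex_Icc 0 1) hθc
      (fun x hx => (hθd x (interior_subset hx)).mono interior_subset)
    intro x hx
    have h1 := hM x (interior_subset hx)
    have h2 : q x * Real.sin (θ x) ^ 2 ≤ M := by
      have h3 := Real.sin_sq_le_one (θ x)
      have h4 := sq_nonneg (Real.sin (θ x))
      have h5 := (abs_le.1 h1).2
      calc q x * Real.sin (θ x) ^ 2 ≤ M * Real.sin (θ x) ^ 2 := by gcongr
        _ ≤ M * 1 := by gcongr
        _ = M := mul_one M
    have h6 : q x * Real.sin (θ x) ^ 2 / r < r := by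
      rw [div_lt_iff₀ hr0]; nlinarith
    linarith
  obtain ⟨hcount, hT1, hT2⟩ := counting θ hθm hθc hθ0 (X n) n
    (fun j a b => ⟨(x1 j a b).1, (hzero _ (Ioo_subset_Icc_self (x1 j a b).1)).1 (x1 j a b).2⟩)
    x2 (fun t ht hs => x3 t ht ((hzero t (Ioo_subset_Icc_self ht)).2 hs))
  have hθb := fun x (hx : x ∈ Icc (0:ℝ) 1) =>
    theta_bound q _ θ r M hr1 hqd hM hM' hθ0 hθd hx
  have hub := fun x (hx : x ∈ Icc (0:ℝ) 1) => u_bound q u θ r M hr0 hM hu0 hud hx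
  have hyv : ∀ x ∈ Icc (0:ℝ) 1, (S (lam n) x).re = Real.exp (u x) * Real.sin (θ x) / r := by
    intro x hx
    rw [← hy x hx]; field_simp
  have hbc : Real.exp (u 1) * Real.cos (θ 1) + H * (Real.exp (u 1) * Real.sin (θ 1) / r)
        - γ1 * (Real.exp (u ξ1) * Real.sin (θ ξ1) / r) = 0 := by
    have h := hen.2.1 n
    rw [hΔ, Vform] at h
    have h2 := congrArg Complex.re h
    simp at h2
    rw [← hz 1 h1mem, ← hyv 1 h1mem, ← hyv _ hξ]
    simpa using h2
  have hT : |θ 1 - r| ≤ C0 / r ^ 2 := by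
    have := hθb 1 h1mem
    rw [hint] at this
    simpa using this
  obtain ⟨e1, e2⟩ := heig n r (θ 1) (θ ξ1) (u ξ1) (u 1) _ hr1 hR hT1 hT2 hT (hθb _ hξ) (hQM _ hξ)
    (hub _ hξ) (hub _ h1mem) hbc
  have hXj := Ioo_subset_Icc_self (x1 j hj1 hj2).1
  have hJ := hθb _ hXj
  rw [hcount j hj1 hj2] at hJ
  set N : ℝ := ((n:ℝ) + 1/2) * Real.pi with hNdef
  have hnR : (1:ℝ) ≤ n := by exact_mod_cast hn1
  have hpi3 := Real.pi_gt_three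
  have hnN : (n:ℝ) ≤ N := by rw [hNdef]; nlinarith
  have hB : |H - (-1:ℝ)^n * (γ1 * Real.sin (N * ξ1))| ≤ |H| + |γ1| := by
    refine (abs_sub _ _).trans ?_
    rw [abs_mul, abs_mul, abs_pow]
    simp only [abs_neg, abs_one, one_pow, one_mul]
    have := Real.abs_sin_le_one (N * ξ1)
    have : |γ1| * |Real.sin (N * ξ1)| ≤ |γ1| * 1 := by gcongr
    linarith
  have hfin := hnod r N (j * Real.pi) (X n j) _ _ hr1 hrC1 (hnR.trans hnN) hXj (hQM _ hXj) hB e1 e2 hJ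
  have hJN : (j:ℝ) * Real.pi / N = (j:ℝ) / ((n:ℝ) + 1/2) := by
    rw [hNdef]; field_simp
  have hN2 : N ^ 2 = ((n:ℝ) + 1/2) ^ 2 * Real.pi ^ 2 := by rw [hNdef]; ring
  rw [hJN, hN2] at hfin
  refine hfin.trans ?_
  have hn0 : (0:ℝ) < n := by linarith
  have hCn : C ≤ ε * n := by
    have h1 : C / ε < n := lt_of_lt_of_le hN2' (by exact_mod_cast hnN2)
    rw [div_lt_iff₀ hε] at h1
    linarith
  calc C / N ^ 3 ≤ C / (n:ℝ) ^ 3 := by gcongr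
    _ ≤ ε * n / (n:ℝ) ^ 3 := by gcongr
    _ = ε / (n:ℝ) ^ 2 := by field_simp
end

section
/- (Lemma 3, case h ∈ ℝ, H = ∞.) Assume ∫₀¹ q(x)dx = 0. The nodal points xₙʲ of the eigenfunction φ(·,λₙ) of the problem with conditions y'(0) + h·y(0) − γ₀·y(ξ₀) = 0 and y(1) = 0 satisfy, as n → ∞, xₙʲ = (j + 1/2)/(n + 1/2) + [h − γ₀·cos((n + 1/2)πξ₀)]·((j + 1/2)/((n + 1/2)³π²)) − (h − Q(xₙʲ))/((n + 1/2)²π²) + γ₀·cos((n + 1/2)πξ₀)/((n + 1/2)²π²) + o(1/n²), uniformly in j. -/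
open Set Filter Asymptotics

/-- The boundary form `U(y) = y'(0) + h y(0) - γ₀ y(ξ₀)`. -/
def Uform (h γ0 ξ0 : ℝ) (y y' : ℝ → ℂ) : ℂ := y' 0 + (h:ℂ) * y 0 - (γ0:ℂ) * y ξ0

/-- The eigenfunction `φ(x,λ) = U(S(·,λ)) C(x,λ) - U(C(·,λ)) S(x,λ)`. -/
def phiFun (h γ0 ξ0 : ℝ) (C C' S S' : ℂ → ℝ → ℂ) (lam : ℂ) (x : ℝ) : ℂ :=
  Uform h γ0 ξ0 (S lam) (S' lam) * C lam x - Uform h γ0 ξ0 (C lam) (C' lam) * S lam x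

/-- Real solutions of the equation with `lam = ρ ^ 2`. -/
def RS (q : ℝ → ℝ) (ρ : ℝ) (y p : ℝ → ℝ) : Prop :=
  (∀ x ∈ Set.Icc (0:ℝ) 1, HasDerivWithinAt y (p x) (Set.Icc 0 1) x) ∧
  (∀ x ∈ Set.Icc (0:ℝ) 1, HasDerivWithinAt p ((q x - ρ ^ 2) * y x) (Set.Icc 0 1) x)

lemma hasDeriv_re {f : ℝ → ℂ} {f' : ℂ} {s : Set ℝ} {x : ℝ} (hf : HasDerivWithinAt f f' s x) :
    HasDerivWithinAt (fun t => (f t).re) f'.re s x :=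
  (Complex.reCLM.hasFDerivAt.comp_hasDerivWithinAt x hf)

lemma hasDeriv_im {f : ℝ → ℂ} {f' : ℂ} {s : Set ℝ} {x : ℝ} (hf : HasDerivWithinAt f f' s x) :
    HasDerivWithinAt (fun t => (f t).im) f'.im s x :=
  (Complex.imCLM.hasFDerivAt.comp_hasDerivWithinAt x hf)

lemma RS_re {q : ℝ → ℝ} {ρ : ℝ} {Y Y' : ℝ → ℂ} (hY : IsSLSolution q ((ρ ^ 2 : ℝ) : ℂ) Y Y') :
    RS q ρ (fun t => (Y t).re) (fun t => (Y' t).re) := by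
  refine ⟨fun x hx => hasDeriv_re (hY.1 x hx), fun x hx => ?_⟩
  have := hasDeriv_re (hY.2 x hx)
  rwa [← Complex.ofReal_sub, Complex.re_ofReal_mul] at this

lemma RS_im {q : ℝ → ℝ} {ρ : ℝ} {Y Y' : ℝ → ℂ} (hY : IsSLSolution q ((ρ ^ 2 : ℝ) : ℂ) Y Y') :
    RS q ρ (fun t => (Y t).im) (fun t => (Y' t).im) := by
  refine ⟨fun x hx => hasDeriv_im (hY.1 x hx), fun x hx => ?_⟩
  have := hasDeriv_im (hY.2 x hx)
  rwa [← Complex.ofReal_sub, Complex.im_ofReal_mul] at this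

/-- The complex phase vector. -/
noncomputable def zfun (ρ : ℝ) (y p : ℝ → ℝ) (x : ℝ) : ℂ :=
  (y x : ℂ) - Complex.I * ((p x / ρ : ℝ) : ℂ)

lemma zfun_re (ρ : ℝ) (y p : ℝ → ℝ) (x : ℝ) : (zfun ρ y p x).re = y x := by
  simp [zfun]

lemma zfun_im (ρ : ℝ) (y p : ℝ → ℝ) (x : ℝ) : (zfun ρ y p x).im = - (p x / ρ) := by
  simp [zfun, -Complex.ofReal_div]

lemma zfun_deriv {q : ℝ → ℝ} {ρ : ℝ} {y p : ℝ → ℝ} (hρ : 0 < ρ) (hy : RS q ρ y p)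
    {x : ℝ} (hx : x ∈ Set.Icc (0:ℝ) 1) :
    HasDerivWithinAt (zfun ρ y p)
      (Complex.I * ρ * zfun ρ y p x - Complex.I * ((q x / ρ * y x : ℝ) : ℂ)) (Set.Icc 0 1) x := by
  have h1 := (hy.1 x hx).ofReal_comp
  have h2 := (((hy.2 x hx).div_const ρ).ofReal_comp).const_mul Complex.I
  refine (h1.sub h2).congr_deriv ?_
  have hr : (ρ : ℂ) ≠ 0 := by exact_mod_cast hρ.ne'
  simp only [zfun]
  push_cast
  field_simp
  linear_combination ((p x : ℂ) * ρ) * Complex.I_sq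

lemma norm_expI (t : ℝ) : ‖Complex.exp (-(Complex.I * t))‖ = 1 := by
  rw [Complex.norm_exp]; simp

lemma gron {q : ℝ → ℝ} {ρ M : ℝ} {y p : ℝ → ℝ} (hρ : 0 < ρ) (hy : RS q ρ y p) (hM : 0 < M)
    (hq : ∀ x ∈ Set.Icc (0:ℝ) 1, |q x| ≤ M) {x : ℝ} (hx : x ∈ Set.Icc (0:ℝ) 1) :
    ‖Complex.exp (-(Complex.I * ((ρ * x : ℝ) : ℂ))) * zfun ρ y p x - zfun ρ y p 0‖ ≤
      ‖zfun ρ y p 0‖ * (Real.exp (M / ρ) - 1) := by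
  set w : ℝ → ℂ := fun x => Complex.exp (-(Complex.I * ((ρ * x : ℝ) : ℂ))) * zfun ρ y p x with hw
  have hw0 : w 0 = zfun ρ y p 0 := by simp [hw]
  have hder : ∀ x ∈ Set.Icc (0:ℝ) 1, HasDerivWithinAt w
      (- Complex.exp (-(Complex.I * ((ρ * x : ℝ) : ℂ))) *
        (Complex.I * ((q x / ρ * y x : ℝ) : ℂ))) (Set.Icc 0 1) x := by
    intro x hx
    have h1 : HasDerivWithinAt (fun x : ℝ => -(Complex.I * ((ρ * x : ℝ) : ℂ)))
        (-(Complex.I * ((ρ * 1 : ℝ) : ℂ))) (Set.Icc 0 1) x :=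
      ((((hasDerivWithinAt_id x _).const_mul ρ).ofReal_comp).const_mul Complex.I).neg
    refine (h1.cexp.mul (zfun_deriv hρ hy hx)).congr_deriv ?_
    push_cast
    ring
  have hnw : ∀ x, ‖w x‖ = ‖zfun ρ y p x‖ := by
    intro x; simp only [hw, norm_mul, norm_expI, one_mul]
  have key := norm_le_gronwallBound_of_norm_deriv_right_le (f := fun x => w x - w 0)
    (f' := fun x => - Complex.exp (-(Complex.I * ((ρ * x : ℝ) : ℂ))) *
        (Complex.I * ((q x / ρ * y x : ℝ) : ℂ))) (δ := 0) (K := M / ρ) (ε := M / ρ * ‖w 0‖)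
    (a := 0) (b := 1) ?_ ?_ ?_ ?_ x hx
  · rw [← hw0]
    refine key.trans ?_
    have hK : M / ρ ≠ 0 := by positivity
    rw [gronwallBound_of_K_ne_0 hK]
    beta_reduce
    rw [zero_mul, zero_add, mul_div_cancel_left₀ _ hK]
    have : M / ρ * (x - 0) ≤ M / ρ := by
      have : 0 < M / ρ := by positivity
      nlinarith [hx.2]
    gcongr
  · intro x hx
    exact (hder x hx).continuousWithinAt.sub continuousWithinAt_const
  · intro x hx
    exact ((hder x ⟨hx.1, hx.2.le⟩).sub_const (w 0)).mono_of_mem_nhdsWithin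
      (Icc_mem_nhdsGE_of_mem hx)
  · simp
  · intro x hx
    rw [norm_mul, norm_neg, norm_expI, one_mul, norm_mul, Complex.norm_I, one_mul,
      Complex.norm_real, Real.norm_eq_abs, abs_mul, abs_div, abs_of_pos hρ]
    have h1 : |y x| ≤ ‖w x‖ := by
      rw [hnw, ← zfun_re ρ y p x]; exact Complex.abs_re_le_norm _
    have h2 : ‖w x‖ ≤ ‖w x - w 0‖ + ‖w 0‖ := by
      simpa using norm_add_le (w x - w 0) (w 0)
    have h3 := hq x ⟨hx.1, hx.2.le⟩
    calc |q x| / ρ * |y x| ≤ M / ρ * (‖w x - w 0‖ + ‖w 0‖) := by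
          gcongr; exact h1.trans h2
      _ = _ := by ring

lemma exp_sub_one_le {t : ℝ} (h0 : 0 ≤ t) (h1 : t ≤ 1/2) : Real.exp t - 1 ≤ 2 * t := by
  have := Real.abs_exp_sub_one_le (x := t) (by rw [abs_of_nonneg h0]; linarith)
  rw [abs_of_nonneg h0] at this
  exact (le_abs_self _).trans this

/-- Consequence: value bounds. -/
lemma gron_val {q : ℝ → ℝ} {ρ M : ℝ} {y p : ℝ → ℝ} (hρ : 0 < ρ) (hy : RS q ρ y p) (hM : 0 < M)
    (hMρ : 4 * M ≤ ρ)
    (hq : ∀ x ∈ Set.Icc (0:ℝ) 1, |q x| ≤ M) {x : ℝ} (hx : x ∈ Set.Icc (0:ℝ) 1) :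
    ‖zfun ρ y p x - Complex.exp (Complex.I * ((ρ * x : ℝ) : ℂ)) * zfun ρ y p 0‖ ≤
      ‖zfun ρ y p 0‖ * (2 * (M / ρ)) := by
  have h := gron hρ hy hM hq hx
  have h1 : Real.exp (M / ρ) - 1 ≤ 2 * (M / ρ) := by
    apply exp_sub_one_le (by positivity)
    rw [div_le_iff₀ hρ]; linarith
  have h2 : zfun ρ y p x - Complex.exp (Complex.I * ((ρ * x : ℝ) : ℂ)) * zfun ρ y p 0 =
      Complex.exp (Complex.I * ((ρ * x : ℝ) : ℂ)) *
      (Complex.exp (-(Complex.I * ((ρ * x : ℝ) : ℂ))) * zfun ρ y p x - zfun ρ y p 0) := by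
    rw [mul_sub, ← mul_assoc, ← Complex.exp_add]; simp
  rw [h2, norm_mul]
  have h3 : ‖Complex.exp (Complex.I * ((ρ * x : ℝ) : ℂ))‖ = 1 := by
    rw [Complex.norm_exp]; simp
  rw [h3, one_mul]
  exact h.trans (by gcongr)

lemma zfun_ne {q : ℝ → ℝ} {ρ M : ℝ} {y p : ℝ → ℝ} (hρ : 0 < ρ) (hy : RS q ρ y p) (hM : 0 < M)
    (hMρ : 4 * M ≤ ρ)
    (hq : ∀ x ∈ Set.Icc (0:ℝ) 1, |q x| ≤ M) (h0 : zfun ρ y p 0 ≠ 0)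
    {x : ℝ} (hx : x ∈ Set.Icc (0:ℝ) 1) : zfun ρ y p x ≠ 0 := by
  intro hz
  have h := gron_val hρ hy hM hMρ hq hx
  have h3 : ‖Complex.exp (Complex.I * ((ρ * x : ℝ) : ℂ))‖ = 1 := by
    rw [Complex.norm_exp]; simp
  rw [hz, zero_sub, norm_neg, norm_mul, h3, one_mul] at h
  have : 0 < ‖zfun ρ y p 0‖ := norm_pos_iff.mpr h0
  have h4 : 2 * (M / ρ) ≤ 1/2 := by
    rw [← mul_div_assoc, div_le_iff₀ hρ]; linarith
  nlinarith

lemma RS_zero {q : ℝ → ℝ} {ρ M : ℝ} {y p : ℝ → ℝ} (hρ : 0 < ρ) (hy : RS q ρ y p) (hM : 0 < M)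
    (hMρ : 4 * M ≤ ρ)
    (hq : ∀ x ∈ Set.Icc (0:ℝ) 1, |q x| ≤ M) (hy0 : y 0 = 0) (hp0 : p 0 = 0)
    {x : ℝ} (hx : x ∈ Set.Icc (0:ℝ) 1) : y x = 0 := by
  have h := gron_val hρ hy hM hMρ hq hx
  have h0 : zfun ρ y p 0 = 0 := by simp [zfun, hy0, hp0]
  rw [h0] at h
  simp only [mul_zero, sub_zero, norm_zero, zero_mul, norm_le_zero_iff] at h
  rw [← zfun_re ρ y p x, h]; simp

/-- Disconjugacy / reality lemma. -/
lemma disconj {q : ℝ → ℝ} {lam : ℂ} {Y Y' : ℝ → ℂ} (hY : IsSLSolution q lam Y Y') {M : ℝ}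
    (hq : ∀ x ∈ Set.Icc (0:ℝ) 1, |q x| ≤ M) {a b t : ℝ} (ha : 0 ≤ a) (hb : b ≤ 1)
    (hat : a < t) (htb : t < b) (hYa : Y a = 0) (hYb : Y b = 0) (hYt : Y t ≠ 0) :
    lam.im = 0 ∧ 1 / (b - a) ^ 2 ≤ lam.re + M := by
  have hab : a < b := hat.trans htb
  have hsub : Set.Icc a b ⊆ Set.Icc (0:ℝ) 1 := Set.Icc_subset_Icc ha hb
  -- general principle
  have gen : ∀ (F F' : ℝ → ℝ), (∀ x ∈ Set.Icc a b, HasDerivWithinAt F (F' x) (Set.Icc a b) x) →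
      (∀ x ∈ Set.Icc a b, 0 ≤ F' x) → F a = 0 → F b = 0 → F' t = 0 := by
    intro F F' hF hF' hFa hFb
    have hmono : MonotoneOn F (Set.Icc a b) := by
      apply monotoneOn_of_hasDerivWithinAt_nonneg (f' := F') (convex_Icc a b)
      · intro x hx; exact (hF x hx).continuousWithinAt
      · intro x hx
        rw [interior_Icc] at hx ⊢
        exact (hF x (Set.Ioo_subset_Icc_self hx)).mono Set.Ioo_subset_Icc_self
      · intro x hx; rw [interior_Icc] at hx; exact hF' x (Set.Ioo_subset_Icc_self hx)
    have hz : ∀ x ∈ Set.Icc a b, F x = 0 := by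
      intro x hx
      have h1 := hmono (Set.left_mem_Icc.mpr hab.le) hx hx.1
      have h2 := hmono hx (Set.right_mem_Icc.mpr hab.le) hx.2
      linarith
    have ht : t ∈ Set.Icc a b := ⟨hat.le, htb.le⟩
    have h1 : HasDerivWithinAt F 0 (Set.Icc a b) t :=
      (hasDerivWithinAt_const t (Set.Icc a b) (0:ℝ)).congr hz (hz t ht)
    exact (uniqueDiffOn_Icc hab t ht).eq_deriv _ (hF t ht) h1
  have hu : ∀ x ∈ Set.Icc a b, HasDerivWithinAt (fun t => (Y t).re) (Y' x).re (Set.Icc a b) x :=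
    fun x hx => (hasDeriv_re (hY.1 x (hsub hx))).mono hsub
  have hv : ∀ x ∈ Set.Icc a b, HasDerivWithinAt (fun t => (Y t).im) (Y' x).im (Set.Icc a b) x :=
    fun x hx => (hasDeriv_im (hY.1 x (hsub hx))).mono hsub
  have hu' : ∀ x ∈ Set.Icc a b, HasDerivWithinAt (fun t => (Y' t).re)
      ((q x - lam.re) * (Y x).re + lam.im * (Y x).im) (Set.Icc a b) x := by
    intro x hx
    refine ((hasDeriv_re (hY.2 x (hsub hx))).mono hsub).congr_deriv ?_
    simp
  have hv' : ∀ x ∈ Set.Icc a b, HasDerivWithinAt (fun t => (Y' t).im)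
      ((q x - lam.re) * (Y x).im - lam.im * (Y x).re) (Set.Icc a b) x := by
    intro x hx
    refine ((hasDeriv_im (hY.2 x (hsub hx))).mono hsub).congr_deriv ?_
    simp; ring
  have hpos : 0 < (Y t).re ^ 2 + (Y t).im ^ 2 := by
    have := Complex.normSq_pos.mpr hYt
    rw [Complex.normSq_apply] at this; nlinarith
  have htm : t ∈ Set.Icc a b := ⟨hat.le, htb.le⟩
  constructor
  · -- imaginary part
    have h1 := gen (fun x => -lam.im * ((Y x).re * (Y' x).im - (Y x).im * (Y' x).re))
      (fun x => lam.im ^ 2 * ((Y x).re ^ 2 + (Y x).im ^ 2)) ?_ ?_ ?_ ?_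
    · rcases mul_eq_zero.mp h1 with h2 | h2
      · exact pow_eq_zero_iff (two_ne_zero) |>.mp h2
      · exact absurd h2 hpos.ne'
    · intro x hx
      refine ((((hu x hx).mul (hv' x hx)).sub ((hv x hx).mul (hu' x hx))).const_mul
        (-lam.im)).congr_deriv ?_
      ring
    · intro x _; positivity
    · simp [hYa]
    · simp [hYb]
  · by_contra hcon
    push Not at hcon
    set k := 1 / (b - a) ^ 2 with hk
    have hba : 0 < b - a := sub_pos.mpr hab
    have hk0 : 0 < k := by positivity
    have hk1 : k * (b - a) ^ 2 = 1 := by rw [hk]; field_simp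
    set g : ℝ → ℝ := fun x => -2 * k * (x - (a + b) / 2) with hg
    have hgd : ∀ x ∈ Set.Icc a b, HasDerivWithinAt g (-2 * k) (Set.Icc a b) x := by
      intro x _
      refine (((hasDerivWithinAt_id x _).sub_const ((a+b)/2)).const_mul (-2 * k)).congr_deriv ?_
      ring
    have hcoef : ∀ x ∈ Set.Icc a b, 0 < q x - lam.re + 2 * k - g x ^ 2 := by
      intro x hx
      have h1 := (abs_le.mp (hq x (hsub hx))).1
      have h2 : g x ^ 2 ≤ k := by
        have h3 : (x - (a + b) / 2) ^ 2 ≤ ((b - a) / 2) ^ 2 := by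
          apply sq_le_sq'
          · linarith [hx.1]
          · linarith [hx.2]
        calc g x ^ 2 = 4 * k ^ 2 * (x - (a + b) / 2) ^ 2 := by simp only [hg]; ring
          _ ≤ 4 * k ^ 2 * ((b - a) / 2) ^ 2 := by gcongr
          _ = k * (k * (b - a) ^ 2) := by ring
          _ = k := by rw [hk1, mul_one]
      linarith
    have h1 := gen (fun x => ((Y x).re * (Y' x).re + (Y x).im * (Y' x).im) -
        g x * ((Y x).re * (Y x).re + (Y x).im * (Y x).im))
      (fun x => ((Y' x).re - g x * (Y x).re) ^ 2 + ((Y' x).im - g x * (Y x).im) ^ 2 +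
        (q x - lam.re + 2 * k - g x ^ 2) * ((Y x).re ^ 2 + (Y x).im ^ 2)) ?_ ?_ ?_ ?_
    · have h2 := mul_pos (hcoef t htm) hpos
      nlinarith [sq_nonneg ((Y' t).re - g t * (Y t).re), sq_nonneg ((Y' t).im - g t * (Y t).im)]
    · intro x hx
      refine ((((hu x hx).mul (hu' x hx)).add ((hv x hx).mul (hv' x hx))).sub
        ((hgd x hx).mul (((hu x hx).mul (hu x hx)).add ((hv x hx).mul (hv x hx))))).congr_deriv ?_
      simp only [Pi.mul_apply, Pi.add_apply]
      ring
    · intro x hx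
      have := (hcoef x hx).le
      positivity
    · simp [hYa]
    · simp [hYb]

lemma pruefer {q : ℝ → ℝ} {ρ M : ℝ} {y p : ℝ → ℝ} (hρ : 0 < ρ) (hy : RS q ρ y p) (hM : 0 < M)
    (hMρ : 4 * M ≤ ρ) (hqc : ContinuousOn q (Set.Icc 0 1))
    (hq : ∀ x ∈ Set.Icc (0:ℝ) 1, |q x| ≤ M) (h0 : 0 < y 0) :
    ∃ θ : ℝ → ℝ, θ 0 = Real.arctan (-(p 0 / ρ) / y 0) ∧
      (∀ x ∈ Set.Icc (0:ℝ) 1,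
        HasDerivWithinAt θ (ρ - q x / ρ * Real.cos (θ x) ^ 2) (Set.Icc 0 1) x) ∧
      ∀ x ∈ Set.Icc (0:ℝ) 1, ∃ r : ℝ, 0 < r ∧ y x = r * Real.cos (θ x) := by
  set z := zfun ρ y p with hz
  have hz0 : z 0 ≠ 0 := by
    intro hh
    have := zfun_re ρ y p 0
    rw [← hz, hh] at this
    simp at this; linarith
  have hzne : ∀ x ∈ Set.Icc (0:ℝ) 1, z x ≠ 0 := fun x hx => zfun_ne hρ hy hM hMρ hq hz0 hx
  set g : ℝ → ℂ := fun x => (Complex.I * ρ * z x - Complex.I * ((q x / ρ * y x : ℝ) : ℂ)) / z x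
    with hg
  have hzd : ∀ x ∈ Set.Icc (0:ℝ) 1, HasDerivWithinAt z (g x * z x) (Set.Icc 0 1) x := by
    intro x hx
    refine (zfun_deriv hρ hy hx).congr_deriv ?_
    simp only [hg]
    rw [div_mul_cancel₀ _ (hzne x hx)]
  have hzc : ContinuousOn z (Set.Icc 0 1) := fun x hx => (hzd x hx).continuousWithinAt
  have hyc : ContinuousOn y (Set.Icc 0 1) := fun x hx => (hy.1 x hx).continuousWithinAt
  have hgc : ContinuousOn g (Set.Icc 0 1) := by
    apply ContinuousOn.div _ hzc hzne
    apply ContinuousOn.sub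
    · exact continuousOn_const.mul hzc
    · apply continuousOn_const.mul
      exact Complex.continuous_ofReal.comp_continuousOn ((hqc.div_const ρ).mul hyc)
  set G : ℝ → ℂ := Set.IccExtend (zero_le_one (α := ℝ)) ((Set.Icc (0:ℝ) 1).domRestrict g) with hG
  have hGc : Continuous G := (continuousOn_iff_continuous_domRestrict.mp hgc).Icc_extend'
  have hGg : ∀ x ∈ Set.Icc (0:ℝ) 1, G x = g x := by
    intro x hx
    rw [hG, Set.IccExtend_of_mem _ _ hx]; rfl
  set L : ℝ → ℂ := fun x => ∫ t in (0:ℝ)..x, G t with hL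
  have hLd : ∀ x ∈ Set.Icc (0:ℝ) 1, HasDerivWithinAt L (g x) (Set.Icc 0 1) x := by
    intro x hx
    rw [← hGg x hx]
    exact (hGc.integral_hasStrictDerivAt 0 x).hasDerivAt.hasDerivWithinAt
  have hL0 : L 0 = 0 := by simp [hL]
  have hconst : ∀ x ∈ Set.Icc (0:ℝ) 1, z x = z 0 * Complex.exp (L x) := by
    intro x hx
    have hd : ∀ x ∈ Set.Icc (0:ℝ) 1,
        HasDerivWithinAt (fun x => z x * Complex.exp (-L x)) 0 (Set.Icc 0 1) x := by
      intro x hx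
      refine ((hzd x hx).mul (hLd x hx).neg.cexp).congr_deriv ?_
      ring
    have h1 := (convex_Icc (0:ℝ) 1).norm_image_sub_le_of_norm_hasDerivWithin_le
      (f' := fun _ => (0:ℂ)) (C := 0) hd (by simp) (Set.left_mem_Icc.mpr zero_le_one) hx
    simp only [zero_mul, norm_le_zero_iff, hL0, neg_zero, Complex.exp_zero, mul_one] at h1
    rw [sub_eq_zero] at h1
    rw [← h1, mul_assoc, ← Complex.exp_add]; simp
  set u := -(p 0 / ρ) / y 0 with hu
  set R0 := y 0 * Real.sqrt (1 + u ^ 2) with hR0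
  have hs : 0 < Real.sqrt (1 + u ^ 2) := Real.sqrt_pos.mpr (by positivity)
  have hR0p : 0 < R0 := by positivity
  have hz0e : z 0 = (R0 : ℂ) * Complex.exp (Real.arctan u * Complex.I) := by
    apply Complex.ext
    · rw [Complex.re_ofReal_mul, Complex.exp_ofReal_mul_I_re, Real.cos_arctan, hz, zfun_re, hR0]
      field_simp
    · rw [Complex.im_ofReal_mul, Complex.exp_ofReal_mul_I_im, Real.sin_arctan, hz, zfun_im, hR0]
      rw [mul_assoc, mul_div_cancel₀ _ hs.ne', hu, mul_div_cancel₀ _ h0.ne']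
  refine ⟨fun x => Real.arctan u + (L x).im, by simp [hL0], ?_⟩
  have hrep : ∀ x ∈ Set.Icc (0:ℝ) 1, z x = ((R0 * Real.exp (L x).re : ℝ) : ℂ) *
      Complex.exp (((Real.arctan u + (L x).im : ℝ) : ℂ) * Complex.I) := by
    intro x hx
    rw [hconst x hx, hz0e]
    conv_lhs => rw [← Complex.re_add_im (L x)]
    push_cast
    rw [Complex.exp_add, add_mul, Complex.exp_add]
    ring
  have hyrep : ∀ x ∈ Set.Icc (0:ℝ) 1, y x = (R0 * Real.exp (L x).re) *
      Real.cos (Real.arctan u + (L x).im) := by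
    intro x hx
    rw [← zfun_re ρ y p x, ← hz, hrep x hx, Complex.re_ofReal_mul, Complex.exp_ofReal_mul_I_re]
  constructor
  · intro x hx
    refine ((hasDeriv_im (hLd x hx)).const_add (Real.arctan u)).congr_deriv ?_
    set t := Real.arctan u + (L x).im with ht
    set R := R0 * Real.exp (L x).re with hR
    have hRp : 0 < R := by positivity
    have hRc : (R : ℂ) ≠ 0 := by exact_mod_cast hRp.ne'
    have : g x = Complex.I * ρ - Complex.I * ((q x / ρ * Real.cos t : ℝ) : ℂ) *
        Complex.exp (((-t : ℝ) : ℂ) * Complex.I) := by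
      simp only [hg]
      rw [sub_div, mul_div_cancel_right₀ _ (hzne x hx), hrep x hx, hyrep x hx]
      rw [Complex.ofReal_neg, neg_mul, Complex.exp_neg]
      have he := Complex.exp_ne_zero ((t:ℂ) * Complex.I)
      have hrr : (ρ:ℂ) ≠ 0 := by exact_mod_cast hρ.ne'
      push_cast [← ht, ← hR]
      field_simp
    rw [this]
    have h2 : (Complex.I * ((q x / ρ * Real.cos t : ℝ) : ℂ) *
        Complex.exp (((-t : ℝ) : ℂ) * Complex.I)).im = q x / ρ * Real.cos t ^ 2 := by
      rw [mul_assoc, Complex.I_mul_im, Complex.re_ofReal_mul, Complex.exp_ofReal_mul_I_re,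
        Real.cos_neg]
      ring
    rw [Complex.sub_im, h2]
    simp [ht]
  · intro x hx
    exact ⟨_, by positivity, hyrep x hx⟩

lemma phase_est {q q' Qi θ : ℝ → ℝ} {ρ M M1 : ℝ} (hρ : 1 ≤ ρ) (hM : 0 < M)
    (hq : ∀ x ∈ Set.Icc (0:ℝ) 1, |q x| ≤ M) (hq1 : ∀ x ∈ Set.Icc (0:ℝ) 1, |q' x| ≤ M1)
    (hqd : ∀ x ∈ Set.Icc (0:ℝ) 1, HasDerivWithinAt q (q' x) (Set.Icc 0 1) x)
    (hQ : ∀ x ∈ Set.Icc (0:ℝ) 1, HasDerivWithinAt Qi (q x) (Set.Icc 0 1) x) (hQ0 : Qi 0 = 0)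
    (hθ : ∀ x ∈ Set.Icc (0:ℝ) 1,
        HasDerivWithinAt θ (ρ - q x / ρ * Real.cos (θ x) ^ 2) (Set.Icc 0 1) x)
    {x : ℝ} (hx : x ∈ Set.Icc (0:ℝ) 1) :
    |θ x - θ 0 - ρ * x + (1/2) * Qi x / ρ| ≤ (M1 + M ^ 2 + M) / ρ ^ 2 := by
  have hρ0 : 0 < ρ := by linarith
  set E : ℝ → ℝ := fun x => θ x - ρ * x + (1/2) * Qi x / ρ +
    q x * Real.sin (2 * θ x) / (4 * ρ ^ 2) with hE
  have hEd : ∀ x ∈ Set.Icc (0:ℝ) 1, HasDerivWithinAt E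
      (q' x * Real.sin (2 * θ x) / (4 * ρ ^ 2) -
        q x ^ 2 / (2 * ρ ^ 3) * Real.cos (2 * θ x) * Real.cos (θ x) ^ 2) (Set.Icc 0 1) x := by
    intro x hx
    have h1 := ((hasDerivWithinAt_id x (Set.Icc (0:ℝ) 1)).const_mul ρ)
    have h2 := ((hQ x hx).const_mul (1/2)).div_const ρ
    have h3 := ((hqd x hx).mul ((hθ x hx).const_mul 2).sin).div_const (4 * ρ ^ 2)
    refine ((((hθ x hx).sub h1).add h2).add h3).congr_deriv ?_
    rw [Real.cos_two_mul]
    field_simp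
    ring
  have hb : ∀ x ∈ Set.Icc (0:ℝ) 1, ‖q' x * Real.sin (2 * θ x) / (4 * ρ ^ 2) -
        q x ^ 2 / (2 * ρ ^ 3) * Real.cos (2 * θ x) * Real.cos (θ x) ^ 2‖ ≤
        (M1 + M ^ 2) / ρ ^ 2 := by
    intro x hx
    rw [Real.norm_eq_abs]
    have hM1 : 0 ≤ M1 := (abs_nonneg _).trans (hq1 x hx)
    have a1 : |q' x * Real.sin (2 * θ x) / (4 * ρ ^ 2)| ≤ M1 / ρ ^ 2 := by
      rw [abs_div, abs_mul, abs_of_pos (show 0 < 4 * ρ ^ 2 by positivity)]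
      calc |q' x| * |Real.sin (2 * θ x)| / (4 * ρ ^ 2) ≤ M1 * 1 / (1 * ρ ^ 2) := by
            gcongr
            · exact hq1 x hx
            · exact Real.abs_sin_le_one _
            · norm_num
        _ = M1 / ρ ^ 2 := by ring
    have a2 : |q x ^ 2 / (2 * ρ ^ 3) * Real.cos (2 * θ x) * Real.cos (θ x) ^ 2| ≤
        M ^ 2 / ρ ^ 2 := by
      rw [abs_mul, abs_mul, abs_div, abs_of_pos (show 0 < 2 * ρ ^ 3 by positivity), abs_pow,
        abs_pow]
      calc |q x| ^ 2 / (2 * ρ ^ 3) * |Real.cos (2 * θ x)| * |Real.cos (θ x)| ^ 2 ≤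
            M ^ 2 / (ρ ^ 2) * 1 * 1 ^ 2 := by
            gcongr
            · exact hq x hx
            · nlinarith [sq_nonneg ρ, pow_pos hρ0 2]
            · exact Real.abs_cos_le_one _
            · exact Real.abs_cos_le_one _
        _ = M ^ 2 / ρ ^ 2 := by ring
    calc _ ≤ _ := abs_sub _ _
      _ ≤ M1 / ρ ^ 2 + M ^ 2 / ρ ^ 2 := add_le_add a1 a2
      _ = _ := by ring
  have h1 := (convex_Icc (0:ℝ) 1).norm_image_sub_le_of_norm_hasDerivWithin_le hEd hb
    (Set.left_mem_Icc.mpr zero_le_one) hx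
  rw [Real.norm_eq_abs, Real.norm_eq_abs, sub_zero, abs_of_nonneg hx.1] at h1
  have hM1 : 0 ≤ M1 := (abs_nonneg _).trans (hq1 x hx)
  have h1' : |E x - E 0| ≤ (M1 + M ^ 2) / ρ ^ 2 := by
    refine h1.trans (mul_le_of_le_one_right (by positivity) hx.2)
  have hs : ∀ x ∈ Set.Icc (0:ℝ) 1, |q x * Real.sin (2 * θ x) / (4 * ρ ^ 2)| ≤
      M / ρ ^ 2 / 4 := by
    intro x hx
    rw [abs_div, abs_mul, abs_of_pos (show 0 < 4 * ρ ^ 2 by positivity)]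
    calc |q x| * |Real.sin (2 * θ x)| / (4 * ρ ^ 2) ≤ M * 1 / (4 * ρ ^ 2) := by
            gcongr
            · exact hq x hx
            · exact Real.abs_sin_le_one _
      _ = M / ρ ^ 2 / 4 := by field_simp
  have s1 := hs x hx
  have s0 := hs 0 (Set.left_mem_Icc.mpr zero_le_one)
  have hp : 0 < M / ρ ^ 2 := by positivity
  have he : (M1 + M ^ 2 + M) / ρ ^ 2 = (M1 + M ^ 2) / ρ ^ 2 + M / ρ ^ 2 := by ring
  rw [he]
  simp only [hE, hQ0, mul_zero, zero_div] at h1'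
  rw [abs_le] at *
  constructor <;> linarith [h1'.1, h1'.2, s1.1, s1.2, s0.1, s0.2]

lemma count_lemma {n m : ℕ} (f : ℕ → ℕ) (hn : 1 ≤ n)
    (hmono : StrictMonoOn f (Set.Icc 0 (n-1))) (hlt : ∀ j ≤ n - 1, f j < m)
    (hsurj : ∀ k < m, ∃ j ≤ n - 1, f j = k) : m = n ∧ ∀ j ≤ n - 1, f j = j := by
  have key : ∀ j ≤ n - 1, f j = j := by
    intro j
    induction j using Nat.strong_induction_on with
    | _ j ih =>
      intro hj
      have hge : j ≤ f j := by
        rcases Nat.eq_zero_or_pos j with h0 | h0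
        · omega
        · have h1 := ih (j-1) (by omega) (by omega)
          have h2 := hmono (a := j - 1) (b := j) ⟨by omega, by omega⟩ ⟨by omega, hj⟩ (by omega)
          omega
      by_contra hne
      have hgt : j < f j := by omega
      obtain ⟨i, hi, hfi⟩ := hsurj j (hgt.trans (hlt j hj))
      rcases lt_trichotomy i j with h | h | h
      · have := ih i h hi; omega
      · subst h; omega
      · have := hmono (a := j) (b := i) ⟨by omega, hj⟩ ⟨by omega, hi⟩ h
        omega
  refine ⟨?_, key⟩
  have h1 := hlt (n-1) le_rfl
  rw [key _ le_rfl] at h1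
  by_contra hne
  obtain ⟨j, hj, hfj⟩ := hsurj n (by omega)
  rw [key j hj] at hfj; omega

lemma arctan_est (u : ℝ) : |Real.arctan u - u| ≤ u ^ 2 := by
  have hd : ∀ x ∈ Set.uIcc 0 u, HasDerivWithinAt (fun t => Real.arctan t - t)
      (1 / (1 + x ^ 2) - 1) (Set.uIcc 0 u) x := fun x _ =>
    ((Real.hasDerivAt_arctan x).sub (hasDerivAt_id x)).hasDerivWithinAt
  have h1 := (convex_uIcc (0:ℝ) u).norm_image_sub_le_of_norm_hasDerivWithin_le (C := |u|) hd ?_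
    Set.left_mem_uIcc Set.right_mem_uIcc
  · simpa [Real.norm_eq_abs, ← sq] using h1
  · intro x hx
    have hxu : |x| ≤ |u| := by simpa using Set.abs_sub_left_of_mem_uIcc hx
    have he : 1 / (1 + x ^ 2) - 1 = - (x ^ 2 / (1 + x ^ 2)) := by field_simp; ring
    rw [he, norm_neg, Real.norm_eq_abs, abs_of_nonneg (by positivity)]
    refine le_trans ?_ hxu
    rw [div_le_iff₀ (by positivity), ← sq_abs x]
    nlinarith [abs_nonneg x, sq_nonneg (|x| - 1), mul_nonneg (abs_nonneg x) (sq_nonneg (|x|-1))]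

lemma final_alg {ρ N J X c Qx A M D B : ℝ} (hρ : 1 ≤ ρ) (hB : 2 * B ≤ ρ ^ 2)
    (hJ0 : 0 ≤ J) (hJN : J ≤ N) (hc : |c| ≤ A) (hQ : |Qx| ≤ M) (hB0 : 0 ≤ B)
    (h1 : |N - ρ| ≤ B / ρ) (h2 : |N - ρ - c / ρ| ≤ D / ρ ^ 2)
    (h3 : |ρ * X - J + (c - Qx) / ρ| ≤ D / ρ ^ 2) (hN1 : 1 ≤ N) :
    |X - (J / N + c * J / N ^ 3 - (c - Qx) / N ^ 2)| ≤
      (8 * D + 2 * (3 * A * B + 4 * D) + 12 * (A + M) * B) / N ^ 3 := by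
  have hρ0 : 0 < ρ := by linarith
  have hA0 : 0 ≤ A := (abs_nonneg _).trans hc
  have hM0 : 0 ≤ M := (abs_nonneg _).trans hQ
  have hD0 : 0 ≤ D := by
    have := (abs_nonneg _).trans h2
    by_contra hh
    push Not at hh
    have : D / ρ ^ 2 < 0 := div_neg_of_neg_of_pos hh (by positivity)
    linarith
  have hBρ : B / ρ ≤ ρ / 2 := by
    rw [div_le_iff₀ hρ0]; nlinarith
  have hN2 : N ≤ 2 * ρ := by linarith [(abs_le.mp h1).2]
  have hN3 : ρ ≤ 2 * N := by linarith [(abs_le.mp h1).1]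
  have hN0 : 0 < N := by linarith
  -- the three pieces
  have hdec : X - (J / N + c * J / N ^ 3 - (c - Qx) / N ^ 2) =
      (ρ * X - J + (c - Qx) / ρ) / ρ +
      J * ((N - ρ) * N ^ 2 - c * ρ) / (ρ * N ^ 3) -
      (c - Qx) * ((N - ρ) * (N + ρ)) / (ρ ^ 2 * N ^ 2) := by
    field_simp
    ring
  have hNN : |(N - ρ) * (N + ρ)| ≤ 3 * B := by
    rw [abs_mul, abs_of_pos (show 0 < N + ρ by linarith)]
    calc |N - ρ| * (N + ρ) ≤ B / ρ * (3 * ρ) := by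
          gcongr
          linarith
      _ = 3 * B := by field_simp
  have t1 : |(ρ * X - J + (c - Qx) / ρ) / ρ| ≤ 8 * D / N ^ 3 := by
    rw [abs_div, abs_of_pos hρ0]
    calc _ ≤ D / ρ ^ 2 / ρ := by gcongr
      _ = 8 * D / (2 * ρ) ^ 3 := by field_simp; norm_num
      _ ≤ 8 * D / N ^ 3 := by gcongr
  have hin : |(N - ρ) * N ^ 2 - c * ρ| ≤ 3 * A * B + 4 * D := by
    have he : (N - ρ) * N ^ 2 - c * ρ =
        (N - ρ - c / ρ) * N ^ 2 + c * ((N - ρ) * (N + ρ)) / ρ := by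
      field_simp; ring
    rw [he]
    have a1 : |(N - ρ - c / ρ) * N ^ 2| ≤ 4 * D := by
      rw [abs_mul, abs_of_pos (show 0 < N ^ 2 by positivity)]
      calc _ ≤ D / ρ ^ 2 * (2 * ρ) ^ 2 := by gcongr
        _ = 4 * D := by field_simp; norm_num
    have a2 : |c * ((N - ρ) * (N + ρ)) / ρ| ≤ 3 * A * B := by
      rw [abs_div, abs_mul, abs_of_pos hρ0]
      calc _ ≤ A * (3 * B) / 1 := by gcongr
        _ = _ := by ring
    linarith [abs_add_le ((N - ρ - c / ρ) * N ^ 2) (c * ((N - ρ) * (N + ρ)) / ρ)]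
  have t2 : |J * ((N - ρ) * N ^ 2 - c * ρ) / (ρ * N ^ 3)| ≤ 2 * (3 * A * B + 4 * D) / N ^ 3 := by
    rw [abs_div, abs_mul, abs_of_nonneg hJ0, abs_of_pos (show 0 < ρ * N ^ 3 by positivity)]
    calc _ ≤ N * (3 * A * B + 4 * D) / ((N / 2) * N ^ 3) := by
          gcongr
          linarith
      _ = _ := by field_simp
  have t3 : |(c - Qx) * ((N - ρ) * (N + ρ)) / (ρ ^ 2 * N ^ 2)| ≤ 12 * (A + M) * B / N ^ 3 := by
    rw [abs_div, abs_mul, abs_of_pos (show 0 < ρ ^ 2 * N ^ 2 by positivity)]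
    have a1 : |c - Qx| ≤ A + M := (abs_sub _ _).trans (add_le_add hc hQ)
    calc _ ≤ (A + M) * (3 * B) / ((N / 2) ^ 2 * N ^ 2) := by
          gcongr
          linarith
      _ = 12 * (A + M) * B / (N ^ 3 * N) := by field_simp; ring
      _ ≤ 12 * (A + M) * B / (N ^ 3 * 1) := by gcongr
      _ = _ := by ring
  rw [hdec]
  set a := (ρ * X - J + (c - Qx) / ρ) / ρ
  set b := J * ((N - ρ) * N ^ 2 - c * ρ) / (ρ * N ^ 3)
  set d := (c - Qx) * ((N - ρ) * (N + ρ)) / (ρ ^ 2 * N ^ 2)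
  calc |a + b - d| ≤ |a| + |b| + |d| := (abs_sub _ _).trans (by gcongr; exact abs_add_le a b)
    _ ≤ 8 * D / N ^ 3 + 2 * (3 * A * B + 4 * D) / N ^ 3 + 12 * (A + M) * B / N ^ 3 := by gcongr
    _ = _ := by ring

/-- From phase estimates to nodal estimates. -/
lemma phase_to_node {ρ N J X h γ ξ θ0 Qx A M K0 K1 : ℝ} (hρ : 1 ≤ ρ)
    (hA : |h| + |γ| ≤ A) (hξ : |ξ| ≤ 1) (hK0 : 0 ≤ K0) (hK1 : 0 ≤ K1)
    (hB : 2 * (A + K0 + K1) ≤ ρ ^ 2)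
    (hJ0 : 0 ≤ J) (hJN : J ≤ N) (hQ : |Qx| ≤ M) (hN1 : 1 ≤ N)
    (i1 : |θ0 - (h - γ * Real.cos (ρ * ξ)) / ρ| ≤ K0 / ρ ^ 2)
    (i2 : |N - θ0 - ρ| ≤ K1 / ρ ^ 2)
    (i3 : |J - θ0 - ρ * X + Qx / ρ| ≤ K1 / ρ ^ 2) :
    |X - (J / N + (h - γ * Real.cos (N * ξ)) * J / N ^ 3 -
      ((h - γ * Real.cos (N * ξ)) - Qx) / N ^ 2)| ≤
      (8 * (K0 + K1 + |γ| * (A + K0 + K1)) +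
        2 * (3 * A * (A + K0 + K1) + 4 * (K0 + K1 + |γ| * (A + K0 + K1))) +
        12 * (A + M) * (A + K0 + K1)) / N ^ 3 := by
  have hρ0 : 0 < ρ := by linarith
  have hA0 : 0 ≤ A := le_trans (by positivity) hA
  have hcb : ∀ t, |h - γ * Real.cos t| ≤ A := by
    intro t
    refine (abs_sub _ _).trans (le_trans ?_ hA)
    rw [abs_mul]
    have := mul_le_of_le_one_right (abs_nonneg γ) (Real.abs_cos_le_one t)
    linarith
  set c := h - γ * Real.cos (N * ξ) with hc
  set cr := h - γ * Real.cos (ρ * ξ) with hcr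
  set B := A + K0 + K1 with hBd
  have hB0 : 0 ≤ B := by positivity
  have hsq : ∀ K, 0 ≤ K → K / ρ ^ 2 ≤ K / ρ := by
    intro K hK
    apply div_le_div_of_nonneg_left hK hρ0
    nlinarith
  have h1 : |N - ρ| ≤ B / ρ := by
    have a1 : |cr / ρ| ≤ A / ρ := by
      rw [abs_div, abs_of_pos hρ0]; gcongr; exact hcb _
    have a2 := hsq K0 hK0
    have a3 := hsq K1 hK1
    have : B / ρ = A / ρ + K0 / ρ + K1 / ρ := by rw [hBd]; ring
    rw [this]
    rw [abs_le] at *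
    constructor <;> linarith [a1.1, a1.2, i1.1, i1.2, i2.1, i2.2]
  have hcc : |c - cr| ≤ |γ| * (B / ρ) := by
    have : c - cr = γ * (Real.cos (ρ * ξ) - Real.cos (N * ξ)) := by rw [hc, hcr]; ring
    rw [this, abs_mul]
    gcongr
    calc |Real.cos (ρ * ξ) - Real.cos (N * ξ)| ≤ |ρ * ξ - N * ξ| :=
          Real.abs_cos_sub_cos_le _ _
      _ = |N - ρ| * |ξ| := by rw [← sub_mul, abs_mul, abs_sub_comm]
      _ ≤ |N - ρ| * 1 := by gcongr
      _ ≤ B / ρ := by rw [mul_one]; exact h1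
  have hcc' : |c / ρ - cr / ρ| ≤ |γ| * B / ρ ^ 2 := by
    rw [← sub_div, abs_div, abs_of_pos hρ0]
    calc _ ≤ |γ| * (B / ρ) / ρ := by gcongr
      _ = _ := by field_simp
  have hDs : (K0 + K1 + |γ| * B) / ρ ^ 2 = K0 / ρ ^ 2 + K1 / ρ ^ 2 + |γ| * B / ρ ^ 2 := by ring
  apply final_alg hρ hB hJ0 hJN (hcb _) hQ hB0 h1 _ _ hN1
  · rw [hDs]
    rw [abs_le] at *
    constructor <;> linarith [hcc'.1, hcc'.2, i1.1, i1.2, i2.1, i2.2]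
  · rw [hDs]
    have : (c - Qx) / ρ = c / ρ - Qx / ρ := by ring
    rw [this]
    rw [abs_le] at *
    constructor <;> linarith [hcc'.1, hcc'.2, i1.1, i1.2, i3.1, i3.2]

/-- Estimate for the initial phase. -/
lemma init_est {ρ h γ ξ M A s k : ℝ} (hρ : 1 ≤ ρ) (hM : 0 < M) (hA : |h| + 2 * |γ| ≤ A)
    (hργ : 4 * |γ| ≤ ρ) (hs : |s| ≤ 2 / ρ) (hk : |k - Real.cos (ρ * ξ)| ≤ 2 * M / ρ)
    (hk2 : |k| ≤ 2) :
    0 < 1 - γ * s ∧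
    |Real.arctan ((h - γ * k) / ρ / (1 - γ * s)) - (h - γ * Real.cos (ρ * ξ)) / ρ| ≤
      (4 * |γ| * (M + A) + 4 * A ^ 2) / ρ ^ 2 := by
  have hρ0 : 0 < ρ := by linarith
  have hA0 : 0 ≤ A := le_trans (by positivity) hA
  have hgs : |γ * s| ≤ 2 * |γ| / ρ := by
    rw [abs_mul]
    calc |γ| * |s| ≤ |γ| * (2 / ρ) := by gcongr
      _ = _ := by ring
  have hg2 : 2 * |γ| / ρ ≤ 1 / 2 := by rw [div_le_iff₀ hρ0]; linarith
  have hV : 1 / 2 ≤ 1 - γ * s := by linarith [(abs_le.mp hgs).2]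
  have hV0 : 0 < 1 - γ * s := by linarith
  refine ⟨hV0, ?_⟩
  set V := 1 - γ * s with hVd
  set u := (h - γ * k) / ρ / V with hu
  set cr := h - γ * Real.cos (ρ * ξ) with hcr
  have hcrA : |cr| ≤ A := by
    refine (abs_sub _ _).trans (le_trans ?_ hA)
    rw [abs_mul]
    have := mul_le_of_le_one_right (abs_nonneg γ) (Real.abs_cos_le_one (ρ * ξ))
    linarith [abs_nonneg γ]
  have hUC : |h - γ * k| ≤ A := by
    refine (abs_sub _ _).trans (le_trans ?_ hA)
    rw [abs_mul]
    nlinarith [abs_nonneg γ]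
  have hub : |u| ≤ 2 * A / ρ := by
    rw [hu, abs_div, abs_div, abs_of_pos hρ0, abs_of_pos hV0]
    calc _ ≤ A / ρ / (1 / 2) := by gcongr
      _ = _ := by field_simp
  have e1 : |Real.arctan u - u| ≤ 4 * A ^ 2 / ρ ^ 2 := by
    refine (arctan_est u).trans ?_
    rw [← sq_abs]
    calc |u| ^ 2 ≤ (2 * A / ρ) ^ 2 := by gcongr
      _ = _ := by field_simp; ring
  have e2 : |u - cr / ρ| ≤ 4 * |γ| * (M + A) / ρ ^ 2 := by
    have he : u - cr / ρ = ((h - γ * k - cr) + cr * (γ * s)) / ρ / V := by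
      rw [hu]
      field_simp
      rw [hVd]; ring
    rw [he, abs_div, abs_div, abs_of_pos hρ0, abs_of_pos hV0]
    have n1 : |h - γ * k - cr| ≤ |γ| * (2 * M / ρ) := by
      have : h - γ * k - cr = -(γ * (k - Real.cos (ρ * ξ))) := by rw [hcr]; ring
      rw [this, abs_neg, abs_mul]
      gcongr
    have n2 : |cr * (γ * s)| ≤ A * (2 * |γ| / ρ) := by rw [abs_mul]; gcongr
    have n3 : |(h - γ * k - cr) + cr * (γ * s)| ≤ |γ| * (2 * M / ρ) + A * (2 * |γ| / ρ) :=
      (abs_add_le _ _).trans (add_le_add n1 n2)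
    calc _ ≤ (|γ| * (2 * M / ρ) + A * (2 * |γ| / ρ)) / ρ / (1 / 2) := by gcongr
      _ = _ := by field_simp; ring
  calc |Real.arctan u - cr / ρ| = |(Real.arctan u - u) + (u - cr / ρ)| := by ring_nf
    _ ≤ _ := abs_add_le _ _
    _ ≤ 4 * A ^ 2 / ρ ^ 2 + 4 * |γ| * (M + A) / ρ ^ 2 := add_le_add e1 e2
    _ = _ := by ring

set_option maxHeartbeats 4000000

lemma SL_comb {q : ℝ → ℝ} {lam : ℂ} {Y Y' Z Z' : ℝ → ℂ} (hY : IsSLSolution q lam Y Y')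
    (hZ : IsSLSolution q lam Z Z') (a b : ℂ) :
    IsSLSolution q lam (fun x => a * Y x - b * Z x) (fun x => a * Y' x - b * Z' x) := by
  refine ⟨fun x hx => ((hY.1 x hx).const_mul a).sub ((hZ.1 x hx).const_mul b), fun x hx => ?_⟩
  refine (((hY.2 x hx).const_mul a).sub ((hZ.2 x hx).const_mul b)).congr_deriv ?_
  ring

lemma gap_lemma {n : ℕ} {X : ℕ → ℝ} (hn : 2 ≤ n)
    (hX : ∀ j ≤ n - 1, X j ∈ Set.Ioo (0:ℝ) 1) :
    ∃ j, j + 1 ≤ n - 1 ∧ X (j + 1) - X j ≤ 1 / ((n:ℝ) - 1) := by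
  by_contra hcon
  push Not at hcon
  have hn1 : (0:ℝ) < (n:ℝ) - 1 := by
    have : (2:ℝ) ≤ n := by exact_mod_cast hn
    linarith
  have h1 : ∀ j ≤ n - 1, X 0 + j * (1 / ((n:ℝ) - 1)) ≤ X j := by
    intro j
    induction j with
    | zero => intro _; simp
    | succ k ih =>
      intro hk
      have := ih (by omega)
      have := hcon k hk
      push_cast
      linarith
  have h2 := h1 (n-1) le_rfl
  rw [Nat.cast_sub (by omega), Nat.cast_one, mul_one_div_cancel hn1.ne'] at h2
  have h3 := (hX 0 (by omega)).1
  have h4 := (hX (n-1) le_rfl).2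
  linarith

lemma real_of_im {q : ℝ → ℝ} {ρ M : ℝ} {Y Y' : ℝ → ℂ} (hρ : 0 < ρ) (hM : 0 < M)
    (hMρ : 4 * M ≤ ρ) (hq : ∀ x ∈ Set.Icc (0:ℝ) 1, |q x| ≤ M)
    (hY : IsSLSolution q ((ρ ^ 2 : ℝ) : ℂ) Y Y') (h0 : (Y 0).im = 0) (h0' : (Y' 0).im = 0)
    {x : ℝ} (hx : x ∈ Set.Icc (0:ℝ) 1) : Y x = ((Y x).re : ℂ) := by
  have := RS_zero hρ (RS_im hY) hM hMρ hq h0 h0' hx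
  apply Complex.ext <;> simp
  exact this

lemma core {q q' Qi : ℝ → ℝ} {ρ M M1 A K0 K1 h γ ξ : ℝ} (hρ : 1 ≤ ρ) (hM : 0 < M)
    (hq : ∀ x ∈ Set.Icc (0:ℝ) 1, |q x| ≤ M) (hq1 : ∀ x ∈ Set.Icc (0:ℝ) 1, |q' x| ≤ M1)
    (hqd : ∀ x ∈ Set.Icc (0:ℝ) 1, HasDerivWithinAt q (q' x) (Set.Icc 0 1) x)
    (hQ : ∀ x ∈ Set.Icc (0:ℝ) 1, HasDerivWithinAt Qi (q x) (Set.Icc 0 1) x) (hQ0 : Qi 0 = 0)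
    (hQ1 : Qi 1 = 0) (hQb : ∀ x ∈ Set.Icc (0:ℝ) 1, |Qi x| ≤ M)
    (hξ : ξ ∈ Set.Ioo (0:ℝ) 1)
    (hA : |h| + 2 * |γ| ≤ A) (hK0 : K0 = 4 * |γ| * (M + A) + 4 * A ^ 2)
    (hK1 : K1 = M1 + M ^ 2 + M)
    (hMρ : 4 * M ≤ ρ) (hργ : 4 * |γ| ≤ ρ) (hB : 2 * (A + K0 + K1) ≤ ρ ^ 2)
    {C C' S S' : ℝ → ℂ}
    (hC : IsSLSolution q ((ρ ^ 2 : ℝ) : ℂ) C C') (hS : IsSLSolution q ((ρ ^ 2 : ℝ) : ℂ) S S')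
    (hC0 : C 0 = 1) (hC0' : C' 0 = 0) (hS0 : S 0 = 0) (hS0' : S' 0 = 1)
    {n : ℕ} (hn : 1 ≤ n) {X : ℕ → ℝ}
    (hX1 : ∀ j ≤ n - 1, X j ∈ Set.Ioo (0:ℝ) 1 ∧
      Uform h γ ξ S S' * C (X j) - Uform h γ ξ C C' * S (X j) = 0)
    (hX2 : StrictMonoOn X (Set.Icc 0 (n - 1)))
    (hX3 : ∀ t ∈ Set.Ioo (0:ℝ) 1, Uform h γ ξ S S' * C t - Uform h γ ξ C C' * S t = 0 →
      ∃ j ≤ n - 1, t = X j)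
    (hend : Uform h γ ξ S S' * C 1 - Uform h γ ξ C C' * S 1 = 0)
    {N : ℝ} (hN : N = ((n:ℝ) + 1/2) * Real.pi) {j : ℕ} (hj : j ≤ n - 1)
    {J : ℝ} (hJ : J = ((j:ℝ) + 1/2) * Real.pi) :
    |X j - (J / N + (h - γ * Real.cos (N * ξ)) * J / N ^ 3 -
      ((h - γ * Real.cos (N * ξ)) - (1/2) * Qi (X j)) / N ^ 2)| ≤
      (8 * (K0 + K1 + |γ| * (A + K0 + K1)) +
        2 * (3 * A * (A + K0 + K1) + 4 * (K0 + K1 + |γ| * (A + K0 + K1))) +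
        12 * (A + M) * (A + K0 + K1)) / N ^ 3 := by
  have hρ0 : 0 < ρ := by linarith
  have hA0 : 0 ≤ A := le_trans (by positivity) hA
  have hM1 : 0 ≤ M1 := (abs_nonneg _).trans (hq1 0 (Set.left_mem_Icc.mpr zero_le_one))
  have hξ' : ξ ∈ Set.Icc (0:ℝ) 1 := Set.Ioo_subset_Icc_self hξ
  have m0 : (0:ℝ) ∈ Set.Icc (0:ℝ) 1 := Set.left_mem_Icc.mpr zero_le_one
  have m1 : (1:ℝ) ∈ Set.Icc (0:ℝ) 1 := Set.right_mem_Icc.mpr zero_le_one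
  have rC : ∀ x ∈ Set.Icc (0:ℝ) 1, C x = ((C x).re : ℂ) := fun x hx =>
    real_of_im hρ0 hM hMρ hq hC (by simp [hC0]) (by simp [hC0']) hx
  have rS : ∀ x ∈ Set.Icc (0:ℝ) 1, S x = ((S x).re : ℂ) := fun x hx =>
    real_of_im hρ0 hM hMρ hq hS (by simp [hS0]) (by simp [hS0']) hx
  set s := (S ξ).re with hs
  set k := (C ξ).re with hk
  have hUS : Uform h γ ξ S S' = ((1 - γ * s : ℝ) : ℂ) := by
    rw [Uform, hS0, hS0', rS ξ hξ', ← hs]; push_cast; ring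
  have hUC : Uform h γ ξ C C' = ((h - γ * k : ℝ) : ℂ) := by
    rw [Uform, hC0, hC0', rC ξ hξ', ← hk]; push_cast; ring
  rw [hUS, hUC] at hX1 hX3 hend
  have h2M : 2 * (M / ρ) ≤ 1 / 2 := by
    rw [← mul_div_assoc, div_le_iff₀ hρ0]; linarith
  have nE : ‖Complex.exp (Complex.I * ((ρ * ξ : ℝ) : ℂ))‖ = 1 := by
    rw [Complex.norm_exp]; simp
  -- bounds on s and k
  have hsb : |s| ≤ 2 / ρ := by
    have g1 := gron_val hρ0 (RS_re hS) hM hMρ hq hξ'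
    set z := zfun ρ (fun t => (S t).re) (fun t => (S' t).re) with hz
    have z0 : ‖z 0‖ = 1 / ρ := by
      simp [hz, zfun, hS0, hS0', abs_of_pos hρ0]
    have : |s| ≤ ‖z ξ‖ := by
      have := Complex.abs_re_le_norm (z ξ)
      rwa [hz, zfun_re] at this
    refine this.trans ?_
    have g2 : ‖z ξ‖ ≤ ‖z ξ - Complex.exp (Complex.I * ((ρ * ξ : ℝ) : ℂ)) * z 0‖ +
        ‖Complex.exp (Complex.I * ((ρ * ξ : ℝ) : ℂ)) * z 0‖ := by
      simpa using norm_add_le (z ξ - Complex.exp (Complex.I * ((ρ * ξ : ℝ) : ℂ)) * z 0)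
        (Complex.exp (Complex.I * ((ρ * ξ : ℝ) : ℂ)) * z 0)
    rw [norm_mul, nE, z0] at g2
    rw [z0] at g1
    have : 1 / ρ * (2 * (M / ρ)) ≤ 1 / ρ * (1 / 2) := by gcongr
    have e : 2 / ρ = 2 * (1 / ρ) := by ring
    have : 0 < 1 / ρ := by positivity
    rw [e]; linarith
  have hkb : |k - Real.cos (ρ * ξ)| ≤ 2 * M / ρ := by
    have g1 := gron_val hρ0 (RS_re hC) hM hMρ hq hξ'
    set z := zfun ρ (fun t => (C t).re) (fun t => (C' t).re) with hz
    have z0 : z 0 = 1 := by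
      simp [hz, zfun, hC0, hC0']
    rw [z0, norm_one, mul_one, one_mul] at g1
    have g2 := Complex.abs_re_le_norm (z ξ - Complex.exp (Complex.I * ((ρ * ξ : ℝ) : ℂ)))
    rw [Complex.sub_re, mul_comm Complex.I, Complex.exp_ofReal_mul_I_re, hz, zfun_re] at g2
    rw [mul_comm Complex.I] at g1
    calc _ ≤ _ := g2
      _ ≤ _ := g1
      _ = _ := by ring
  have hk2 : |k| ≤ 2 := by
    have a1 := Real.abs_cos_le_one (ρ * ξ)
    have a2 : 2 * M / ρ ≤ 1 / 2 := by rw [mul_div_assoc]; exact h2M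
    rw [abs_le] at *
    constructor <;> linarith [a1.1, a1.2, hkb.1, hkb.2]
  obtain ⟨hUS0, hinit⟩ := init_est (h := h) hρ hM hA hργ hsb hkb hk2
  -- real solution
  have hy : RS q ρ (fun x => (1 - γ * s) * (C x).re - (h - γ * k) * (S x).re)
      (fun x => (1 - γ * s) * (C' x).re - (h - γ * k) * (S' x).re) := by
    have := RS_re (SL_comb hC hS ((1 - γ * s : ℝ) : ℂ) ((h - γ * k : ℝ) : ℂ))
    simpa only [Complex.sub_re, Complex.re_ofReal_mul] using this
  obtain ⟨θ, hθ0, hθd, hθr⟩ := pruefer hρ0 hy hM hMρ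
    (fun x hx => (hqd x hx).continuousWithinAt) hq (by simpa [hC0, hS0] using hUS0)
  have hθ0' : θ 0 = Real.arctan ((h - γ * k) / ρ / (1 - γ * s)) := by
    rw [hθ0]; congr 1
    simp only [hC0, hS0, hC0', hS0', Complex.zero_re, Complex.one_re]
    ring
  rw [← hθ0'] at hinit
  have hφ : ∀ x ∈ Set.Icc (0:ℝ) 1,
      (((1 - γ * s : ℝ) : ℂ) * C x - ((h - γ * k : ℝ) : ℂ) * S x = 0 ↔ Real.cos (θ x) = 0) := by
    intro x hx
    obtain ⟨r, hr, hyr⟩ := hθr x hx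
    rw [rC x hx, rS x hx, ← Complex.ofReal_mul, ← Complex.ofReal_mul, ← Complex.ofReal_sub,
      Complex.ofReal_eq_zero]
    rw [hyr]
    simp [hr.ne']
  have hθc : ContinuousOn θ (Set.Icc 0 1) := fun x hx => (hθd x hx).continuousWithinAt
  have hθm : StrictMonoOn θ (Set.Icc 0 1) := by
    apply strictMonoOn_of_hasDerivWithinAt_pos (convex_Icc (0:ℝ) 1) hθc
      (f' := fun x => ρ - q x / ρ * Real.cos (θ x) ^ 2)
    · intro x hx
      rw [interior_Icc] at hx ⊢
      exact (hθd x (Set.Ioo_subset_Icc_self hx)).mono Set.Ioo_subset_Icc_self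
    · intro x hx
      rw [interior_Icc] at hx
      have h1 : q x / ρ * Real.cos (θ x) ^ 2 ≤ M / ρ := by
        have b1 : q x / ρ ≤ M / ρ := by
          gcongr; exact (le_abs_self _).trans (hq x (Set.Ioo_subset_Icc_self hx))
        have b2 := Real.cos_sq_le_one (θ x)
        have b3 : 0 < M / ρ := by positivity
        nlinarith [sq_nonneg (Real.cos (θ x))]
      linarith
  have hpi := Real.pi_pos
  have hlow : ∀ x ∈ Set.Icc (0:ℝ) 1, -(Real.pi / 2) < θ x := by
    intro x hx
    have := hθm.monotoneOn m0 hx hx.1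
    have := Real.neg_pi_div_two_lt_arctan ((h - γ * k) / ρ / (1 - γ * s))
    linarith
  have hidx : ∀ x ∈ Set.Icc (0:ℝ) 1, Real.cos (θ x) = 0 →
      ∃ i : ℕ, θ x = ((i:ℝ) + 1/2) * Real.pi := by
    intro x hx hc
    obtain ⟨i, hi⟩ := Real.cos_eq_zero_iff.mp hc
    have hl := hlow x hx
    have hi0 : 0 ≤ i := by
      by_contra hneg
      have : i ≤ -1 := by omega
      have : (i:ℝ) ≤ -1 := by exact_mod_cast this
      rw [hi] at hl
      nlinarith
    obtain ⟨i', rfl⟩ := Int.eq_ofNat_of_zero_le hi0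
    refine ⟨i', ?_⟩
    rw [hi]; push_cast; ring
  have hlt_iff : ∀ a b : ℕ, ((a:ℝ) + 1/2) * Real.pi < ((b:ℝ) + 1/2) * Real.pi ↔ a < b := by
    intro a b
    rw [mul_lt_mul_iff_left₀ hpi, add_lt_add_iff_right, Nat.cast_lt]
  obtain ⟨m, hm⟩ := hidx 1 m1 ((hφ 1 m1).mp hend)
  have hXm : ∀ j ≤ n - 1, X j ∈ Set.Icc (0:ℝ) 1 :=
    fun j hj => Set.Ioo_subset_Icc_self (hX1 j hj).1
  have hf : ∀ j, ∃ i : ℕ, j ≤ n - 1 → θ (X j) = ((i:ℝ) + 1/2) * Real.pi := by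
    intro j
    by_cases hj : j ≤ n - 1
    · obtain ⟨i, hi⟩ := hidx (X j) (hXm j hj) ((hφ _ (hXm j hj)).mp (hX1 j hj).2)
      exact ⟨i, fun _ => hi⟩
    · exact ⟨0, fun hh => absurd hh hj⟩
  choose f hf using hf
  have hc1 : StrictMonoOn f (Set.Icc 0 (n-1)) := by
    intro a ha b hb hab
    have := hθm (hXm a ha.2) (hXm b hb.2) (hX2 ha hb hab)
    rw [hf a ha.2, hf b hb.2, hlt_iff] at this
    exact this
  have hc2 : ∀ j ≤ n - 1, f j < m := by
    intro j hj
    have := hθm (hXm j hj) m1 (hX1 j hj).1.2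
    rw [hf j hj, hm, hlt_iff] at this
    exact this
  have hc3 : ∀ k < m, ∃ j ≤ n - 1, f j = k := by
    intro i hi
    have hup : θ 0 < ((i:ℝ) + 1/2) * Real.pi := by
      have := Real.arctan_lt_pi_div_two ((h - γ * k) / ρ / (1 - γ * s))
      rw [← hθ0'] at this
      have : (0:ℝ) ≤ i := Nat.cast_nonneg i
      nlinarith
    have hdn : ((i:ℝ) + 1/2) * Real.pi < θ 1 := by
      rw [hm, hlt_iff]; exact hi
    obtain ⟨x, hx, hxe⟩ := intermediate_value_Icc zero_le_one hθc ⟨hup.le, hdn.le⟩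
    have hx0 : 0 < x := by
      rcases hx.1.eq_or_lt with h0 | h0
      · rw [← h0] at hxe; linarith
      · exact h0
    have hx1 : x < 1 := by
      rcases hx.2.eq_or_lt with h0 | h0
      · rw [h0] at hxe; linarith
      · exact h0
    have hcos : Real.cos (θ x) = 0 := by
      rw [Real.cos_eq_zero_iff]
      refine ⟨i, ?_⟩
      rw [hxe]; push_cast; ring
    obtain ⟨j, hj, hjx⟩ := hX3 x ⟨hx0, hx1⟩ ((hφ x hx).mpr hcos)
    refine ⟨j, hj, ?_⟩
    have h1 := hf j hj
    rw [← hjx, hxe] at h1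
    rcases lt_trichotomy (f j) i with h2 | h2 | h2
    · have := (hlt_iff _ _).mpr h2; linarith
    · exact h2
    · have := (hlt_iff _ _).mpr h2; linarith
  obtain ⟨hmn, hfj⟩ := count_lemma f hn hc1 hc2 hc3
  subst hmn
  have hJθ : θ (X j) = J := by rw [hf j hj, hfj j hj, hJ]
  have hNθ : θ 1 = N := by rw [hm, hN]
  have p1 := phase_est hρ hM hq hq1 hqd hQ hQ0 hθd m1
  have pj := phase_est hρ hM hq hq1 hqd hQ hQ0 hθd (hXm j hj)
  rw [hNθ, hQ1, mul_zero, zero_div, add_zero, mul_one, ← hK1] at p1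
  rw [hJθ, ← hK1] at pj
  rw [← hK0] at hinit
  have hmR : (1:ℝ) ≤ m := by exact_mod_cast hn
  have hjm : (j:ℝ) ≤ m := by
    have : j ≤ m := by omega
    exact_mod_cast this
  have hN1 : 1 ≤ N := by
    rw [hN]; nlinarith [Real.pi_gt_three]
  have hQx : |(1/2) * Qi (X j)| ≤ M := by
    have := hQb _ (hXm j hj)
    rw [abs_mul, abs_of_pos (by norm_num : (0:ℝ) < 1/2)]
    linarith [abs_nonneg (Qi (X j))]
  refine phase_to_node hρ (by linarith [abs_nonneg γ]) ?_ (by rw [hK0]; positivity)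
    (by rw [hK1]; positivity) hB (by rw [hJ]; positivity) ?_ hQx hN1 hinit p1 pj
  · rw [abs_of_pos hξ.1]; exact hξ.2.le
  · rw [hJ, hN]; gcongr

/-- Lemma 3, case `h ∈ ℝ`, `H = ∞`: assuming `∫₀¹ q = 0`, the nodal points `xₙʲ` of the
eigenfunction of the problem with `y'(0)+hy(0)-γ₀y(ξ₀)=0`, `y(1)=0` satisfy, uniformly in `j`,
`xₙʲ = (j+1/2)/(n+1/2) + [h-γ₀cos((n+1/2)πξ₀)]·((j+1/2)/((n+1/2)³π²))
 - (h-Q(xₙʲ))/((n+1/2)²π²) + γ₀cos((n+1/2)πξ₀)/((n+1/2)²π²) + o(1/n²)`. -/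
theorem stmt_13
    (q : ℝ → ℝ) (hq : ContDiffOn ℝ 1 q (Set.Icc 0 1))
    (hint : (∫ t in (0:ℝ)..1, q t) = 0)
    (h γ0 : ℝ) (hγ0 : γ0 ≠ 0)
    (ξ0 : ℚ) (hξ0 : (ξ0:ℝ) ∈ Set.Ioo 0 1)
    (C C' S S' : ℂ → ℝ → ℂ)
    (hsolC : ∀ lam : ℂ, IsSLSolution q lam (C lam) (C' lam))
    (hC0 : ∀ lam : ℂ, C lam 0 = 1) (hC'0 : ∀ lam : ℂ, C' lam 0 = 0)
    (hsolS : ∀ lam : ℂ, IsSLSolution q lam (S lam) (S' lam))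
    (hS0 : ∀ lam : ℂ, S lam 0 = 0) (hS'0 : ∀ lam : ℂ, S' lam 0 = 1)
    (Δ : ℂ → ℂ)
    (hΔ : ∀ lam : ℂ, Δ lam =
      Uform h γ0 ξ0 (S lam) (S' lam) * C lam 1 - Uform h γ0 ξ0 (C lam) (C' lam) * S lam 1)
    (lam : ℕ → ℂ) (hen : EnumeratesZeros Δ lam)
    (X : ℕ → ℕ → ℝ) (N0 : ℕ)
    (hX : HasNodalPoints (phiFun h γ0 ξ0 C C' S S') lam X (fun _ => 0) (fun n => n - 1) N0) :
    ∀ ε > (0:ℝ), ∃ N : ℕ, ∀ n ≥ N, ∀ j : ℕ, j ≤ n - 1 →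
      |X n j - (((j:ℝ) + 1/2) / ((n:ℝ) + 1/2)
        + (h - γ0 * Real.cos (((n:ℝ) + 1/2) * Real.pi * ξ0)) *
            (((j:ℝ) + 1/2) / (((n:ℝ) + 1/2)^3 * Real.pi^2))
        - (h - (1/2) * ∫ t in (0:ℝ)..(X n j), q t) / (((n:ℝ) + 1/2)^2 * Real.pi^2)
        + γ0 * Real.cos (((n:ℝ) + 1/2) * Real.pi * ξ0) / (((n:ℝ) + 1/2)^2 * Real.pi^2))| ≤
        ε / (n:ℝ)^2 := by
  have hqc : ContinuousOn q (Set.Icc 0 1) := hq.continuousOn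
  set q' := derivWithin q (Set.Icc 0 1) with hq'
  have hqd : ∀ x ∈ Set.Icc (0:ℝ) 1, HasDerivWithinAt q (q' x) (Set.Icc 0 1) x := fun x hx =>
    ((hq.differentiableOn one_ne_zero) x hx).hasDerivWithinAt
  have hq'c : ContinuousOn q' (Set.Icc 0 1) :=
    hq.continuousOn_derivWithin (uniqueDiffOn_Icc zero_lt_one) le_rfl
  obtain ⟨Ma, hMa⟩ := isCompact_Icc.exists_bound_of_continuousOn hqc
  obtain ⟨M1, hM1⟩ := isCompact_Icc.exists_bound_of_continuousOn hq'c
  set M := |Ma| + 1 with hMd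
  have hM : 0 < M := by positivity
  have hqb : ∀ x ∈ Set.Icc (0:ℝ) 1, |q x| ≤ M := fun x hx => by
    have := hMa x hx
    rw [Real.norm_eq_abs] at this
    linarith [le_abs_self Ma]
  have hq1 : ∀ x ∈ Set.Icc (0:ℝ) 1, |q' x| ≤ M1 := hM1
  have hM1' : 0 ≤ M1 := (abs_nonneg _).trans (hq1 0 (Set.left_mem_Icc.mpr zero_le_one))
  set Qi : ℝ → ℝ := fun x => ∫ t in (0:ℝ)..x, q t with hQi
  have hQ : ∀ x ∈ Set.Icc (0:ℝ) 1, HasDerivWithinAt Qi (q x) (Set.Icc 0 1) x := by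
    intro x hx
    set G : ℝ → ℝ := Set.IccExtend (zero_le_one (α := ℝ)) ((Set.Icc (0:ℝ) 1).domRestrict q) with hG
    have hGc : Continuous G := (continuousOn_iff_continuous_domRestrict.mp hqc).Icc_extend'
    have hGg : ∀ x ∈ Set.Icc (0:ℝ) 1, G x = q x := by
      intro x hx
      rw [hG, Set.IccExtend_of_mem _ _ hx]; rfl
    have h1 : HasDerivWithinAt (fun x => ∫ t in (0:ℝ)..x, G t) (G x) (Set.Icc 0 1) x :=
      (hGc.integral_hasStrictDerivAt 0 x).hasDerivAt.hasDerivWithinAt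
    rw [hGg x hx] at h1
    have h2 : ∀ x ∈ Set.Icc (0:ℝ) 1, Qi x = ∫ t in (0:ℝ)..x, G t := by
      intro x hx
      apply intervalIntegral.integral_congr
      intro t ht
      rw [Set.uIcc_of_le hx.1] at ht
      exact (hGg t ⟨ht.1, ht.2.trans hx.2⟩).symm
    exact h1.congr h2 (h2 x hx)
  have hQ0 : Qi 0 = 0 := by simp [hQi]
  have hQ1 : Qi 1 = 0 := hint
  have hQb : ∀ x ∈ Set.Icc (0:ℝ) 1, |Qi x| ≤ M := by
    intro x hx
    have := intervalIntegral.norm_integral_le_of_norm_le_const (f := q) (a := 0) (b := x) (C := M)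
      (fun t ht => by
        rw [Set.uIoc_of_le hx.1] at ht
        exact hqb t ⟨ht.1.le, ht.2.trans hx.2⟩)
    rw [sub_zero, abs_of_nonneg hx.1, Real.norm_eq_abs] at this
    exact this.trans (mul_le_of_le_one_right hM.le hx.2)
  set A := |h| + 2 * |γ0| with hA
  have hA0 : 0 ≤ A := by positivity
  set K0 := 4 * |γ0| * (M + A) + 4 * A ^ 2 with hK0
  set K1 := M1 + M ^ 2 + M with hK1
  have hK0' : 0 ≤ K0 := by positivity
  have hK1' : 0 ≤ K1 := by positivity
  set Kt := 8 * (K0 + K1 + |γ0| * (A + K0 + K1)) +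
        2 * (3 * A * (A + K0 + K1) + 4 * (K0 + K1 + |γ0| * (A + K0 + K1))) +
        12 * (A + M) * (A + K0 + K1) with hKt
  have hKt0 : 0 ≤ Kt := by positivity
  set R0 := 1 + 4 * M + 4 * |γ0| + 2 * (A + K0 + K1) with hR0
  have hR01 : 1 ≤ R0 := by
    have : 0 ≤ 4 * M + 4 * |γ0| + 2 * (A + K0 + K1) := by positivity
    linarith
  intro ε hε
  set T := 1 + M + R0 ^ 2 with hT
  clear_value T R0 Kt K1 K0 A Qi M q'
  obtain ⟨N1, hN1⟩ := exists_nat_ge (T + 1)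
  obtain ⟨N2, hN2⟩ := exists_nat_ge (Kt / ε)
  refine ⟨max (max N0 2) (max N1 N2), fun n hn j hj => ?_⟩
  have hnN0 : N0 ≤ n := le_trans (le_trans (le_max_left _ _) (le_max_left _ _)) hn
  have hn2 : 2 ≤ n := le_trans (le_trans (le_max_right _ _) (le_max_left _ _)) hn
  have hnN1 : N1 ≤ n := le_trans (le_trans (le_max_left _ _) (le_max_right _ _)) hn
  have hnN2 : N2 ≤ n := le_trans (le_trans (le_max_right _ _) (le_max_right _ _)) hn
  have hnT : T ≤ (n:ℝ) - 1 := by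
    have : (N1:ℝ) ≤ n := by exact_mod_cast hnN1
    linarith
  have hnK : Kt / ε ≤ n := hN2.trans (by exact_mod_cast hnN2)
  have hnpos : (0:ℝ) < n := by exact_mod_cast (by omega : 0 < n)
  obtain ⟨hx1, hx2, hx3⟩ := hX n hnN0
  simp only [phiFun] at hx1 hx2 hx3
  have hx1' : ∀ j ≤ n - 1, X n j ∈ Set.Ioo (0:ℝ) 1 ∧
      Uform h γ0 ξ0 (S (lam n)) (S' (lam n)) * C (lam n) (X n j) -
        Uform h γ0 ξ0 (C (lam n)) (C' (lam n)) * S (lam n) (X n j) = 0 :=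
    fun j hj => hx1 j (Nat.zero_le _) hj
  -- the eigenvalue is real and large
  obtain ⟨i, hi, hgap⟩ := gap_lemma hn2 (fun j hj => (hx1' j hj).1)
  have hlt : X n i < X n (i + 1) :=
    hx2 (a := i) (b := i + 1) ⟨Nat.zero_le _, by omega⟩ ⟨Nat.zero_le _, hi⟩ (by omega)
  obtain ⟨t, hit, hti⟩ := exists_between hlt
  have hmi := hx1' i (by omega)
  have hmi' := hx1' (i + 1) hi
  have ht01 : t ∈ Set.Ioo (0:ℝ) 1 := ⟨hmi.1.1.trans hit, hti.trans hmi'.1.2⟩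
  obtain ⟨him, hre⟩ := disconj (SL_comb (hsolC (lam n)) (hsolS (lam n))
      (Uform h γ0 ξ0 (S (lam n)) (S' (lam n))) (Uform h γ0 ξ0 (C (lam n)) (C' (lam n)))) hqb
      hmi.1.1.le hmi'.1.2.le hit hti hmi.2 hmi'.2 (by
        intro hz
        obtain ⟨k, _, hk, hkt⟩ := hx3 t ht01 hz
        rw [hkt] at hit hti
        have a1 : i < k := by
          by_contra hcon
          have := hx2.monotoneOn (a := k) (b := i) ⟨Nat.zero_le _, hk⟩
            ⟨Nat.zero_le _, by omega⟩ (by omega)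
          linarith
        have a2 : k < i + 1 := by
          by_contra hcon
          have := hx2.monotoneOn (a := i + 1) (b := k) ⟨Nat.zero_le _, hi⟩
            ⟨Nat.zero_le _, hk⟩ (by omega)
          linarith
        omega)
  have hT1 : 1 ≤ T := by
    have : 0 ≤ M + R0 ^ 2 := by positivity
    linarith
  have hn1pos : 0 < (n:ℝ) - 1 := by linarith
  have hreb : R0 ^ 2 ≤ (lam n).re := by
    have b0 : 0 < X n (i + 1) - X n i := sub_pos.mpr hlt
    have b1 : ((n:ℝ) - 1) ^ 2 ≤ 1 / (X n (i + 1) - X n i) ^ 2 := by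
      rw [le_div_iff₀ (by positivity), ← mul_pow]
      have : ((n:ℝ) - 1) * (X n (i + 1) - X n i) ≤ 1 := by
        rw [le_div_iff₀ hn1pos] at hgap; linarith
      exact pow_le_one₀ (by positivity) this
    have b2 : T ≤ ((n:ℝ) - 1) ^ 2 :=
      hnT.trans (le_self_pow₀ (hT1.trans hnT) two_ne_zero)
    linarith
  set ρ := Real.sqrt (lam n).re with hρd
  have hρsq : ρ ^ 2 = (lam n).re := Real.sq_sqrt (le_trans (by positivity) hreb)
  have hlam : lam n = ((ρ ^ 2 : ℝ) : ℂ) := by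
    rw [hρsq]; apply Complex.ext <;> simp [him]
  have hρR : R0 ≤ ρ := Real.le_sqrt_of_sq_le hreb
  have hρ1 : 1 ≤ ρ := hR01.trans hρR
  have hρρ : ρ ≤ ρ ^ 2 := le_self_pow₀ hρ1 two_ne_zero
  have hγp : 0 ≤ |γ0| := abs_nonneg _
  have hend : Uform h γ0 ξ0 (S (lam n)) (S' (lam n)) * C (lam n) 1 -
      Uform h γ0 ξ0 (C (lam n)) (C' (lam n)) * S (lam n) 1 = 0 := by
    rw [← hΔ]; exact hen.2.1 n
  have hres := core (q' := q') (Qi := Qi) (A := A) (K0 := K0) (K1 := K1) (n := n) (X := X n)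
    hρ1 hM hqb hq1 hqd hQ hQ0 hQ1 hQb hξ0 hA.ge hK0 hK1
    (by linarith) (by linarith) (by linarith)
    (hlam ▸ hsolC (lam n)) (hlam ▸ hsolS (lam n)) (hC0 _) (hC'0 _) (hS0 _) (hS'0 _)
    (by omega) hx1' hx2
    (fun t ht hz => by
      obtain ⟨k, _, hk, hkt⟩ := hx3 t ht hz
      exact ⟨k, hk, hkt⟩) hend rfl hj rfl
  rw [← hKt] at hres
  have hpi := Real.pi_pos
  have hnh : (0:ℝ) < (n:ℝ) + 1/2 := by positivity
  have hfin : Kt / (((n:ℝ) + 1/2) * Real.pi) ^ 3 ≤ ε / (n:ℝ) ^ 2 := by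
    have hge : (n:ℝ) ≤ ((n:ℝ) + 1/2) * Real.pi := by nlinarith [Real.pi_gt_three]
    calc Kt / (((n:ℝ) + 1/2) * Real.pi) ^ 3 ≤ Kt / (n:ℝ) ^ 3 := by gcongr
      _ ≤ (ε * n) / (n:ℝ) ^ 3 := by
          gcongr
          rw [div_le_iff₀ hε] at hnK; linarith
      _ = ε / (n:ℝ) ^ 2 := by field_simp
  refine le_trans (le_of_eq ?_) (hres.trans hfin)
  congr 2
  simp only [hQi]
  field_simp
  ring
end

section
/- (Limit function g, case h = ∞, H ∈ ℝ.) Assume ∫₀¹ q(x)dx = 0 and ξ₁ = p₁/r₁. For the problem with conditions y(0) = 0 and y'(1) + H·y(1) − γ₁·y(ξ₁) = 0, fix x ∈ (0,1) and let (x_m^{j(m)}) be a sequence of nodal points with m = 2r₁n, n → ∞, such that x_m^{j(m)} → x. Then the limit lim_{m→∞} (m + 1/2)²π²·(x_m^{j(m)} − j(m)/(m + 1/2)) exists, is finite, and equals g(x) = (γ₁·sin(πξ₁/2) − H)·x + (1/2)∫₀ˣ q(t)dt. -/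
open Set Filter Asymptotics

lemma aux_gap (u v p : ℝ → ℝ) (a b K : ℝ) (hab : a < b)
    (hu : ∀ x ∈ Icc a b, HasDerivWithinAt u (v x) (Icc a b) x)
    (hv : ∀ x ∈ Icc a b, HasDerivWithinAt v (p x * u x) (Icc a b) x)
    (hp : ∀ x ∈ Icc a b, |p x| ≤ K) (ha : u a = 0) (hb : u b = 0)
    (hne : ∃ c ∈ Icc a b, u c ≠ 0) : 1 ≤ K * (b - a) ^ 2 := by
  have hcont : ContinuousOn u (Icc a b) := fun x hx => (hu x hx).continuousWithinAt
  obtain ⟨c, hc, hmax⟩ := isCompact_Icc.exists_isMaxOn (nonempty_Icc.2 hab.le) hcont.abs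
  have hmax' : ∀ x ∈ Icc a b, |u x| ≤ |u c| := fun x hx => hmax hx
  have hM : 0 < |u c| := by
    obtain ⟨e, he, hne⟩ := hne
    exact lt_of_lt_of_le (abs_pos.2 hne) (hmax' e he)
  obtain ⟨d, hd, hvd⟩ := exists_hasDerivAt_eq_zero hab hcont (ha.trans hb.symm)
    (fun x hx => (hu x (Ioo_subset_Icc_self hx)).hasDerivAt (Icc_mem_nhds hx.1 hx.2))
  have hd' := Ioo_subset_Icc_self hd
  have hK : 0 ≤ K := (abs_nonneg _).trans (hp d hd')
  have hvb : ∀ x ∈ Icc a b, ‖v x‖ ≤ K * |u c| * (b - a) := by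
    intro x hx
    have h1 := Convex.norm_image_sub_le_of_norm_hasDerivWithin_le (C := K * |u c|) hv
      (fun y hy => by
        rw [norm_mul]
        exact mul_le_mul (hp y hy) (hmax' y hy) (norm_nonneg _) hK) (convex_Icc a b) hd' hx
    rw [hvd, sub_zero] at h1
    refine h1.trans ?_
    gcongr
    rw [Real.norm_eq_abs, abs_le]
    constructor <;> linarith [hx.1, hx.2, hd'.1, hd'.2]
  have h2 := Convex.norm_image_sub_le_of_norm_hasDerivWithin_le hu hvb (convex_Icc a b)
      (left_mem_Icc.2 hab.le) hc
  rw [ha, sub_zero, Real.norm_eq_abs, Real.norm_eq_abs, abs_of_nonneg (sub_nonneg.2 hc.1)] at h2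
  have h3 : K * |u c| * (b - a) * (c - a) ≤ K * |u c| * (b - a) * (b - a) := by
    have : 0 ≤ b - a := by linarith
    gcongr
    exact hc.2
  by_contra hcon
  push Not at hcon
  nlinarith

lemma aux_unique (q : ℝ → ℝ) (hq : ContinuousOn q (Icc 0 1)) (lam : ℂ) (y y' z z' : ℝ → ℂ)
    (hy : IsSLSolution q lam y y') (hz : IsSLSolution q lam z z')
    (h0 : y 0 = z 0) (h0' : y' 0 = z' 0) :
    ∀ x ∈ Icc (0:ℝ) 1, y x = z x ∧ y' x = z' x := by
  obtain ⟨C, hC⟩ := isCompact_Icc.exists_bound_of_continuousOn hq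
  have hC0 : 0 ≤ C := (norm_nonneg _).trans (hC 0 (by simp))
  set K : NNReal := ⟨1 + C + ‖lam‖, by positivity⟩ with hK
  have key := ODE_solution_unique_of_mem_Icc_right (a := (0:ℝ)) (b := 1)
    (v := fun t (w : ℂ × ℂ) => (w.2, ((q t : ℂ) - lam) * w.1)) (s := fun _ => univ) (K := K)
    (f := fun t => (y t, y' t)) (g := fun t => (z t, z' t)) ?_ ?_ ?_ ?_ ?_ ?_ ?_ ?_
  · intro x hx
    have := key hx
    simpa using this
  · intro t ht
    refine LipschitzOnWith.of_dist_le_mul fun w _ w' _ => ?_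
    have hb : ‖(q t : ℂ) - lam‖ ≤ C + ‖lam‖ := by
      refine (norm_sub_le _ _).trans ?_
      gcongr
      simpa using hC t ⟨ht.1, ht.2.le⟩
    have hKv : (K : ℝ) = 1 + C + ‖lam‖ := rfl
    rw [hKv, Prod.dist_eq, Prod.dist_eq]
    have e1 := le_max_left (dist w.1 w'.1) (dist w.2 w'.2)
    have e2 := le_max_right (dist w.1 w'.1) (dist w.2 w'.2)
    set D := max (dist w.1 w'.1) (dist w.2 w'.2)
    have hD : 0 ≤ D := dist_nonneg.trans e1
    refine max_le ?_ ?_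
    · show dist w.2 w'.2 ≤ _
      nlinarith [norm_nonneg lam, mul_nonneg hC0 hD, mul_nonneg (norm_nonneg lam) hD]
    · show dist (((q t : ℂ) - lam) * w.1) (((q t : ℂ) - lam) * w'.1) ≤ _
      rw [dist_eq_norm, ← mul_sub, norm_mul]
      have e3 : ‖w.1 - w'.1‖ ≤ D := by rwa [← dist_eq_norm]
      have e4 : ‖(q t : ℂ) - lam‖ * ‖w.1 - w'.1‖ ≤ (C + ‖lam‖) * D :=
        mul_le_mul hb e3 (norm_nonneg _) (by positivity)
      linarith
  · exact fun x hx => ((hy.1 x hx).continuousWithinAt).prodMk ((hy.2 x hx).continuousWithinAt)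
  · intro t ht
    have ht' : t ∈ Icc (0:ℝ) 1 := ⟨ht.1, ht.2.le⟩
    exact ((hy.1 t ht').prodMk (hy.2 t ht')).mono_of_mem_nhdsWithin (Icc_mem_nhdsGE_of_mem ht)
  · intro _ _; trivial
  · exact fun x hx => ((hz.1 x hx).continuousWithinAt).prodMk ((hz.2 x hx).continuousWithinAt)
  · intro t ht
    have ht' : t ∈ Icc (0:ℝ) 1 := ⟨ht.1, ht.2.le⟩
    exact ((hz.1 t ht').prodMk (hz.2 t ht')).mono_of_mem_nhdsWithin (Icc_mem_nhdsGE_of_mem ht)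
  · intro _ _; trivial
  · simp [h0, h0']

lemma aux_mono_zero (f f' : ℝ → ℝ) (t : ℝ) (ht : 0 < t)
    (hf : ∀ x ∈ Icc 0 t, HasDerivWithinAt f (f' x) (Icc 0 t) x)
    (h0 : f 0 = 0) (h1 : f t = 0) (hpos : ∀ x ∈ Icc 0 t, 0 ≤ f' x) :
    ∀ x ∈ Icc 0 t, f' x = 0 := by
  have hd : ∀ x ∈ Ioo 0 t, HasDerivAt f (f' x) x := fun x hx =>
    (hf x (Ioo_subset_Icc_self hx)).hasDerivAt (Icc_mem_nhds hx.1 hx.2)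
  have hm : MonotoneOn f (Icc 0 t) := by
    apply monotoneOn_of_deriv_nonneg (convex_Icc 0 t) (fun x hx => (hf x hx).continuousWithinAt)
    · rw [interior_Icc]
      exact fun x hx => (hd x hx).differentiableAt.differentiableWithinAt
    · rw [interior_Icc]
      intro x hx
      rw [(hd x hx).deriv]
      exact hpos x (Ioo_subset_Icc_self hx)
  have hz : ∀ x ∈ Icc 0 t, f x = 0 := by
    intro x hx
    have a1 := hm (left_mem_Icc.2 ht.le) hx hx.1
    have a2 := hm hx (right_mem_Icc.2 ht.le) hx.2
    linarith
  intro x hx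
  have h2 : HasDerivWithinAt f 0 (Icc 0 t) x :=
    (hasDerivWithinAt_const x (Icc 0 t) (0:ℝ)).congr hz (hz x hx)
  exact (uniqueDiffOn_Icc ht x hx).eq_deriv _ (hf x hx) h2

lemma aux_real (q : ℝ → ℝ) (C : ℝ) (hC : ∀ x ∈ Icc (0:ℝ) 1, |q x| ≤ C) (lam : ℂ) (y y' : ℝ → ℂ)
    (hy : IsSLSolution q lam y y') (h0 : y 0 = 0) (h0' : y' 0 = 1)
    (t : ℝ) (ht : t ∈ Ioo (0:ℝ) 1) (hyt : y t = 0) : lam.im = 0 ∧ -C ≤ lam.re := by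
  have hsub : Icc 0 t ⊆ Icc (0:ℝ) 1 := Icc_subset_Icc le_rfl ht.2.le
  have d1 : ∀ x ∈ Icc 0 t, HasDerivWithinAt y (y' x) (Icc 0 t) x := fun x hx =>
    (hy.1 x (hsub hx)).mono hsub
  have d2 : ∀ x ∈ Icc 0 t, HasDerivWithinAt y' (((q x : ℂ) - lam) * y x) (Icc 0 t) x := fun x hx =>
    (hy.2 x (hsub hx)).mono hsub
  have re_d : ∀ (g : ℝ → ℂ) (g' : ℂ) (x : ℝ), HasDerivWithinAt g g' (Icc 0 t) x →
      HasDerivWithinAt (fun s => (g s).re) g'.re (Icc 0 t) x := fun g g' x h =>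
    (Complex.reCLM.hasFDerivAt (x := g x)).comp_hasDerivWithinAt x h
  have im_d : ∀ (g : ℝ → ℂ) (g' : ℂ) (x : ℝ), HasDerivWithinAt g g' (Icc 0 t) x →
      HasDerivWithinAt (fun s => (g s).im) g'.im (Icc 0 t) x := fun g g' x h =>
    (Complex.imCLM.hasFDerivAt (x := g x)).comp_hasDerivWithinAt x h
  have h0mem : (0:ℝ) ∈ Icc 0 t := left_mem_Icc.2 ht.1.le
  -- `y` cannot vanish on `[0,t]`
  have hnz : ¬ ∀ x ∈ Icc 0 t, y x = 0 := by
    intro hz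
    have h2 : HasDerivWithinAt y 0 (Icc 0 t) 0 :=
      (hasDerivWithinAt_const (0:ℝ) (Icc 0 t) (0:ℂ)).congr hz (hz 0 h0mem)
    have := (uniqueDiffOn_Icc ht.1 0 h0mem).eq_deriv _ (d1 0 h0mem) h2
    rw [h0'] at this
    exact one_ne_zero this
  have him : lam.im = 0 := by
    by_contra hne
    set f : ℝ → ℝ := fun x => -lam.im * ((y' x).im * (y x).re - (y' x).re * (y x).im)
    have hf : ∀ x ∈ Icc 0 t, HasDerivWithinAt f (lam.im^2 * ((y x).re^2 + (y x).im^2))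
        (Icc 0 t) x := by
      intro x hx
      have := ((((im_d _ _ x (d2 x hx)).mul (re_d _ _ x (d1 x hx))).sub
        ((re_d _ _ x (d2 x hx)).mul (im_d _ _ x (d1 x hx)))).const_mul (-lam.im))
      refine this.congr_deriv ?_
      simp
      ring
    have := aux_mono_zero f _ t ht.1 hf (by simp [f, h0]) (by simp [f, hyt])
      (fun x _ => by positivity)
    apply hnz
    intro x hx
    have h3 := this x hx
    have h4 : (y x).re^2 + (y x).im^2 = 0 := by
      rcases mul_eq_zero.1 h3 with h | h
      · exact absurd h (pow_ne_zero 2 hne)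
      · exact h
    apply Complex.ext <;> simp <;> nlinarith
  refine ⟨him, ?_⟩
  by_contra hlt
  push Not at hlt
  set f : ℝ → ℝ := fun x => ((y' x).re * (y x).re + (y' x).im * (y x).im)
  have hf : ∀ x ∈ Icc 0 t, HasDerivWithinAt f
      ((q x - lam.re) * ((y x).re^2 + (y x).im^2) + ((y' x).re^2 + (y' x).im^2))
      (Icc 0 t) x := by
    intro x hx
    have := ((((re_d _ _ x (d2 x hx)).mul (re_d _ _ x (d1 x hx))).add
      ((im_d _ _ x (d2 x hx)).mul (im_d _ _ x (d1 x hx)))))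
    refine this.congr_deriv ?_
    simp [him]
    ring
  have hqp : ∀ x ∈ Icc 0 t, 0 ≤ q x - lam.re := fun x hx => by
    have := (abs_le.1 (hC x (hsub hx))).1
    linarith
  have := aux_mono_zero f _ t ht.1 hf (by simp [f, h0]) (by simp [f, hyt])
    (fun x hx => by have := hqp x hx; positivity) 0 h0mem
  simp [h0, h0'] at this

lemma aux_real_valued (q : ℝ → ℝ) (hq : ContinuousOn q (Icc 0 1)) (lam : ℂ) (hlam : lam.im = 0)
    (y y' : ℝ → ℂ) (hy : IsSLSolution q lam y y') (h0 : y 0 = 0) (h0' : y' 0 = 1) :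
    ∀ x ∈ Icc (0:ℝ) 1, y x = ((y x).re : ℂ) := by
  have re_d : ∀ (g : ℝ → ℂ) (g' : ℂ) (x : ℝ), HasDerivWithinAt g g' (Icc 0 1) x →
      HasDerivWithinAt (fun s => (((g s).re : ℝ) : ℂ)) ((g'.re : ℝ) : ℂ) (Icc 0 1) x :=
    fun g g' x h => ((Complex.ofRealCLM.comp Complex.reCLM).hasFDerivAt
      (x := g x)).comp_hasDerivWithinAt x h
  have hz : IsSLSolution q lam (fun s => (((y s).re : ℝ) : ℂ)) (fun s => (((y' s).re : ℝ) : ℂ)) := by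
    refine ⟨fun x hx => re_d _ _ x (hy.1 x hx), fun x hx => (re_d _ _ x (hy.2 x hx)).congr_deriv ?_⟩
    apply Complex.ext <;> simp [hlam]
  exact fun x hx => (aux_unique q hq lam y y' _ _ hy hz (by simp [h0]) (by simp [h0']) x hx).1

lemma aux_prim (f : ℝ → ℝ) (hf : ContinuousOn f (Icc 0 1)) :
    ∀ x ∈ Icc (0:ℝ) 1, HasDerivWithinAt (fun x => ∫ t in (0:ℝ)..x, f t) (f x) (Icc 0 1) x := by
  intro x hx
  set g : ℝ → ℝ := IccExtend (zero_le_one (α := ℝ)) ((Icc (0:ℝ) 1).domRestrict f) with hg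
  have hgc : Continuous g := (continuousOn_iff_continuous_domRestrict.1 hf).Icc_extend'
  have hgf : ∀ t ∈ Icc (0:ℝ) 1, g t = f t := fun t ht => by
    rw [hg, IccExtend_of_mem _ _ ht]; rfl
  have h1 : HasDerivWithinAt (fun x => ∫ t in (0:ℝ)..x, g t) (g x) (Icc 0 1) x :=
    (hgc.integral_hasStrictDerivAt 0 x).hasDerivAt.hasDerivWithinAt
  rw [← hgf x hx]
  have hcong : ∀ s ∈ Icc (0:ℝ) 1, (∫ t in (0:ℝ)..s, f t) = ∫ t in (0:ℝ)..s, g t := by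
    intro s hs
    refine intervalIntegral.integral_congr fun t ht => ?_
    rw [uIcc_of_le hs.1] at ht
    exact (hgf t ⟨ht.1, ht.2.trans hs.2⟩).symm
  exact h1.congr hcong (hcong x hx)

lemma aux_sin_sq_lip (a b : ℝ) : |Real.sin a ^ 2 - Real.sin b ^ 2| ≤ 2 * |a - b| := by
  have h1 : |Real.sin a - Real.sin b| ≤ |a - b| := by
    have := Real.lipschitzWith_sin.dist_le_mul a b
    simpa [Real.dist_eq] using this
  have h2 : |Real.sin a + Real.sin b| ≤ 2 :=
    (abs_add_le _ _).trans (by linarith [Real.abs_sin_le_one a, Real.abs_sin_le_one b])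
  calc |Real.sin a ^ 2 - Real.sin b ^ 2| = |Real.sin a + Real.sin b| * |Real.sin a - Real.sin b| := by
        rw [← abs_mul]; ring_nf
    _ ≤ 2 * |a - b| := mul_le_mul h2 h1 (abs_nonneg _) (by norm_num)

lemma aux_theta (q : ℝ → ℝ) (hq : ContinuousOn q (Icc 0 1)) (C : ℝ)
    (hC : ∀ x ∈ Icc (0:ℝ) 1, |q x| ≤ C) (ρ : ℝ) (hρ : 0 < ρ) :
    ∃ θ : ℝ → ℝ, θ 0 = 0 ∧ ∀ x ∈ Icc (0:ℝ) 1,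
      HasDerivWithinAt θ (ρ - q x / ρ * Real.sin (θ x) ^ 2) (Icc 0 1) x := by
  have hC0 : 0 ≤ C := (abs_nonneg _).trans (hC 0 (by simp))
  set L : NNReal := ⟨ρ + C / ρ, by positivity⟩ with hL
  set K : NNReal := ⟨C / ρ * 2, by positivity⟩ with hK
  have hpl : IsPicardLindelof (fun t (x : ℝ) => ρ - q t / ρ * Real.sin x ^ 2)
      (⟨0, by simp⟩ : Icc (0:ℝ) 1) (0:ℝ) L 0 L K := by
    refine ⟨?_, ?_, ?_, ?_⟩
    · intro t ht
      refine LipschitzOnWith.of_dist_le_mul fun a _ b _ => ?_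
      have hKv : (K : ℝ) = C / ρ * 2 := rfl
      rw [hKv, Real.dist_eq, Real.dist_eq]
      have : ρ - q t / ρ * Real.sin a ^ 2 - (ρ - q t / ρ * Real.sin b ^ 2)
        = - (q t / ρ * (Real.sin a ^ 2 - Real.sin b ^ 2)) := by ring
      rw [this, abs_neg, abs_mul, mul_assoc, abs_div, abs_of_pos hρ]
      exact mul_le_mul (by gcongr; exact hC t ht) (aux_sin_sq_lip a b) (abs_nonneg _) (by positivity)
    · intro x _
      fun_prop
    · intro t ht x _
      have hLv : (L : ℝ) = ρ + C / ρ := rfl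
      rw [hLv]
      refine (norm_sub_le _ _).trans ?_
      rw [Real.norm_eq_abs, abs_of_pos hρ, Real.norm_eq_abs, abs_mul, abs_div, abs_of_pos hρ]
      gcongr
      rw [← mul_one (C / ρ)]
      refine mul_le_mul (by gcongr; exact hC t ht) ?_ (abs_nonneg _) (by positivity)
      rw [abs_of_nonneg (sq_nonneg _)]
      exact Real.sin_sq_le_one x
    · simp
  obtain ⟨θ, h0, h1⟩ := hpl.exists_eq_forall_mem_Icc_hasDerivWithinAt₀
  exact ⟨θ, h0, h1⟩

lemma aux_prufer (q : ℝ → ℝ) (hq : ContDiffOn ℝ 1 q (Icc 0 1)) :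
    ∃ C : ℝ, 0 < C ∧ (∀ x ∈ Icc (0:ℝ) 1, |q x| ≤ C) ∧ ∀ ρ : ℝ, 1 + C ≤ ρ → ∀ y y' : ℝ → ℂ,
      IsSLSolution q ((ρ ^ 2 : ℝ) : ℂ) y y' → y 0 = 0 → y' 0 = 1 →
      ∃ θ R : ℝ → ℝ, θ 0 = 0 ∧ ContinuousOn θ (Icc 0 1) ∧ StrictMonoOn θ (Icc 0 1) ∧
        ∀ x ∈ Icc (0:ℝ) 1, y x = ((Real.exp (R x) / ρ * Real.sin (θ x) : ℝ) : ℂ) ∧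
          y' x = ((Real.exp (R x) * Real.cos (θ x) : ℝ) : ℂ) ∧ |R x| ≤ C / ρ ∧
          |θ x - ρ * x + (∫ t in (0:ℝ)..x, q t) / (2 * ρ)| ≤ C / ρ ^ 2 := by
  have hqc := hq.continuousOn
  obtain ⟨C1, hC1⟩ := isCompact_Icc.exists_bound_of_continuousOn hqc
  obtain ⟨C2, hC2⟩ := isCompact_Icc.exists_bound_of_continuousOn
    (hq.continuousOn_derivWithin (uniqueDiffOn_Icc zero_lt_one) le_rfl)
  have hqd : ∀ x ∈ Icc (0:ℝ) 1, HasDerivWithinAt q (derivWithin q (Icc 0 1) x) (Icc 0 1) x :=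
    fun x hx => (hq.differentiableOn one_ne_zero x hx).hasDerivWithinAt
  set q' := derivWithin q (Icc 0 1)
  have hC1' : 0 ≤ C1 := (norm_nonneg _).trans (hC1 0 (by simp))
  have hC2' : 0 ≤ C2 := (norm_nonneg _).trans (hC2 0 (by simp))
  refine ⟨C1 ^ 2 + C1 + C2 + 1, by positivity, fun x hx => (hC1 x hx).trans (by nlinarith), ?_⟩
  intro ρ hρC y y' hy hy0 hy0'
  have hρ1 : 1 ≤ ρ := by nlinarith
  have hρ : 0 < ρ := by linarith
  have hρC1 : C1 < ρ := by nlinarith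
  obtain ⟨θ, hθ0, hθ⟩ := aux_theta q hqc C1 hC1 ρ hρ
  have hθc : ContinuousOn θ (Icc 0 1) := fun x hx => (hθ x hx).continuousWithinAt
  have hgc : ContinuousOn (fun x => q x / ρ * (Real.sin (θ x) * Real.cos (θ x))) (Icc 0 1) := by
    fun_prop
  have hRd := aux_prim _ hgc
  set R : ℝ → ℝ := fun x => ∫ t in (0:ℝ)..x, q t / ρ * (Real.sin (θ t) * Real.cos (θ t)) with hR
  have hR0 : R 0 = 0 := by simp [hR]
  refine ⟨θ, R, hθ0, hθc, ?_, ?_⟩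
  · apply strictMonoOn_of_deriv_pos (convex_Icc 0 1) hθc
    rw [interior_Icc]
    intro x hx
    rw [((hθ x (Ioo_subset_Icc_self hx)).hasDerivAt (Icc_mem_nhds hx.1 hx.2)).deriv]
    have h1 : q x / ρ * Real.sin (θ x) ^ 2 ≤ C1 / ρ * 1 := by
      have hb := (le_abs_self _).trans (hC1 x (Ioo_subset_Icc_self hx))
      calc _ ≤ C1 / ρ * Real.sin (θ x) ^ 2 := by gcongr
        _ ≤ _ := by gcongr; exact Real.sin_sq_le_one _
    have h2 : C1 / ρ < 1 := (div_lt_one hρ).2 hρC1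
    linarith
  have hsol : IsSLSolution q ((ρ ^ 2 : ℝ) : ℂ)
      (fun x => ((Real.exp (R x) / ρ * Real.sin (θ x) : ℝ) : ℂ))
      (fun x => ((Real.exp (R x) * Real.cos (θ x) : ℝ) : ℂ)) := by
    constructor
    · intro x hx
      refine HasDerivWithinAt.ofReal_comp ?_
      have := (((hRd x hx).exp).div_const ρ).mul ((hθ x hx).sin)
      refine this.congr_deriv ?_
      have hsc := Real.sin_sq_add_cos_sq (θ x)
      field_simp
      linear_combination (0:ℝ) * hsc
    · intro x hx
      have := ((hRd x hx).exp).mul ((hθ x hx).cos)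
      have h2 : HasDerivWithinAt (fun x => Real.exp (R x) * Real.cos (θ x))
          ((q x - ρ ^ 2) * (Real.exp (R x) / ρ * Real.sin (θ x))) (Icc 0 1) x := by
        refine this.congr_deriv ?_
        have hsc := Real.sin_sq_add_cos_sq (θ x)
        field_simp
        linear_combination (Real.sin (θ x) * q x) * hsc
      refine h2.ofReal_comp.congr_deriv ?_
      push_cast
      ring
  have huni := aux_unique q hqc _ y y' _ _ hy hsol (by simp [hy0, hθ0]) (by simp [hy0', hθ0, hR0])
  intro x hx
  refine ⟨(huni x hx).1, (huni x hx).2, ?_, ?_⟩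
  · have := norm_image_sub_le_of_norm_deriv_le_segment' (C := C1 / ρ) hRd (fun t ht => by
      rw [norm_mul, norm_div, Real.norm_of_nonneg hρ.le, ← mul_one (C1 / ρ)]
      refine mul_le_mul (by gcongr; exact hC1 t ⟨ht.1, ht.2.le⟩) ?_ (norm_nonneg _) (by positivity)
      rw [norm_mul]
      exact mul_le_one₀ (Real.abs_sin_le_one _) (norm_nonneg _) (Real.abs_cos_le_one _)) x hx
    rw [hR0, sub_zero, sub_zero] at this
    refine this.trans ?_
    calc C1 / ρ * x ≤ C1 / ρ * 1 := by gcongr; exact hx.2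
      _ ≤ _ := by rw [mul_one]; gcongr; nlinarith
  · have hQ := aux_prim q hqc
    set F : ℝ → ℝ := fun x => θ x - ρ * x + (∫ t in (0:ℝ)..x, q t) / (2 * ρ)
      - 1 / (4 * ρ ^ 2) * (q x * Real.sin (2 * θ x)) with hF
    have hFd : ∀ x ∈ Icc (0:ℝ) 1, HasDerivWithinAt F
        (1 / ρ ^ 2 * (q x ^ 2 * Real.sin (θ x) ^ 2 * Real.cos (2 * θ x) / (2 * ρ)
          - q' x * Real.sin (2 * θ x) / 4)) (Icc 0 1) x := by
      intro x hx
      have := (((hθ x hx).sub ((hasDerivWithinAt_id x _).const_mul ρ)).add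
        ((hQ x hx).div_const (2 * ρ))).sub
        (((hqd x hx).mul (((hθ x hx).const_mul 2).sin)).const_mul (1 / (4 * ρ ^ 2)))
      refine this.congr_deriv ?_
      have hsc : Real.sin (θ x) ^ 2 = 1 / 2 - Real.cos (2 * θ x) / 2 := Real.sin_sq_eq_half_sub _
      rw [hsc]
      field_simp
      ring
    have hb : ∀ t ∈ Ico (0:ℝ) 1, ‖1 / ρ ^ 2 * (q t ^ 2 * Real.sin (θ t) ^ 2 * Real.cos (2 * θ t) / (2 * ρ)
          - q' t * Real.sin (2 * θ t) / 4)‖ ≤ 1 / ρ ^ 2 * (C1 ^ 2 + C2) := by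
      intro t ht
      have ht' : t ∈ Icc (0:ℝ) 1 := ⟨ht.1, ht.2.le⟩
      rw [norm_mul, Real.norm_of_nonneg (by positivity : 0 ≤ 1 / ρ ^ 2)]
      gcongr
      refine (norm_sub_le _ _).trans ?_
      have e1 : ‖q t ^ 2 * Real.sin (θ t) ^ 2 * Real.cos (2 * θ t) / (2 * ρ)‖ ≤ C1 ^ 2 := by
        rw [norm_div, norm_mul, norm_mul, norm_pow, norm_pow]
        have a1 := hC1 t ht'
        have a2 : ‖Real.sin (θ t)‖ ≤ 1 := Real.abs_sin_le_one _
        have a3 : ‖Real.cos (2 * θ t)‖ ≤ 1 := Real.abs_cos_le_one _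
        have a4 : 1 ≤ ‖2 * ρ‖ := by rw [Real.norm_of_nonneg (by positivity)]; linarith
        refine (div_le_self (by positivity) a4).trans ?_
        calc _ ≤ C1 ^ 2 * 1 ^ 2 * 1 := by gcongr
          _ = _ := by ring
      have e2 : ‖q' t * Real.sin (2 * θ t) / 4‖ ≤ C2 := by
        rw [norm_div, norm_mul]
        have a1 := hC2 t ht'
        have a2 : ‖Real.sin (2 * θ t)‖ ≤ 1 := Real.abs_sin_le_one _
        refine (div_le_self (by positivity) (by norm_num)).trans ?_
        calc _ ≤ C2 * 1 := by gcongr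
          _ = _ := by ring
      linarith
    have hFb := norm_image_sub_le_of_norm_deriv_le_segment' hFd hb x hx
    have hF0 : F 0 = 0 := by simp [hF, hθ0]
    rw [hF0, sub_zero, sub_zero] at hFb
    have e5 : ‖F x‖ ≤ 1 / ρ ^ 2 * (C1 ^ 2 + C2) := by
      refine hFb.trans ?_
      calc _ ≤ 1 / ρ ^ 2 * (C1 ^ 2 + C2) * 1 := by gcongr; exact hx.2
        _ = _ := by ring
    have e6 : ‖1 / (4 * ρ ^ 2) * (q x * Real.sin (2 * θ x))‖ ≤ 1 / ρ ^ 2 * C1 := by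
      rw [norm_mul, norm_mul, Real.norm_of_nonneg (by positivity : 0 ≤ 1 / (4 * ρ ^ 2))]
      have a1 := hC1 x hx
      have a2 : ‖Real.sin (2 * θ x)‖ ≤ 1 := Real.abs_sin_le_one _
      calc _ ≤ 1 / (1 * ρ ^ 2) * (C1 * 1) := by gcongr; norm_num
        _ = _ := by ring
    have e7 : θ x - ρ * x + (∫ t in (0:ℝ)..x, q t) / (2 * ρ)
        = F x + 1 / (4 * ρ ^ 2) * (q x * Real.sin (2 * θ x)) := by simp only [hF]; ring
    rw [e7]
    refine (norm_add_le _ _).trans ((add_le_add e5 e6).trans ?_)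
    rw [← mul_add, one_div_mul_eq_div]
    exact div_le_div_of_nonneg_right (by linarith) (by positivity)

lemma aux_count (θ : ℝ → ℝ) (hc : ContinuousOn θ (Icc 0 1)) (hm : StrictMonoOn θ (Icc 0 1))
    (h0 : θ 0 = 0) (n : ℕ) (hn : 1 ≤ n) (x : ℕ → ℝ)
    (hz : ∀ j, 1 ≤ j → j ≤ n → x j ∈ Ioo (0:ℝ) 1 ∧ Real.sin (θ (x j)) = 0)
    (hx : StrictMonoOn x (Icc 1 n))
    (hex : ∀ t ∈ Ioo (0:ℝ) 1, Real.sin (θ t) = 0 → ∃ j, 1 ≤ j ∧ j ≤ n ∧ t = x j) :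
    (∀ j, 1 ≤ j → j ≤ n → θ (x j) = j * Real.pi) ∧ n * Real.pi < θ 1 ∧
      θ 1 ≤ (n + 1) * Real.pi := by
  have hpi := Real.pi_pos
  have hmem0 : (0:ℝ) ∈ Icc (0:ℝ) 1 := by simp
  have hmem1 : (1:ℝ) ∈ Icc (0:ℝ) 1 := by simp
  have hk : ∀ j, 1 ≤ j → j ≤ n → ∃ k : ℕ, 1 ≤ k ∧ θ (x j) = k * Real.pi := by
    intro j h1 h2
    obtain ⟨hxj, hs⟩ := hz j h1 h2
    obtain ⟨k, hk⟩ := Real.sin_eq_zero_iff.1 hs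
    have hpos : 0 < θ (x j) := by
      have := hm hmem0 (Ioo_subset_Icc_self hxj) hxj.1
      rwa [h0] at this
    have hkpos : (0:ℝ) < k := by
      rw [← hk] at hpos
      exact pos_of_mul_pos_left hpos hpi.le
    have hkpos' : 0 < k := by exact_mod_cast hkpos
    lift k to ℕ using hkpos'.le
    refine ⟨k, by exact_mod_cast hkpos', ?_⟩
    rw [← hk]; simp
  have hex' : ∀ i : ℕ, 1 ≤ i → i * Real.pi < θ 1 →
      ∃ j, 1 ≤ j ∧ j ≤ n ∧ θ (x j) = i * Real.pi := by
    intro i hi hlt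
    have hpos : 0 < (i:ℝ) * Real.pi := by
      have : (0:ℝ) < i := by exact_mod_cast hi
      positivity
    have := intermediate_value_Ioo (zero_le_one (α := ℝ)) hc
    rw [h0] at this
    obtain ⟨t, ht, hti⟩ := this ⟨hpos, hlt⟩
    have hti' : θ t = i * Real.pi := hti
    obtain ⟨j, h1, h2, h3⟩ := hex t ht (by rw [hti']; exact Real.sin_nat_mul_pi i)
    exact ⟨j, h1, h2, by rw [← h3]; exact hti⟩
  have hmono : ∀ a b, 1 ≤ a → b ≤ n → a < b → θ (x a) < θ (x b) := by
    intro a b ha hb hab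
    have ha' := (hz a ha (by omega)).1
    have hb' := (hz b (by omega) hb).1
    exact hm (Ioo_subset_Icc_self ha') (Ioo_subset_Icc_self hb')
      (hx ⟨ha, by omega⟩ ⟨by omega, hb⟩ hab)
  have hlt1 : ∀ j, 1 ≤ j → j ≤ n → θ (x j) < θ 1 := by
    intro j h1 h2
    have := (hz j h1 h2).1
    exact hm (Ioo_subset_Icc_self this) hmem1 this.2
  have main : ∀ j, 1 ≤ j → j ≤ n → θ (x j) = j * Real.pi := by
    intro j
    induction j using Nat.strong_induction_on with
    | _ j ih =>
      intro h1 h2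
      obtain ⟨k, hk1, hk⟩ := hk j h1 h2
      rcases lt_trichotomy k j with h | h | h
      · have e := ih k h hk1 (by omega)
        have := hmono k j hk1 h2 h
        rw [e, hk] at this
        exact absurd this (lt_irrefl _)
      · rw [hk, h]
      · have hjk : (j:ℝ) * Real.pi < θ (x j) := by
          rw [hk]
          have : (j:ℝ) < k := by exact_mod_cast h
          gcongr
        obtain ⟨i, hi1, hi2, hi⟩ := hex' j h1 (hjk.trans (hlt1 j h1 h2))
        rw [← hi] at hjk
        have hij : i < j := by
          by_contra hcon
          rcases Nat.eq_or_lt_of_le (not_lt.1 hcon) with h | h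
          · rw [h] at hjk; exact lt_irrefl _ hjk
          · exact absurd (hmono j i h1 hi2 h) (not_lt.2 hjk.le)
        have e := ih i hij hi1 hi2
        rw [e] at hi
        have : (i:ℝ) = j := mul_right_cancel₀ hpi.ne' hi
        have : i = j := by exact_mod_cast this
        omega
  refine ⟨main, ?_, ?_⟩
  · rw [← main n hn le_rfl]; exact hlt1 n hn le_rfl
  · by_contra hcon
    push Not at hcon
    obtain ⟨i, hi1, hi2, hi⟩ := hex' (n + 1) (by omega) (by push_cast; exact hcon)
    rw [main i hi1 hi2] at hi
    have : (i:ℝ) = (n + 1 : ℕ) := mul_right_cancel₀ hpi.ne' hi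
    have : i = n + 1 := by exact_mod_cast this
    omega

lemma aux_large (q : ℝ → ℝ) (hq : ContinuousOn q (Icc 0 1)) (S S' : ℂ → ℝ → ℂ)
    (hsolS : ∀ lam : ℂ, IsSLSolution q lam (S lam) (S' lam))
    (hS0 : ∀ lam : ℂ, S lam 0 = 0) (hS'0 : ∀ lam : ℂ, S' lam 0 = 1)
    (lam : ℕ → ℂ) (X : ℕ → ℕ → ℝ) (N0 : ℕ)
    (hX : HasNodalPoints (fun l => S l) lam X (fun _ => 1) (fun n => n) N0) (B : ℝ) :
    ∃ N, ∀ n ≥ N, (lam n).im = 0 ∧ B ≤ (lam n).re := by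
  obtain ⟨C, hC⟩ := isCompact_Icc.exists_bound_of_continuousOn hq
  have hC0 : 0 ≤ C := (norm_nonneg _).trans (hC 0 (by simp))
  set K : ℝ := C + (|B| + C) with hK
  have hK0 : 0 ≤ K := by positivity
  refine ⟨max N0 (⌈K⌉₊ + 2), fun n hn => ?_⟩
  have hn0 : n ≥ N0 := (le_max_left _ _).trans hn
  have hn1 : ⌈K⌉₊ + 2 ≤ n := (le_max_right _ _).trans hn
  have hnK : K + 2 ≤ n := by
    have h1 := Nat.le_ceil K
    have h2 : ((⌈K⌉₊ + 2 : ℕ) : ℝ) ≤ n := by exact_mod_cast hn1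
    push_cast at h2
    linarith
  obtain ⟨hz, hmono, hex⟩ := hX n hn0
  simp only at hz hmono hex
  have hz1 := hz 1 le_rfl (by omega)
  obtain ⟨him, hre⟩ := aux_real q C hC (lam n) _ _ (hsolS _) (hS0 _) (hS'0 _) _ hz1.1 hz1.2
  refine ⟨him, ?_⟩
  by_contra hlt
  push Not at hlt
  have hrv := aux_real_valued q hq (lam n) him _ _ (hsolS _) (hS0 _) (hS'0 _)
  set δ : ℝ := 1 / (K + 1) with hδ
  have hδ0 : 0 < δ := by positivity
  have hgap : ∀ j, 1 ≤ j → j + 1 ≤ n → δ ≤ X n (j + 1) - X n j := by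
    intro j h1 h2
    have ha := hz j h1 (by omega)
    have hb := hz (j + 1) (by omega) h2
    have hab : X n j < X n (j + 1) := hmono ⟨h1, by omega⟩ ⟨by omega, h2⟩ (by omega)
    have hsub : Icc (X n j) (X n (j + 1)) ⊆ Icc (0:ℝ) 1 := Icc_subset_Icc ha.1.1.le hb.1.2.le
    have re_d : ∀ (g : ℝ → ℂ) (g' : ℂ) (x : ℝ), HasDerivWithinAt g g' (Icc 0 1) x →
        HasDerivWithinAt (fun s => (g s).re) g'.re (Icc 0 1) x := fun g g' x h =>
      (Complex.reCLM.hasFDerivAt (x := g x)).comp_hasDerivWithinAt x h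
    have key := aux_gap (fun x => (S (lam n) x).re) (fun x => (S' (lam n) x).re)
      (fun x => q x - (lam n).re) _ _ K hab
      (fun x hx => (re_d _ _ x ((hsolS (lam n)).1 x (hsub hx))).mono hsub)
      (fun x hx => ((re_d _ _ x ((hsolS (lam n)).2 x (hsub hx))).mono hsub).congr_deriv
        (by simp [him]))
      (fun x hx => by
        have e1 := hC x (hsub hx)
        rw [Real.norm_eq_abs, abs_le] at e1
        have e2 := le_abs_self B
        have e3 := abs_nonneg B
        rw [abs_le]
        constructor <;> linarith [e1.1, e1.2])
      (by simp [ha.2]) (by simp [hb.2])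
      (by
        by_contra hcon
        push Not at hcon
        have hmid : (X n j + X n (j + 1)) / 2 ∈ Icc (X n j) (X n (j + 1)) := by
          constructor <;> linarith
        have h0 : S (lam n) ((X n j + X n (j + 1)) / 2) = 0 := by
          rw [hrv _ (hsub hmid), hcon _ hmid]; simp
        obtain ⟨i, hi1, hi2, hi⟩ := hex _ ⟨by linarith [ha.1.1], by linarith [hb.1.2]⟩ h0
        have l1 : X n j < X n i := by rw [← hi]; linarith
        have l2 : X n i < X n (j + 1) := by rw [← hi]; linarith
        have l1' := (hmono.lt_iff_lt ⟨h1, by omega⟩ ⟨hi1, hi2⟩).1 l1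
        have l2' := (hmono.lt_iff_lt ⟨hi1, hi2⟩ ⟨by omega, h2⟩).1 l2
        omega)
    by_contra hcon
    push Not at hcon
    set d := X n (j + 1) - X n j
    have hd0 : 0 < d := by simp only [d]; linarith
    have hd : d * (K + 1) < 1 := by
      rw [hδ, lt_div_iff₀ (by positivity)] at hcon
      exact hcon
    nlinarith [mul_nonneg hK0 hd0.le]
  have hind : ∀ j, 1 ≤ j → j ≤ n → ((j:ℝ) - 1) * δ ≤ X n j := by
    intro j h1
    induction j, h1 using Nat.le_induction with
    | base => intro _; simpa using hz1.1.1.le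
    | succ j h1 ih =>
      intro h2
      have := hgap j h1 h2
      have := ih (by omega)
      push_cast
      linarith
  have h1 := hind n (by omega) le_rfl
  have h2 := (hz n (by omega) le_rfl).1.2
  have h3 : ((n:ℝ) - 1) * δ < 1 := by linarith
  rw [hδ, mul_one_div, div_lt_one (by positivity)] at h3
  linarith

lemma aux_limit (H γ ξ x0 Q0 : ℝ) (r p : ℕ) (hr : 0 < r) (hξ : ξ = p / r)
    (ρ θ1 θξ E x Q : ℕ → ℝ) (j : ℕ → ℕ)
    (hρ : Tendsto ρ atTop atTop)
    (h1 : Tendsto (fun n => ρ n * (θ1 n - ρ n)) atTop (nhds 0))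
    (h2 : Tendsto (fun n => θξ n - ρ n * ξ) atTop (nhds 0))
    (hE : Tendsto E atTop (nhds 1))
    (h3 : ∀ᶠ n in atTop, ρ n * Real.cos (θ1 n) = γ * E n * Real.sin (θξ n) - H * Real.sin (θ1 n))
    (h4 : ∀ᶠ n in atTop, ((2 * r * n : ℕ) : ℝ) * Real.pi < θ1 n ∧
      θ1 n ≤ (((2 * r * n : ℕ) : ℝ) + 1) * Real.pi)
    (h5 : Tendsto (fun n => ρ n * (j n * Real.pi - ρ n * x n + Q n / (2 * ρ n))) atTop (nhds 0))
    (hx : Tendsto x atTop (nhds x0)) (hQ : Tendsto Q atTop (nhds Q0)) :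
    Tendsto (fun n : ℕ => (((2 * r * n : ℕ) : ℝ) + 1/2)^2 * Real.pi^2 *
        (x n - (j n : ℝ) / (((2 * r * n : ℕ) : ℝ) + 1/2))) atTop
      (nhds ((γ * Real.sin (Real.pi * ξ / 2) - H) * x0 + (1/2) * Q0)) := by
  have hpi := Real.pi_pos
  have hr' : (r:ℝ) ≠ 0 := by exact_mod_cast hr.ne'
  set M : ℕ → ℝ := fun n => (((2 * r * n : ℕ) : ℝ) + 1/2) * Real.pi with hM
  set δ : ℕ → ℝ := fun n => θ1 n - M n with hδ
  have hρinv : Tendsto (fun n => (ρ n)⁻¹) atTop (nhds 0) := tendsto_inv_atTop_zero.comp hρ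
  have hρpos : ∀ᶠ n in atTop, 0 < ρ n := hρ.eventually_gt_atTop 0
  have hcos : ∀ n, Real.cos (θ1 n) = - Real.sin (δ n) := by
    intro n
    have : θ1 n = δ n + Real.pi / 2 + (r * n : ℕ) * (2 * Real.pi) := by
      simp only [hδ, hM]; push_cast; ring
    rw [this, Real.cos_add_nat_mul_two_pi, Real.cos_add_pi_div_two]
  have hsin : ∀ n, Real.sin (θ1 n) = Real.cos (δ n) := by
    intro n
    have : θ1 n = δ n + Real.pi / 2 + (r * n : ℕ) * (2 * Real.pi) := by
      simp only [hδ, hM]; push_cast; ring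
    rw [this, Real.sin_add_nat_mul_two_pi, Real.sin_add_pi_div_two]
  -- `sin δ → 0`
  have hsd : Tendsto (fun n => Real.sin (δ n)) atTop (nhds 0) := by
    have hbd : ∀ᶠ n in atTop, ‖H * Real.sin (θ1 n) - γ * E n * Real.sin (θξ n)‖ ≤ |H| + |γ| * 2 := by
      have hE2 : ∀ᶠ n in atTop, |E n| ≤ 2 := by
        have := hE.abs.eventually (eventually_le_nhds (show |(1:ℝ)| < 2 by norm_num))
        exact this
      filter_upwards [hE2] with n hn
      refine (norm_sub_le _ _).trans ?_
      rw [norm_mul, norm_mul, norm_mul]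
      have a1 : ‖Real.sin (θ1 n)‖ ≤ 1 := Real.abs_sin_le_one _
      have a2 : ‖Real.sin (θξ n)‖ ≤ 1 := Real.abs_sin_le_one _
      simp only [Real.norm_eq_abs] at *
      have b1 : |H| * |Real.sin (θ1 n)| ≤ |H| * 1 := by gcongr
      have b2 : |γ| * |E n| * |Real.sin (θξ n)| ≤ |γ| * 2 * 1 := by gcongr
      linarith
    have := hρinv.zero_mul_isBoundedUnder_le (isBoundedUnder_of_eventually_le hbd)
    refine this.congr' ?_
    filter_upwards [h3, hρpos] with n hn hp
    rw [hcos n] at hn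
    field_simp
    linarith
  have hδ0 : Tendsto δ atTop (nhds 0) := by
    have h := (Real.continuous_arcsin.tendsto 0).comp hsd
    rw [Real.arcsin_zero] at h
    refine h.congr' ?_
    filter_upwards [h4] with n hn
    simp only [Function.comp]
    apply Real.arcsin_sin
    · simp only [hδ, hM]; linarith [hn.1]
    · simp only [hδ, hM]; linarith [hn.2]
  -- `θ1 - ρ → 0`
  have h1' : Tendsto (fun n => θ1 n - ρ n) atTop (nhds 0) := by
    have := hρinv.mul h1
    rw [zero_mul] at this
    refine this.congr' ?_
    filter_upwards [hρpos] with n hp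
    field_simp
  have hsinξ : Tendsto (fun n => Real.sin (θξ n)) atTop (nhds (Real.sin (Real.pi * ξ / 2))) := by
    have ht : Tendsto (fun n => (θξ n - ρ n * ξ) - (θ1 n - ρ n) * ξ + δ n * ξ + Real.pi * ξ / 2) atTop
        (nhds (0 - 0 * ξ + 0 * ξ + Real.pi * ξ / 2)) :=
      ((h2.sub (h1'.mul_const ξ)).add (hδ0.mul_const ξ)).add_const _
    have ht' := (Real.continuous_sin.tendsto _).comp ht
    have e0 : 0 - 0 * ξ + 0 * ξ + Real.pi * ξ / 2 = Real.pi * ξ / 2 := by ring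
    rw [e0] at ht'
    refine ht'.congr fun n => ?_
    simp only [Function.comp]
    rw [← Real.sin_add_nat_mul_two_pi _ (p * n)]
    congr 1
    simp only [hδ, hM, hξ]
    push_cast
    field_simp
    ring
  have hρsin : Tendsto (fun n => ρ n * Real.sin (δ n)) atTop
      (nhds (H * 1 - γ * 1 * Real.sin (Real.pi * ξ / 2))) := by
    have hc1 : Tendsto (fun n => Real.cos (δ n)) atTop (nhds 1) := by
      have := (Real.continuous_cos.tendsto 0).comp hδ0
      rwa [Real.cos_zero] at this
    have := (hc1.const_mul H).sub ((hE.const_mul γ).mul hsinξ)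
    refine this.congr' ?_
    filter_upwards [h3] with n hn
    rw [hcos n, hsin n] at hn
    linarith
  have hρδ : Tendsto (fun n => ρ n * δ n) atTop
      (nhds (H - γ * Real.sin (Real.pi * ξ / 2))) := by
    have hs1 : Tendsto (fun n => Real.sinc (δ n)) atTop (nhds 1) := by
      have := (Real.continuous_sinc.tendsto 0).comp hδ0
      rwa [Real.sinc_zero] at this
    have := hρsin.div hs1 one_ne_zero
    have e0 : (H * 1 - γ * 1 * Real.sin (Real.pi * ξ / 2)) / 1 = H - γ * Real.sin (Real.pi * ξ / 2) := by
      ring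
    rw [e0] at this
    refine this.congr' ?_
    filter_upwards [hs1.eventually_ne one_ne_zero] with n hn
    simp only [Pi.div_apply]
    rw [div_eq_iff hn]
    by_cases hd : δ n = 0
    · simp [hd]
    · rw [Real.sinc_of_ne_zero hd]; field_simp
  -- `ρ (M - ρ) → ω`
  have hω : Tendsto (fun n => ρ n * (M n - ρ n)) atTop
      (nhds (0 - (H - γ * Real.sin (Real.pi * ξ / 2)))) := by
    refine (h1.sub hρδ).congr fun n => ?_
    simp only [hδ]; ring
  have hMρ : Tendsto (fun n => M n / ρ n) atTop (nhds 1) := by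
    have := ((hρinv.mul (hρinv.mul hω)).const_add 1)
    simp only [zero_mul, add_zero] at this
    refine this.congr' ?_
    filter_upwards [hρpos] with n hp
    field_simp
    ring
  have hfin := ((hx.mul (hMρ.mul hω)).add ((hMρ.mul hQ).div_const 2)).sub (hMρ.mul h5)
  have e0 : x0 * (1 * (0 - (H - γ * Real.sin (Real.pi * ξ / 2)))) + 1 * Q0 / 2 - 1 * 0
      = (γ * Real.sin (Real.pi * ξ / 2) - H) * x0 + (1/2) * Q0 := by ring
  rw [e0] at hfin
  refine hfin.congr' ?_
  filter_upwards [hρpos] with n hp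
  have hm : (((2 * r * n : ℕ) : ℝ) + 1/2) ≠ 0 := by positivity
  simp only [hM]
  set m : ℝ := (((2 * r * n : ℕ) : ℝ) + 1/2)
  field_simp
  ring

/-- Limit function `g`, case `h = ∞`, `H ∈ ℝ`: for the problem with `y(0) = 0` and
`y'(1) + Hy(1) - γ₁y(ξ₁) = 0`, `∫₀¹ q = 0`, `ξ₁ = p₁/r₁`, if a sequence of nodal points
`x_m^{j(m)}` with `m = 2r₁n` converges to `x₀ ∈ (0,1)`, then
`lim (m+1/2)²π²(x_m^{j(m)} - j(m)/(m+1/2)) = g(x₀) = (γ₁ sin(πξ₁/2) - H)x₀ + ½∫₀^{x₀} q`. -/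
theorem stmt_17
    (q : ℝ → ℝ) (hq : ContDiffOn ℝ 1 q (Set.Icc 0 1))
    (hint : (∫ t in (0:ℝ)..1, q t) = 0)
    (H γ1 : ℝ) (hγ1 : γ1 ≠ 0)
    (ξ1 : ℚ) (hξ1 : (ξ1:ℝ) ∈ Set.Ioo 0 1)
    (p1 r1 : ℕ) (hr1 : 0 < r1) (hfrac1 : (ξ1:ℝ) = p1 / r1)
    (S S' : ℂ → ℝ → ℂ)
    (hsolS : ∀ lam : ℂ, IsSLSolution q lam (S lam) (S' lam))
    (hS0 : ∀ lam : ℂ, S lam 0 = 0) (hS'0 : ∀ lam : ℂ, S' lam 0 = 1)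
    (Δ : ℂ → ℂ)
    (hΔ : ∀ lam : ℂ, Δ lam = Vform H γ1 ξ1 (S lam) (S' lam))
    (lam : ℕ → ℂ) (hen : EnumeratesZeros Δ lam)
    (X : ℕ → ℕ → ℝ) (N0 : ℕ)
    (hX : HasNodalPoints (fun l => S l) lam X (fun _ => 1) (fun n => n) N0)
    (x₀ : ℝ) (hx₀ : x₀ ∈ Set.Ioo (0:ℝ) 1)
    (j : ℕ → ℕ) (hj : ∀ n ≥ 1, 1 ≤ j n ∧ j n ≤ 2 * r1 * n)
    (hconv : Tendsto (fun n : ℕ => X (2 * r1 * n) (j n)) atTop (nhds x₀)) :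
    Tendsto
      (fun n : ℕ => (((2 * r1 * n : ℕ) : ℝ) + 1/2)^2 * Real.pi^2 *
        (X (2 * r1 * n) (j n) - (j n : ℝ) / (((2 * r1 * n : ℕ) : ℝ) + 1/2)))
      atTop
      (nhds ((γ1 * Real.sin (Real.pi * ξ1 / 2) - H) * x₀ +
        (1/2) * ∫ t in (0:ℝ)..x₀, q t)) := by
  have hqc := hq.continuousOn
  obtain ⟨C, hC0, -, hP⟩ := aux_prufer q hq
  have hlarge := aux_large q hqc S S' hsolS hS0 hS'0 lam X N0 hX
  obtain ⟨N, hN⟩ := hlarge ((1 + C) ^ 2)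
  set ρ : ℕ → ℝ := fun k => Real.sqrt (lam k).re with hρdef
  set N1 := max (max N0 N) 1 with hN1
  have hdata : ∀ k, ∃ θ R : ℝ → ℝ, N1 ≤ k → 0 < ρ k ∧
      (∀ x ∈ Icc (0:ℝ) 1, S (lam k) x = ((Real.exp (R x) / ρ k * Real.sin (θ x) : ℝ) : ℂ) ∧
          S' (lam k) x = ((Real.exp (R x) * Real.cos (θ x) : ℝ) : ℂ) ∧ |R x| ≤ C / ρ k ∧
          |θ x - ρ k * x + (∫ t in (0:ℝ)..x, q t) / (2 * ρ k)| ≤ C / ρ k ^ 2) ∧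
      (∀ i, 1 ≤ i → i ≤ k → θ (X k i) = i * Real.pi) ∧ k * Real.pi < θ 1 ∧
      θ 1 ≤ (k + 1) * Real.pi := by
    intro k
    by_cases hk : N1 ≤ k
    swap
    · exact ⟨0, 0, fun h => absurd h hk⟩
    have hkN0 : k ≥ N0 := ((le_max_left _ _).trans (le_max_left _ _)).trans hk
    have hkN : k ≥ N := ((le_max_right _ _).trans (le_max_left _ _)).trans hk
    have hk1 : 1 ≤ k := (le_max_right _ _).trans hk
    obtain ⟨him, hre⟩ := hN k hkN
    have hρC : 1 + C ≤ ρ k := Real.le_sqrt_of_sq_le hre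
    have hρ0 : 0 < ρ k := by linarith
    have hsq : ρ k ^ 2 = (lam k).re := Real.sq_sqrt ((sq_nonneg _).trans hre)
    have hlam : ((ρ k ^ 2 : ℝ) : ℂ) = lam k := by
      rw [hsq]; apply Complex.ext <;> simp [him]
    obtain ⟨θ, R, hθ0, hθc, hθm, hθ⟩ := hP (ρ k) hρC (S (lam k)) (S' (lam k))
      (by rw [hlam]; exact hsolS _) (hS0 _) (hS'0 _)
    have hzero : ∀ x ∈ Icc (0:ℝ) 1, S (lam k) x = 0 ↔ Real.sin (θ x) = 0 := by
      intro x hx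
      rw [(hθ x hx).1]
      have : Real.exp (R x) / ρ k ≠ 0 := by positivity
      rw [Complex.ofReal_eq_zero, mul_eq_zero, or_iff_right this]
    obtain ⟨hz, hmono, hex⟩ := hX k hkN0
    simp only at hz hmono hex
    have hcount := aux_count θ hθc hθm hθ0 k hk1 (X k)
      (fun i h1 h2 => ⟨(hz i h1 h2).1, (hzero _ (Ioo_subset_Icc_self (hz i h1 h2).1)).1 (hz i h1 h2).2⟩)
      hmono (fun t ht hs => hex t ht ((hzero t (Ioo_subset_Icc_self ht)).2 hs))
    exact ⟨θ, R, fun _ => ⟨hρ0, hθ, hcount⟩⟩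
  choose θ R hD using hdata
  set m : ℕ → ℕ := fun n => 2 * r1 * n with hm
  have hmn : ∀ n, n ≤ m n := fun n => by
    simp only [hm]; nlinarith
  have hmt : Tendsto m atTop atTop := tendsto_atTop_mono hmn tendsto_id
  have hev : ∀ᶠ n in atTop, N1 ≤ m n := hmt.eventually_ge_atTop N1
  have hρt0 : Tendsto ρ atTop atTop := by
    rw [tendsto_atTop]
    intro b
    obtain ⟨N', hN'⟩ := hlarge (b ^ 2)
    filter_upwards [eventually_ge_atTop N'] with k hk
    exact Real.le_sqrt_of_sq_le (hN' k hk).2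
  have hρt : Tendsto (fun n => ρ (m n)) atTop atTop := hρt0.comp hmt
  have hinv : Tendsto (fun n => C / ρ (m n)) atTop (nhds 0) := hρt.const_div_atTop C
  have hξI : (ξ1:ℝ) ∈ Icc (0:ℝ) 1 := Ioo_subset_Icc_self hξ1
  have h1I : (1:ℝ) ∈ Icc (0:ℝ) 1 := by simp
  have hbd : ∀ (r e : ℝ), 0 < r → |e| ≤ C / r ^ 2 → ‖r * e‖ ≤ C / r := by
    intro r e hr he
    rw [norm_mul, Real.norm_of_nonneg hr.le]
    calc r * ‖e‖ ≤ r * (C / r ^ 2) := by gcongr; exact he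
      _ = C / r := by field_simp
  have hxev : ∀ᶠ n in atTop, X (m n) (j n) ∈ Ioo (0:ℝ) 1 :=
    hconv.eventually (isOpen_Ioo.mem_nhds hx₀)
  refine aux_limit H γ1 ξ1 x₀ (∫ t in (0:ℝ)..x₀, q t) r1 p1 hr1 hfrac1 (fun n => ρ (m n))
    (fun n => θ (m n) 1) (fun n => θ (m n) ξ1)
    (fun n => Real.exp (R (m n) ξ1 - R (m n) 1)) (fun n => X (m n) (j n))
    (fun n => ∫ t in (0:ℝ)..X (m n) (j n), q t) j hρt ?_ ?_ ?_ ?_ ?_ ?_ hconv ?_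
  · refine squeeze_zero_norm' ?_ hinv
    filter_upwards [hev] with n hn
    obtain ⟨hp, hx, -⟩ := hD (m n) hn
    apply hbd _ _ hp
    have := (hx 1 h1I).2.2.2
    rw [hint] at this
    simpa using this
  · have hsum : Tendsto (fun n => ρ (m n) * (θ (m n) ξ1 - ρ (m n) * ξ1
        + (∫ t in (0:ℝ)..ξ1, q t) / (2 * ρ (m n)))) atTop (nhds 0) := by
      refine squeeze_zero_norm' ?_ hinv
      filter_upwards [hev] with n hn
      obtain ⟨hp, hx, -⟩ := hD (m n) hn
      exact hbd _ _ hp (hx ξ1 hξI).2.2.2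
    have hρinv : Tendsto (fun n => (ρ (m n))⁻¹) atTop (nhds 0) := tendsto_inv_atTop_zero.comp hρt
    have := (hρinv.mul hsum).sub (hρinv.mul_const ((∫ t in (0:ℝ)..ξ1, q t) / 2))
    simp only [zero_mul, sub_zero] at this
    refine this.congr' ?_
    filter_upwards [hev] with n hn
    have hp := (hD (m n) hn).1
    field_simp
    ring
  · have hR : ∀ x ∈ Icc (0:ℝ) 1, Tendsto (fun n => R (m n) x) atTop (nhds 0) := by
      intro x hx
      refine squeeze_zero_norm' ?_ hinv
      filter_upwards [hev] with n hn
      exact ((hD (m n) hn).2.1 x hx).2.2.1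
    have := (Real.continuous_exp.tendsto _).comp ((hR ξ1 hξI).sub (hR 1 h1I))
    rw [sub_zero, Real.exp_zero] at this
    exact this
  · filter_upwards [hev] with n hn
    obtain ⟨hp, hx, -⟩ := hD (m n) hn
    have hzero := hen.2.1 (m n)
    rw [hΔ, Vform, (hx 1 h1I).1, (hx 1 h1I).2.1, (hx ξ1 hξI).1] at hzero
    have hz : Real.exp (R (m n) 1) * Real.cos (θ (m n) 1)
        + H * (Real.exp (R (m n) 1) / ρ (m n) * Real.sin (θ (m n) 1))
        - γ1 * (Real.exp (R (m n) ξ1) / ρ (m n) * Real.sin (θ (m n) ξ1)) = 0 := by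
      exact_mod_cast hzero
    have he := Real.exp_pos (R (m n) 1)
    rw [Real.exp_sub]
    field_simp at hz ⊢
    linarith
  · filter_upwards [hev] with n hn
    exact (hD (m n) hn).2.2.2
  · refine squeeze_zero_norm' ?_ hinv
    filter_upwards [hev, hxev, eventually_ge_atTop 1] with n hn hxn hn1
    obtain ⟨hp, hx, hc, -⟩ := hD (m n) hn
    apply hbd _ _ hp
    have := (hx _ (Ioo_subset_Icc_self hxn)).2.2.2
    rwa [hc (j n) (hj n hn1).1 (hj n hn1).2] at this
  · have hd := (aux_prim q hqc x₀ (Ioo_subset_Icc_self hx₀)).hasDerivAt (Icc_mem_nhds hx₀.1 hx₀.2)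
    exact hd.continuousAt.tendsto.comp hconv
end
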